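/- arXiv:1302.2421 — 2 statements merged into one kernel-verified Lean document; each statement's English description precedes it below -/
import Mathlib

section
/- For every f in the class 𝓕, there exists a homogeneously multifractal (HM), strictly monotone increasing, continuous function Z : [0,1] → ℝ such that: (1) for all h ∈ Support*(f) \ {1}, d_Z(h) = max(f(h), 0); (2) d_Z(h) = −∞ for all h ∈ [0,∞) \ Support*(f); (3) the set {x ∈ [0,1] : h_Z(x) = 1} has Lebesgue measure 1 (so d_Z(1) = 1). -/
open MeasureTheory Metric Filter Set
open scoped ENNReal Topology
open Classical

/-- `Z ∈ C^α(x₀)`: there are a polynomial `P` of degree less than `α` and a constant `C > 0`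
such that `|Z x - P (x - x₀)| ≤ C |x - x₀| ^ α` in a neighborhood of `x₀`. -/
def HolderAt (Z : ℝ → ℝ) (α : ℝ) (x₀ : ℝ) : Prop :=
  ∃ (P : Polynomial ℝ) (C δ : ℝ), 0 < C ∧ 0 < δ ∧
    (P = 0 ∨ (P.natDegree : ℝ) < α) ∧
    ∀ x : ℝ, |x - x₀| < δ → |Z x - P.eval (x - x₀)| ≤ C * |x - x₀| ^ α

/-- The pointwise Hölder exponent `h_Z(x₀) = sup {α ≥ 0 : Z ∈ C^α(x₀)}`. -/
noncomputable def holderExp (Z : ℝ → ℝ) (x₀ : ℝ) : EReal :=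
  sSup {h : EReal | ∃ α : ℝ, 0 ≤ α ∧ HolderAt Z α x₀ ∧ h = (α : EReal)}

/-- Hausdorff dimension of a set, with the convention `dim ∅ = -∞`. -/
noncomputable def dimHE (s : Set ℝ) : EReal :=
  if s.Nonempty then ((dimH s : ℝ≥0∞) : EReal) else ⊥

/-- The multifractal spectrum of a function on `[0,1]`:
`d_Z(h) = dim_H {x ∈ [0,1] : h_Z(x) = h}`, with `dim ∅ = -∞`. -/
noncomputable def specF (Z : ℝ → ℝ) (h : EReal) : EReal :=
  dimHE {x ∈ Set.Icc (0:ℝ) 1 | holderExp Z x = h}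

/-- A function on `[0,1]` is homogeneously multifractal (HM) if its restriction to any
non-degenerate subinterval of `[0,1]` has the same multifractal spectrum as `Z` itself. -/
def IsHMF (Z : ℝ → ℝ) : Prop :=
  ∀ a b : ℝ, 0 ≤ a → a < b → b ≤ 1 →
    ∀ h : EReal, dimHE {x ∈ Set.Ioo a b | holderExp Z x = h} = specF Z h

/-- The class `𝓕` of admissible spectra: suprema of countably many step functions `f_n`,
each supported by a closed subinterval `Iₙ ⊆ [0,1]`, bounded away from `0` uniformly,
constant (with value `vₙ ∈ [0,1]`) on `Iₙ`, with `fₙ(x) ≤ x` on `Iₙ`, and `f = sup_n fₙ`. -/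
def MemF (f : ℝ → EReal) : Prop :=
  ∃ (I : ℕ → Set ℝ) (v : ℕ → EReal),
    (∀ n, ∃ a b : ℝ, a ≤ b ∧ I n = Set.Icc a b) ∧
    (∀ n, I n ⊆ Set.Icc (0:ℝ) 1) ∧
    (∃ c : ℝ, 0 < c ∧ ∀ n, ∀ x ∈ I n, c ≤ x) ∧
    (∀ n, 0 ≤ v n ∧ v n ≤ 1) ∧
    (∀ n, ∀ x ∈ I n, v n ≤ (x : EReal)) ∧
    (∀ x : ℝ, f x = ⨆ n, (if x ∈ I n then v n else ⊥))

/-! ### A Lipschitz increasing function which is nowhere better than Lipschitz -/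

/-- The `i`-th oscillating term of the lacunary series defining `baseFun`. -/
noncomputable def wiggle (i : ℕ) (x : ℝ) : ℝ :=
  (1 / 2) ^ i / 4 ^ (i ^ 2) * Real.sin (Real.pi * 4 ^ (i ^ 2) * x)

/-- A bi-Lipschitz increasing function whose pointwise Hölder exponent is `1` everywhere. -/
noncomputable def baseFun (x : ℝ) : ℝ := 7 * x + ∑' i, wiggle i x

lemma abs_wiggle_le (i : ℕ) (x : ℝ) : |wiggle i x| ≤ (1 / 2) ^ i := by
  unfold wiggle
  rw [abs_mul, abs_of_pos (by positivity)]
  have h1 : |Real.sin (Real.pi * 4 ^ (i ^ 2) * x)| ≤ 1 := Real.abs_sin_le_one _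
  have h2 : (1 / 2 : ℝ) ^ i / 4 ^ (i ^ 2) ≤ (1 / 2) ^ i :=
    div_le_self (by positivity) (one_le_pow₀ (by norm_num))
  calc _ ≤ (1 / 2 : ℝ) ^ i / 4 ^ (i ^ 2) * 1 := by gcongr
    _ ≤ _ := by simpa using h2

lemma summable_wiggle (x : ℝ) : Summable fun i => wiggle i x :=
  Summable.of_norm_bounded (summable_geometric_of_lt_one (by norm_num) (by norm_num))
    (fun i => abs_wiggle_le i x)

lemma abs_wiggle_sub_le (i : ℕ) (x y : ℝ) :
    |wiggle i y - wiggle i x| ≤ (1 / 2) ^ i * (Real.pi * |y - x|) := by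
  unfold wiggle
  rw [← mul_sub, abs_mul, abs_of_pos (by positivity)]
  have h1 : |Real.sin (Real.pi * 4 ^ (i ^ 2) * y) - Real.sin (Real.pi * 4 ^ (i ^ 2) * x)| ≤
      |Real.pi * 4 ^ (i ^ 2) * y - Real.pi * 4 ^ (i ^ 2) * x| := Real.abs_sin_sub_sin_le _ _
  rw [← mul_sub, abs_mul, abs_of_pos (by positivity : 0 < Real.pi * 4 ^ (i ^ 2))] at h1
  calc _ ≤ (1 / 2 : ℝ) ^ i / 4 ^ (i ^ 2) * (Real.pi * 4 ^ (i ^ 2) * |y - x|) := by gcongr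
    _ = _ := by field_simp

lemma abs_tsum_wiggle_sub_le (x y : ℝ) :
    |∑' i, wiggle i y - ∑' i, wiggle i x| ≤ 6.3 * |y - x| := by
  rw [← (summable_wiggle y).tsum_sub (summable_wiggle x)]
  have h : HasSum (fun i : ℕ => (1 / 2 : ℝ) ^ i * (Real.pi * |y - x|)) (2 * (Real.pi * |y - x|)) :=
    hasSum_geometric_two.mul_right _
  have := tsum_of_norm_bounded (f := fun i => wiggle i y - wiggle i x) h
    (fun i => abs_wiggle_sub_le i x y)
  rw [Real.norm_eq_abs] at this
  have hpi := Real.pi_lt_d2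
  nlinarith [abs_nonneg (y - x)]

lemma baseFun_strictMono : StrictMono baseFun := by
  intro x y hxy
  have h := abs_le.1 (abs_tsum_wiggle_sub_le x y)
  rw [abs_of_pos (sub_pos.2 hxy)] at h
  unfold baseFun
  linarith [h.1]

lemma abs_baseFun_sub_le (x y : ℝ) : |baseFun y - baseFun x| ≤ 14 * |y - x| := by
  have h := abs_tsum_wiggle_sub_le x y
  have : baseFun y - baseFun x = 7 * (y - x) + (∑' i, wiggle i y - ∑' i, wiggle i x) := by
    unfold baseFun; ring
  rw [this]
  calc _ ≤ |7 * (y - x)| + 6.3 * |y - x| := (abs_add_le _ _).trans (by gcongr)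
    _ ≤ _ := by rw [abs_mul]; norm_num; nlinarith [abs_nonneg (y - x)]

lemma continuous_baseFun : Continuous baseFun := by
  have : LipschitzWith 14 baseFun := LipschitzWith.of_dist_le_mul fun x y => by
    simpa [Real.dist_eq] using abs_baseFun_sub_le y x
  exact this.continuous

lemma wiggle_second_difference (i : ℕ) (x u : ℝ) :
    wiggle i (x + 2 * u) - 2 * wiggle i (x + u) + wiggle i x =
      (1 / 2) ^ i / 4 ^ (i ^ 2) * (2 * Real.sin (Real.pi * 4 ^ (i ^ 2) * (x + u)) *
        (Real.cos (Real.pi * 4 ^ (i ^ 2) * u) - 1)) := by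
  unfold wiggle
  set t := Real.pi * 4 ^ (i ^ 2) * u with ht
  set s := Real.pi * 4 ^ (i ^ 2) * (x + u) with hs
  have h1 : Real.pi * 4 ^ (i ^ 2) * (x + 2 * u) = s + t := by rw [hs, ht]; ring
  have h2 : Real.pi * 4 ^ (i ^ 2) * x = s - t := by rw [hs, ht]; ring
  rw [h1, h2, Real.sin_add, Real.sin_sub]
  ring

lemma abs_wiggle_second_difference_le {i k : ℕ} (hik : i < k) (x u : ℝ) (hu0 : 0 ≤ u)
    (hu : u ≤ 1 / 4 ^ (k ^ 2)) :
    |wiggle i (x + 2 * u) - 2 * wiggle i (x + u) + wiggle i x| ≤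
      (1 / 2) ^ i * (40 * (1 / 16) ^ k / 4 ^ (k ^ 2)) := by
  rw [wiggle_second_difference, abs_mul, abs_of_pos (by positivity), abs_mul, abs_mul]
  have h1 : |Real.sin (Real.pi * 4 ^ (i ^ 2) * (x + u))| ≤ 1 := Real.abs_sin_le_one _
  have h2 : |Real.cos (Real.pi * 4 ^ (i ^ 2) * u) - 1| ≤ (Real.pi * 4 ^ (i ^ 2) * u) ^ 2 / 2 := by
    rw [abs_sub_comm, abs_of_nonneg (by linarith [Real.cos_le_one (Real.pi * 4 ^ (i ^ 2) * u)])]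
    linarith [Real.one_sub_sq_div_two_le_cos (x := Real.pi * 4 ^ (i ^ 2) * u)]
  have hpi : Real.pi ^ 2 ≤ 10 := by nlinarith [Real.pi_lt_d2, Real.pi_pos]
  have hq : (4 : ℝ) ^ (i ^ 2) * 16 ^ k ≤ 4 * 4 ^ (k ^ 2) := by
    have : (16 : ℝ) ^ k = 4 ^ (2 * k) := by rw [pow_mul]; norm_num
    rw [this, ← pow_add, ← pow_succ']
    apply pow_le_pow_right₀ (by norm_num)
    nlinarith
  have hu2 : u ^ 2 ≤ (1 / 4 ^ (k ^ 2)) ^ 2 := by gcongr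
  calc (1 / 2 : ℝ) ^ i / 4 ^ (i ^ 2) * (|2| * |Real.sin (Real.pi * 4 ^ (i ^ 2) * (x + u))| *
        |Real.cos (Real.pi * 4 ^ (i ^ 2) * u) - 1|)
      ≤ (1 / 2 : ℝ) ^ i / 4 ^ (i ^ 2) * (|2| * 1 * ((Real.pi * 4 ^ (i ^ 2) * u) ^ 2 / 2)) := by
        gcongr
    _ = (1 / 2 : ℝ) ^ i * (Real.pi ^ 2 * 4 ^ (i ^ 2) * u ^ 2) := by
        rw [abs_of_pos (by norm_num)]; field_simp
    _ ≤ (1 / 2 : ℝ) ^ i * (10 * 4 ^ (i ^ 2) * (1 / 4 ^ (k ^ 2)) ^ 2) := by gcongr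
    _ ≤ _ := by
        gcongr
        rw [one_div, one_div, inv_pow, inv_pow, ← div_eq_mul_inv, ← div_eq_mul_inv, div_div,
          div_le_div_iff₀ (by positivity) (by positivity)]
        nlinarith [pow_pos (show (0 : ℝ) < 4 by norm_num) (k ^ 2)]

lemma wiggle_second_difference_eq_zero {i k : ℕ} (hik : k < i) (x u : ℝ)
    (hu : u = 1 / 4 ^ (k ^ 2) ∨ u = 1 / 4 ^ (k ^ 2) / 2) :
    wiggle i (x + 2 * u) - 2 * wiggle i (x + u) + wiggle i x = 0 := by
  rw [wiggle_second_difference]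
  obtain ⟨d, hd⟩ : ∃ d, i ^ 2 = k ^ 2 + (d + 1) :=
    ⟨i ^ 2 - k ^ 2 - 1, by have : k ^ 2 < i ^ 2 := Nat.pow_lt_pow_left hik (by norm_num)
                           omega⟩
  have hcos : Real.cos (Real.pi * 4 ^ (i ^ 2) * u) = 1 := by
    rw [hd, pow_add]
    rcases hu with rfl | rfl
    · have := Real.cos_nat_mul_two_pi (2 * 4 ^ d)
      push_cast at this
      convert this using 2
      field_simp
      ring
    · have := Real.cos_nat_mul_two_pi (4 ^ d)
      push_cast at this
      convert this using 2
      field_simp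
      ring
  rw [hcos]; ring

lemma exists_le_abs_wiggle_second_difference (k : ℕ) (x : ℝ) :
    ∃ u, (u = 1 / 4 ^ (k ^ 2) ∨ u = 1 / 4 ^ (k ^ 2) / 2) ∧
      (1 / 2) ^ k / 4 ^ (k ^ 2) ≤ |wiggle k (x + 2 * u) - 2 * wiggle k (x + u) + wiggle k x| := by
  set θ := Real.pi * 4 ^ (k ^ 2) * x with hθ
  by_cases h : 1 / 4 ≤ |Real.sin θ|
  · refine ⟨_, Or.inl rfl, ?_⟩
    rw [wiggle_second_difference, abs_mul, abs_of_pos (by positivity)]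
    have h1 : Real.pi * 4 ^ (k ^ 2) * (x + 1 / 4 ^ (k ^ 2)) = θ + Real.pi := by
      rw [hθ]; field_simp
    have h2 : Real.pi * 4 ^ (k ^ 2) * (1 / 4 ^ (k ^ 2)) = Real.pi := by field_simp
    rw [h1, h2, Real.sin_add_pi, Real.cos_pi]
    apply le_mul_of_one_le_right (by positivity)
    have : 2 * -Real.sin θ * (-1 - 1) = 4 * Real.sin θ := by ring
    rw [this, abs_mul, abs_of_pos (by norm_num)]
    linarith
  · refine ⟨_, Or.inr rfl, ?_⟩
    rw [wiggle_second_difference, abs_mul, abs_of_pos (by positivity)]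
    have h1 : Real.pi * 4 ^ (k ^ 2) * (x + 1 / 4 ^ (k ^ 2) / 2) = θ + Real.pi / 2 := by
      rw [hθ]; field_simp
    have h2 : Real.pi * 4 ^ (k ^ 2) * (1 / 4 ^ (k ^ 2) / 2) = Real.pi / 2 := by field_simp
    rw [h1, h2, Real.sin_add_pi_div_two, Real.cos_pi_div_two]
    apply le_mul_of_one_le_right (by positivity)
    have : 2 * Real.cos θ * (0 - 1) = -(2 * Real.cos θ) := by ring
    rw [this, abs_neg, abs_mul, abs_of_pos (by norm_num : (0 : ℝ) < 2)]
    push Not at h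
    have h3 := Real.sin_sq_add_cos_sq θ
    by_contra! hc
    have : |Real.cos θ| < 1 / 2 := by linarith
    nlinarith [sq_abs (Real.cos θ), sq_abs (Real.sin θ), abs_nonneg (Real.cos θ),
      abs_nonneg (Real.sin θ)]

lemma exists_le_abs_baseFun_second_difference {k : ℕ} (hk : 3 ≤ k) (x : ℝ) :
    ∃ u, 0 < u ∧ u ≤ 1 / 4 ^ (k ^ 2) ∧ (1 / 2) ^ (k + 1) / 4 ^ (k ^ 2) ≤
      |baseFun (x + 2 * u) - 2 * baseFun (x + u) + baseFun x| := by
  obtain ⟨u, hu, hmain⟩ := exists_le_abs_wiggle_second_difference k x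
  have hu0 : 0 < u := by rcases hu with rfl | rfl <;> positivity
  have hu1 : u ≤ 1 / 4 ^ (k ^ 2) := by
    rcases hu with rfl | rfl
    · exact le_rfl
    · exact half_le_self (by positivity)
  refine ⟨u, hu0, hu1, ?_⟩
  set D : ℕ → ℝ := fun i => wiggle i (x + 2 * u) - 2 * wiggle i (x + u) + wiggle i x with hD
  have hsum : baseFun (x + 2 * u) - 2 * baseFun (x + u) + baseFun x = ∑' i, D i := by
    have := (((summable_wiggle (x + 2 * u)).hasSum.sub
      ((summable_wiggle (x + u)).hasSum.mul_left 2)).add (summable_wiggle x).hasSum).tsum_eq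
    rw [hD, this]; unfold baseFun; ring
  have hfin : ∑' i, D i = ∑ i ∈ Finset.range (k + 1), D i := by
    apply tsum_eq_sum
    intro i hi
    rw [Finset.mem_range, not_lt] at hi
    exact wiggle_second_difference_eq_zero (by omega) x u hu
  rw [hsum, hfin, Finset.sum_range_succ]
  have hlow : |∑ i ∈ Finset.range k, D i| ≤ 80 * (1 / 16) ^ k / 4 ^ (k ^ 2) := by
    calc |∑ i ∈ Finset.range k, D i| ≤ ∑ i ∈ Finset.range k, |D i| :=
          Finset.abs_sum_le_sum_abs _ _
      _ ≤ ∑ i ∈ Finset.range k, (1 / 2 : ℝ) ^ i * (40 * (1 / 16) ^ k / 4 ^ (k ^ 2)) :=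
          Finset.sum_le_sum fun i hi =>
            abs_wiggle_second_difference_le (Finset.mem_range.1 hi) x u hu0.le hu1
      _ = (∑ i ∈ Finset.range k, (1 / 2 : ℝ) ^ i) * (40 * (1 / 16) ^ k / 4 ^ (k ^ 2)) := by
          rw [Finset.sum_mul]
      _ ≤ 2 * (40 * (1 / 16) ^ k / 4 ^ (k ^ 2)) := by
          gcongr
          exact sum_geometric_two_le k
      _ = _ := by ring
  have hcmp : 80 * (1 / 16 : ℝ) ^ k / 4 ^ (k ^ 2) ≤ (1 / 2) ^ (k + 1) / 4 ^ (k ^ 2) := by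
    gcongr
    have h16 : (1 / 16 : ℝ) ^ k = (1 / 8) ^ k * (1 / 2) ^ k := by
      rw [← mul_pow]; norm_num
    have h8 : (1 / 8 : ℝ) ^ k ≤ (1 / 8) ^ 3 :=
      pow_le_pow_of_le_one (by norm_num) (by norm_num) hk
    rw [h16, pow_succ]
    have : (0 : ℝ) < (1 / 2) ^ k := by positivity
    nlinarith
  have htri : |D k| ≤ |∑ i ∈ Finset.range k, D i + D k| + |∑ i ∈ Finset.range k, D i| := by
    have := abs_sub (∑ i ∈ Finset.range k, D i + D k) (∑ i ∈ Finset.range k, D i)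
    simpa using this
  have hmain' : (1 / 2 : ℝ) ^ k / 4 ^ (k ^ 2) = 2 * ((1 / 2) ^ (k + 1) / 4 ^ (k ^ 2)) := by
    rw [pow_succ]; ring
  linarith

/-- Right difference quotients of `baseFun` at any point converge slower than any power. -/
lemma exists_slope_baseFun (x : ℝ) {ε δ : ℝ} (hε : 0 < ε) (hδ : 0 < δ) :
    ∃ u, 0 < u ∧ 2 * u < δ ∧ (3 * u) ^ ε <
      |(baseFun (x + u) - baseFun x) / u - (baseFun (x + 2 * u) - baseFun x) / (2 * u)| := by
  obtain ⟨k, hk⟩ := exists_nat_gt (max 3 (max (1 + 1 / ε) (2 / δ)))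
  have hk3 : 3 ≤ k := by
    have : (3 : ℝ) < k := (le_max_left _ _).trans_lt hk
    exact_mod_cast this.le
  have hkε : 1 + 1 / ε < k := ((le_max_left _ _).trans (le_max_right _ _)).trans_lt hk
  have hkδ : 2 / δ < k := ((le_max_right _ _).trans (le_max_right _ _)).trans_lt hk
  obtain ⟨u, hu0, hu1, hu⟩ := exists_le_abs_baseFun_second_difference hk3 x
  have hkpos : (0 : ℝ) < k := by positivity
  have hpow : (k : ℝ) ≤ 4 ^ (k ^ 2) := by
    have h1 : k < 4 ^ k := Nat.lt_pow_self (by norm_num)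
    have h2 : 4 ^ k ≤ 4 ^ (k ^ 2) := Nat.pow_le_pow_right (by norm_num) (by nlinarith)
    exact_mod_cast (h1.le.trans h2)
  refine ⟨u, hu0, ?_, ?_⟩
  · have : 1 / (4 : ℝ) ^ (k ^ 2) ≤ 1 / k := one_div_le_one_div_of_le hkpos hpow
    have h2 : 2 / (k : ℝ) < δ := by
      rw [div_lt_iff₀ hδ] at hkδ
      rw [div_lt_iff₀ hkpos]; linarith
    calc 2 * u ≤ 2 * (1 / k) := by linarith
      _ = 2 / k := by ring
      _ < δ := h2
  · have hslope : (baseFun (x + u) - baseFun x) / u - (baseFun (x + 2 * u) - baseFun x) / (2 * u)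
        = -((baseFun (x + 2 * u) - 2 * baseFun (x + u) + baseFun x) / (2 * u)) := by
      field_simp; ring
    rw [hslope, abs_neg, abs_div, abs_of_pos (by positivity : 0 < 2 * u)]
    have hge : (1 / 2 : ℝ) ^ (k + 2) ≤
        |baseFun (x + 2 * u) - 2 * baseFun (x + u) + baseFun x| / (2 * u) := by
      rw [le_div_iff₀ (by positivity)]
      calc (1 / 2 : ℝ) ^ (k + 2) * (2 * u) ≤ (1 / 2) ^ (k + 2) * (2 * (1 / 4 ^ (k ^ 2))) := by
            gcongr
        _ = (1 / 2) ^ (k + 1) / 4 ^ (k ^ 2) := by rw [pow_succ _ (k + 1)]; ring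
        _ ≤ _ := hu
    refine lt_of_lt_of_le ?_ hge
    have hk2 : 1 ≤ k ^ 2 := Nat.one_le_pow _ _ (by omega)
    have h3u : 3 * u ≤ (2 : ℝ) ^ (-(2 * ((k : ℝ) ^ 2 - 1))) := by
      have : (2 : ℝ) ^ (-(2 * ((k : ℝ) ^ 2 - 1))) = 4 * (1 / 4 ^ (k ^ 2)) := by
        rw [show -(2 * ((k : ℝ) ^ 2 - 1)) = 2 * (1 - ((k ^ 2 : ℕ) : ℝ)) by push_cast; ring,
          Real.rpow_mul (by norm_num), Real.rpow_sub (by positivity), Real.rpow_natCast]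
        norm_num
        ring
      rw [this]
      linarith
    calc (3 * u) ^ ε ≤ ((2 : ℝ) ^ (-(2 * ((k : ℝ) ^ 2 - 1)))) ^ ε := by gcongr
      _ = (2 : ℝ) ^ (-(2 * ((k : ℝ) ^ 2 - 1)) * ε) := by rw [← Real.rpow_mul (by norm_num)]
      _ < (2 : ℝ) ^ (-((k + 2 : ℕ) : ℝ)) := by
          apply Real.rpow_lt_rpow_of_exponent_lt (by norm_num)
          have h1 : 1 < (k - 1) * ε := by
            have : 1 / ε < k - 1 := by linarith
            rwa [div_lt_iff₀ hε] at this
          push_cast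
          nlinarith
      _ = (1 / 2 : ℝ) ^ (k + 2) := by
          rw [Real.rpow_neg (by norm_num), Real.rpow_natCast, one_div, inv_pow]

/-! ### Pointwise Hölder regularity -/

lemma holderAt_of_isBigO {Z : ℝ → ℝ} {α x : ℝ} (hα : 0 < α)
    (h : (fun y => Z y - Z x) =O[𝓝 x] fun y => |y - x| ^ α) : HolderAt Z α x := by
  obtain ⟨C, hC, h⟩ := h.exists_pos
  obtain ⟨δ, hδ, h⟩ := Metric.eventually_nhds_iff.1 h.bound
  refine ⟨Polynomial.C (Z x), C, δ, hC, hδ, Or.inr (by simpa using hα), fun y hy => ?_⟩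
  have := h (by simpa [Real.dist_eq] using hy)
  rw [Real.norm_eq_abs, Real.norm_eq_abs, abs_of_nonneg (by positivity : 0 ≤ |y - x| ^ α)] at this
  simpa using this

lemma HolderAt.eq_eval_zero {Z : ℝ → ℝ} {α x C : ℝ} {P : Polynomial ℝ} (hα : 0 < α)
    (h : |Z x - P.eval (x - x)| ≤ C * |x - x| ^ α) : Z x = P.eval 0 := by
  simp only [sub_self, abs_zero, Real.zero_rpow hα.ne', mul_zero] at h
  linarith [abs_nonpos_iff.1 h]

lemma Polynomial.exists_abs_eval_le (P : Polynomial ℝ) :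
    ∃ B, 0 ≤ B ∧ ∀ t, |t| ≤ 1 → |P.eval t| ≤ B := by
  obtain ⟨B, hB⟩ := (isCompact_Icc (a := (-1 : ℝ)) (b := 1)).exists_bound_of_continuousOn
    P.continuous.continuousOn
  refine ⟨B, (norm_nonneg _).trans (hB 0 (by simp)), fun t ht => hB t (abs_le.1 ht)⟩

lemma Polynomial.eval_eq_divX (P : Polynomial ℝ) (t : ℝ) :
    P.eval t = P.divX.eval t * t + P.eval 0 := by
  conv_lhs => rw [← Polynomial.divX_mul_X_add P]
  simp [Polynomial.coeff_zero_eq_eval_zero]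

lemma HolderAt.isBigO {Z : ℝ → ℝ} {α β x : ℝ} (h : HolderAt Z α x) (hβ : 0 < β) (hβα : β ≤ α)
    (hβ1 : β ≤ 1) : (fun y => Z y - Z x) =O[𝓝 x] fun y => |y - x| ^ β := by
  obtain ⟨P, C, δ, hC, hδ, -, h⟩ := h
  have hα : 0 < α := hβ.trans_le hβα
  have h0 := HolderAt.eq_eval_zero hα (h x (by simpa using hδ))
  obtain ⟨B, hB0, hB⟩ := P.divX.exists_abs_eval_le
  refine Asymptotics.IsBigO.of_bound (C + B) ?_
  filter_upwards [Metric.ball_mem_nhds x (lt_min hδ one_pos)] with y hy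
  rw [Metric.mem_ball, Real.dist_eq] at hy
  have hy1 : |y - x| ≤ 1 := (hy.trans_le (min_le_right _ _)).le
  rw [Real.norm_eq_abs, Real.norm_eq_abs, abs_of_nonneg (by positivity : 0 ≤ |y - x| ^ β)]
  have e : Z y - Z x = (Z y - P.eval (y - x)) + P.divX.eval (y - x) * (y - x) := by
    rw [h0, P.eval_eq_divX (y - x)]; ring
  have h1 := h y (hy.trans_le (min_le_left _ _))
  have h2 := hB (y - x) hy1
  have hp1 : |y - x| ^ α ≤ |y - x| ^ β :=
    Real.rpow_le_rpow_of_exponent_ge_of_imp (abs_nonneg _) hy1 hβα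
      (fun _ h => absurd h hα.ne')
  have hp2 : |y - x| ≤ |y - x| ^ β := by
    simpa using Real.rpow_le_rpow_of_exponent_ge_of_imp (abs_nonneg _) hy1 hβ1
      (fun _ h => absurd h one_ne_zero)
  calc |Z y - Z x| ≤ |Z y - P.eval (y - x)| + |P.divX.eval (y - x)| * |y - x| := by
        rw [e, ← abs_mul]; exact abs_add_le _ _
    _ ≤ C * |y - x| ^ β + B * |y - x| ^ β := by gcongr; exact h1.trans (by gcongr)
    _ = _ := by ring

/-- Two difference quotients of `G` at `x` at scale less than `ε` differ by a relatively large
amount. -/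
def SlopeGap (G : ℝ → ℝ) (x ε : ℝ) : Prop :=
  ∃ u v : ℝ, 0 < |u| ∧ |u| < ε ∧ 0 < |v| ∧ |v| < ε ∧
    (|u| + |v|) ^ ε < |(G (x + u) - G x) / u - (G (x + v) - G x) / v|

lemma HolderAt.le_one {Z : ℝ → ℝ} {α x : ℝ} (hgap : ∀ n : ℕ, SlopeGap Z x (1 / (n + 1)))
    (h : HolderAt Z α x) : α ≤ 1 := by
  by_contra! hα1
  obtain ⟨P, C, δ, hC, hδ, -, h⟩ := h
  have hα : 0 < α := by linarith
  have h0 := HolderAt.eq_eval_zero hα (h x (by simpa using hδ))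
  obtain ⟨B, hB0, hB⟩ := P.divX.divX.exists_abs_eval_le
  set γ := min (α - 1) 1 with hγ
  have hγ0 : 0 < γ := lt_min (by linarith) one_pos
  have key : ∀ u : ℝ, 0 < |u| → |u| < δ → |u| ≤ 1 →
      |(Z (x + u) - Z x) / u - P.divX.eval 0| ≤ (C + B) * |u| ^ γ := by
    intro u hu0 huδ hu1
    have hu : u ≠ 0 := abs_pos.1 hu0
    have h1 := h (x + u) (by simpa using huδ)
    rw [add_sub_cancel_left] at h1
    have e : (Z (x + u) - Z x) / u - P.divX.eval 0 =
        (Z (x + u) - P.eval u) / u + P.divX.divX.eval u * u := by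
      rw [h0, P.eval_eq_divX u, P.divX.eval_eq_divX u]; field_simp; ring
    have hp1 : |u| ^ (α - 1) ≤ |u| ^ γ :=
      Real.rpow_le_rpow_of_exponent_ge hu0 hu1 (min_le_left _ _)
    have hp2 : |u| ≤ |u| ^ γ := by
      simpa using Real.rpow_le_rpow_of_exponent_ge hu0 hu1 (min_le_right (α - 1) 1)
    have h3 : |(Z (x + u) - P.eval u) / u| ≤ C * |u| ^ γ := by
      rw [abs_div, div_le_iff₀ hu0]
      calc _ ≤ C * |u| ^ α := h1
        _ = C * |u| ^ (α - 1) * |u| := by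
          rw [mul_assoc, ← Real.rpow_add_one hu0.ne', sub_add_cancel]
        _ ≤ _ := by gcongr
    rw [e]
    calc _ ≤ C * |u| ^ γ + |P.divX.divX.eval u| * |u| := by
          rw [← abs_mul]; exact (abs_add_le _ _).trans (by gcongr)
      _ ≤ C * |u| ^ γ + B * |u| ^ γ := by gcongr; exact hB u hu1
      _ = _ := by ring
  have hlim : Tendsto (fun n : ℕ => 2 * (C + B) * (2 * (1 / ((n : ℝ) + 1))) ^ (γ / 2)) atTop
      (𝓝 (2 * (C + B) * (2 * 0) ^ (γ / 2))) := by
    apply Tendsto.const_mul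
    apply Tendsto.rpow_const _ (Or.inr (by positivity))
    exact tendsto_one_div_add_atTop_nhds_zero_nat.const_mul 2
  rw [mul_zero, Real.zero_rpow (by positivity), mul_zero] at hlim
  have hn0 := tendsto_one_div_add_atTop_nhds_zero_nat (𝕜 := ℝ)
  obtain ⟨n, hn1, hn2, hn3, hn4⟩ := ((hlim.eventually (gt_mem_nhds one_pos)).and
    ((hn0.eventually (gt_mem_nhds hδ)).and ((hn0.eventually (gt_mem_nhds (by norm_num :
      (0 : ℝ) < 1 / 2))).and (hn0.eventually (gt_mem_nhds (by positivity : 0 < γ / 2)))))).exists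
  obtain ⟨u, v, hu0, hu, hv0, hv, huv⟩ := hgap n
  set ε : ℝ := 1 / ((n : ℝ) + 1) with hε
  have ku := key u hu0 (hu.trans hn2) (by linarith)
  have kv := key v hv0 (hv.trans hn2) (by linarith)
  have hs0 : 0 < |u| + |v| := by positivity
  have hs1 : |u| + |v| ≤ 1 := by linarith
  have hsum : |(Z (x + u) - Z x) / u - (Z (x + v) - Z x) / v| ≤
      2 * (C + B) * (|u| + |v|) ^ γ := by
    have e1 : |u| ^ γ ≤ (|u| + |v|) ^ γ := by gcongr; linarith
    have e2 : |v| ^ γ ≤ (|u| + |v|) ^ γ := by gcongr; linarith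
    have hCB : 0 ≤ C + B := by positivity
    calc _ ≤ |(Z (x + u) - Z x) / u - P.divX.eval 0| + |(Z (x + v) - Z x) / v - P.divX.eval 0| := by
          rw [abs_sub_comm ((Z (x + v) - Z x) / v)]; exact abs_sub_le _ _ _
      _ ≤ (C + B) * |u| ^ γ + (C + B) * |v| ^ γ := add_le_add ku kv
      _ ≤ (C + B) * (|u| + |v|) ^ γ + (C + B) * (|u| + |v|) ^ γ := by gcongr
      _ = _ := by ring
  have hfac : (|u| + |v|) ^ γ ≤ (|u| + |v|) ^ ε * (2 * ε) ^ (γ / 2) := by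
    calc (|u| + |v|) ^ γ ≤ (|u| + |v|) ^ (ε + γ / 2) :=
          Real.rpow_le_rpow_of_exponent_ge hs0 hs1 (by linarith)
      _ = (|u| + |v|) ^ ε * (|u| + |v|) ^ (γ / 2) := Real.rpow_add hs0 _ _
      _ ≤ _ := by gcongr; linarith
  have hpos : 0 < (|u| + |v|) ^ ε := by positivity
  have : 2 * (C + B) * (|u| + |v|) ^ γ ≤ (|u| + |v|) ^ ε := by
    calc _ ≤ 2 * (C + B) * ((|u| + |v|) ^ ε * (2 * ε) ^ (γ / 2)) := by gcongr
      _ = (|u| + |v|) ^ ε * (2 * (C + B) * (2 * ε) ^ (γ / 2)) := by ring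
      _ ≤ (|u| + |v|) ^ ε * 1 := by gcongr
      _ = _ := mul_one _
  linarith

lemma le_holderExp {Z : ℝ → ℝ} {α x : ℝ} (hα : 0 ≤ α) (h : HolderAt Z α x) :
    (α : EReal) ≤ holderExp Z x :=
  le_sSup ⟨α, hα, h, rfl⟩

lemma holderExp_le {Z : ℝ → ℝ} {x H : ℝ} (h : ∀ α, HolderAt Z α x → α ≤ H) :
    holderExp Z x ≤ H := by
  apply sSup_le
  rintro _ ⟨α, -, hα, rfl⟩
  exact_mod_cast h α hα

lemma holderExp_eq {Z : ℝ → ℝ} {x H : ℝ} (hH : 0 < H) (hle : ∀ α, HolderAt Z α x → α ≤ H)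
    (hge : ∀ β, 0 < β → β < H → (fun y => Z y - Z x) =O[𝓝 x] fun y => |y - x| ^ β) :
    holderExp Z x = H := by
  apply le_antisymm (holderExp_le hle)
  apply le_of_forall_lt
  intro c hc
  obtain ⟨β, hcβ, hβH⟩ := EReal.lt_iff_exists_real_btwn.1 (max_lt hc (EReal.coe_pos.2 hH))
  have hβ0 : 0 < β := by exact_mod_cast (le_max_right _ _).trans_lt hcβ
  have hβ : β < H := by exact_mod_cast hβH
  exact ((le_max_left _ _).trans_lt hcβ).trans_le
    (le_holderExp hβ0.le (holderAt_of_isBigO hβ0 (hge β hβ0 hβ)))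

lemma SlopeGap.exists_nhds {G : ℝ → ℝ} (hG : Continuous G) {x ε : ℝ} (h : SlopeGap G x ε) :
    ∃ η > 0, ∀ᶠ y in 𝓝 x, ∀ H : ℝ → ℝ, (∀ z, |H z - G z| ≤ η) → SlopeGap H y ε := by
  obtain ⟨u, v, hu0, hu, hv0, hv, huv⟩ := h
  set T : ℝ → ℝ := fun y => (G (y + u) - G y) / u - (G (y + v) - G y) / v with hT
  have hcont : Continuous fun y => |T y| := by fun_prop
  obtain ⟨m, hm1, hm2⟩ := exists_between huv
  set η := (m - (|u| + |v|) ^ ε) / (2 * (2 / |u| + 2 / |v|)) with hη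
  have hden : 0 < 2 / |u| + 2 / |v| := by positivity
  have hη0 : 0 < η := div_pos (by linarith) (by positivity)
  refine ⟨η, hη0, ?_⟩
  filter_upwards [hcont.continuousAt.eventually (lt_mem_nhds hm2)] with y hy H hH
  refine ⟨u, v, hu0, hu, hv0, hv, ?_⟩
  have hb : ∀ w : ℝ, 0 < |w| →
      |(G (y + w) - G y) / w - (H (y + w) - H y) / w| ≤ η * (2 / |w|) := by
    intro w hw
    rw [← sub_div, abs_div, div_le_iff₀ hw]
    have e : G (y + w) - G y - (H (y + w) - H y) = (H y - G y) - (H (y + w) - G (y + w)) := by ring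
    rw [e, mul_assoc, div_mul_cancel₀ _ hw.ne']
    calc _ ≤ |H y - G y| + |H (y + w) - G (y + w)| := abs_sub _ _
      _ ≤ η + η := add_le_add (hH _) (hH _)
      _ = _ := by ring
  have hdiff : |T y| ≤ |(H (y + u) - H y) / u - (H (y + v) - H y) / v| +
      (η * (2 / |u|) + η * (2 / |v|)) := by
    have e : T y = ((H (y + u) - H y) / u - (H (y + v) - H y) / v) +
        (((G (y + u) - G y) / u - (H (y + u) - H y) / u) -
          ((G (y + v) - G y) / v - (H (y + v) - H y) / v)) := by rw [hT]; ring
    rw [e]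
    refine (abs_add_le _ _).trans ?_
    gcongr
    exact (abs_sub _ _).trans (add_le_add (hb u hu0) (hb v hv0))
  have : η * (2 / |u|) + η * (2 / |v|) = (m - (|u| + |v|) ^ ε) / 2 := by
    rw [← mul_add, hη]; field_simp
  have hy' : m < |T y| := hy
  linarith

lemma exists_stable_slopeGap {G : ℝ → ℝ} (hG : Continuous G) {ε : ℝ} {s : Set ℝ}
    (hs : IsCompact s) (h : ∀ x, SlopeGap G x ε) :
    ∃ η > 0, ∀ H : ℝ → ℝ, (∀ z, |H z - G z| ≤ η) → ∀ x ∈ s, SlopeGap H x ε := by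
  refine hs.induction_on
    (p := fun s => ∃ η > 0, ∀ H : ℝ → ℝ, (∀ z, |H z - G z| ≤ η) → ∀ x ∈ s, SlopeGap H x ε)
    ⟨1, one_pos, by simp⟩ ?_ ?_ ?_
  · rintro s t hst ⟨η, hη, h⟩
    exact ⟨η, hη, fun H hH x hx => h H hH x (hst hx)⟩
  · rintro s t ⟨η₁, hη₁, h₁⟩ ⟨η₂, hη₂, h₂⟩
    refine ⟨min η₁ η₂, lt_min hη₁ hη₂, fun H hH x hx => ?_⟩
    rcases hx with hx | hx
    · exact h₁ H (fun z => (hH z).trans (min_le_left _ _)) x hx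
    · exact h₂ H (fun z => (hH z).trans (min_le_right _ _)) x hx
  · intro x _
    obtain ⟨η, hη, hev⟩ := (h x).exists_nhds hG
    exact ⟨_, mem_nhdsWithin_of_mem_nhds hev, η, hη, fun H hH y hy => hy H hH⟩

/-! ### Finite sums of ramps -/

/-- The ramp of slope `1` rising from `0` to `ℓ` on `[0, ℓ]`. -/
noncomputable def ramp (ℓ t : ℝ) : ℝ := max 0 (min t ℓ)

lemma ramp_mono (ℓ : ℝ) : Monotone (ramp ℓ) := fun _ _ h => by unfold ramp; gcongr

lemma ramp_nonneg (ℓ t : ℝ) : 0 ≤ ramp ℓ t := le_max_left _ _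

lemma ramp_le {ℓ : ℝ} (hℓ : 0 ≤ ℓ) (t : ℝ) : ramp ℓ t ≤ ℓ := max_le hℓ (min_le_right _ _)

lemma ramp_of_nonpos {ℓ t : ℝ} (h : t ≤ 0) : ramp ℓ t = 0 :=
  max_eq_left ((min_le_left _ _).trans h)

lemma ramp_of_le {ℓ t : ℝ} (hℓ : 0 ≤ ℓ) (h : ℓ ≤ t) : ramp ℓ t = ℓ := by
  unfold ramp; rw [min_eq_right h, max_eq_right hℓ]

lemma abs_min_sub_min_le_abs_sub (ℓ s t : ℝ) : |min s ℓ - min t ℓ| ≤ |s - t| := by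
  simpa using abs_min_sub_min_le_max s ℓ t ℓ

lemma abs_ramp_sub_le (ℓ s t : ℝ) : |ramp ℓ s - ramp ℓ t| ≤ |s - t| := by
  unfold ramp
  rw [max_comm 0, max_comm 0]
  exact (abs_max_sub_max_le_abs _ _ _).trans (abs_min_sub_min_le_abs_sub _ _ _)

lemma abs_ramp_sub_le_min {ℓ : ℝ} (hℓ : 0 ≤ ℓ) (s t : ℝ) :
    |ramp ℓ s - ramp ℓ t| ≤ min ℓ |s - t| := by
  refine le_min ?_ (abs_ramp_sub_le ℓ s t)
  rw [abs_le]
  constructor <;> linarith [ramp_nonneg ℓ s, ramp_nonneg ℓ t, ramp_le hℓ s, ramp_le hℓ t]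

/-- `F` is affine on a right neighborhood of `x`. -/
def RightAffine (F : ℝ → ℝ) (x : ℝ) : Prop :=
  ∃ c : ℝ, ∀ᶠ y in 𝓝[>] x, F y - F x = c * (y - x)

lemma RightAffine.add {F G : ℝ → ℝ} {x : ℝ} (hF : RightAffine F x) (hG : RightAffine G x) :
    RightAffine (fun y => F y + G y) x := by
  obtain ⟨c, hc⟩ := hF
  obtain ⟨d, hd⟩ := hG
  refine ⟨c + d, ?_⟩
  filter_upwards [hc, hd] with y h1 h2
  linear_combination h1 + h2

lemma RightAffine.const_mul {F : ℝ → ℝ} {x : ℝ} (hF : RightAffine F x) (m : ℝ) :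
    RightAffine (fun y => m * F y) x := by
  obtain ⟨c, hc⟩ := hF
  refine ⟨m * c, ?_⟩
  filter_upwards [hc] with y h1
  linear_combination m * h1

lemma RightAffine.sum {ι : Type*} {s : Finset ι} {F : ι → ℝ → ℝ} {x : ℝ}
    (hF : ∀ i ∈ s, RightAffine (F i) x) : RightAffine (fun y => ∑ i ∈ s, F i y) x := by
  induction s using Finset.cons_induction with
  | empty => exact ⟨0, by simp⟩
  | cons i s hi ih =>
    simp only [Finset.sum_cons]
    exact (hF i (by simp)).add (ih fun j hj => hF j (by simp [hj]))

lemma rightAffine_ramp {ℓ : ℝ} (hℓ : 0 ≤ ℓ) (s x : ℝ) :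
    RightAffine (fun y => ramp ℓ (y - s)) x := by
  rcases lt_or_ge x s with h | h
  · refine ⟨0, ?_⟩
    filter_upwards [mem_nhdsWithin_of_mem_nhds (Iio_mem_nhds h)] with y hy
    rw [ramp_of_nonpos (by simpa using hy.le), ramp_of_nonpos (by linarith)]; ring
  rcases lt_or_ge x (s + ℓ) with h' | h'
  · refine ⟨1, ?_⟩
    filter_upwards [mem_nhdsWithin_of_mem_nhds (Iio_mem_nhds h'), self_mem_nhdsWithin] with y hy hy'
    rw [mem_Iio] at hy
    rw [mem_Ioi] at hy'
    unfold ramp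
    rw [min_eq_left (by linarith), min_eq_left (by linarith), max_eq_right (by linarith),
      max_eq_right (by linarith)]
    ring
  · refine ⟨0, ?_⟩
    filter_upwards [self_mem_nhdsWithin] with y hy
    rw [mem_Ioi] at hy
    rw [ramp_of_le hℓ (by linarith), ramp_of_le hℓ (by linarith)]; ring

lemma min_le_rpow_mul_rpow {ℓ r β : ℝ} (hℓ : 0 ≤ ℓ) (hr : 0 ≤ r) (hβ0 : 0 ≤ β) (hβ1 : β ≤ 1) :
    min ℓ r ≤ ℓ ^ (1 - β) * r ^ β := by
  have hm : 0 ≤ min ℓ r := le_min hℓ hr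
  calc min ℓ r = min ℓ r ^ (1 - β) * min ℓ r ^ β := by
        rw [← Real.rpow_add_of_nonneg hm (by linarith) hβ0]; simp
    _ ≤ _ := by
        gcongr
        · exact min_le_left _ _
        · exact min_le_right _ _

/-- The sum over `(s, h) ∈ S` of ramps of height `ℓ ^ h` on the intervals `[s, s + ℓ]`. -/
noncomputable def genFun (S : Finset (ℝ × ℝ)) (ℓ x : ℝ) : ℝ :=
  ∑ c ∈ S, ℓ ^ (c.2 - 1) * ramp ℓ (x - c.1)

lemma genFun_mono (S : Finset (ℝ × ℝ)) {ℓ : ℝ} (hℓ : 0 ≤ ℓ) : Monotone (genFun S ℓ) := by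
  intro x y h
  unfold genFun
  gcongr with c
  exact ramp_mono ℓ (by linarith)

lemma rightAffine_genFun (S : Finset (ℝ × ℝ)) {ℓ : ℝ} (hℓ : 0 ≤ ℓ) (x : ℝ) :
    RightAffine (genFun S ℓ) x :=
  RightAffine.sum fun c _ => (rightAffine_ramp hℓ c.1 x).const_mul _

lemma genFun_nonneg (S : Finset (ℝ × ℝ)) {ℓ : ℝ} (hℓ : 0 ≤ ℓ) (x : ℝ) : 0 ≤ genFun S ℓ x :=
  Finset.sum_nonneg fun c _ => mul_nonneg (by positivity) (ramp_nonneg _ _)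

lemma abs_genFun_sub_le (S : Finset (ℝ × ℝ)) {ℓ : ℝ} (hℓ : 0 ≤ ℓ) (x y : ℝ) :
    |genFun S ℓ y - genFun S ℓ x| ≤ (∑ c ∈ S, ℓ ^ (c.2 - 1)) * |y - x| := by
  unfold genFun
  rw [← Finset.sum_sub_distrib, Finset.sum_mul]
  refine (Finset.abs_sum_le_sum_abs _ _).trans (Finset.sum_le_sum fun c _ => ?_)
  rw [← mul_sub, abs_mul, abs_of_nonneg (by positivity : 0 ≤ ℓ ^ (c.2 - 1))]
  exact mul_le_mul_of_nonneg_left (by simpa using abs_ramp_sub_le ℓ (y - c.1) (x - c.1))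
    (by positivity)

lemma genFun_eq_of_disjoint (S : Finset (ℝ × ℝ)) {ℓ : ℝ} (hℓ : 0 ≤ ℓ) {x y : ℝ}
    (h : ∀ c ∈ S, (x ≤ c.1 ∧ y ≤ c.1) ∨ (c.1 + ℓ ≤ x ∧ c.1 + ℓ ≤ y)) :
    genFun S ℓ y = genFun S ℓ x := by
  refine Finset.sum_congr rfl fun c hc => ?_
  congr 1
  rcases h c hc with ⟨h1, h2⟩ | ⟨h1, h2⟩
  · rw [ramp_of_nonpos (by linarith), ramp_of_nonpos (by linarith)]
  · rw [ramp_of_le hℓ (by linarith), ramp_of_le hℓ (by linarith)]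

lemma le_genFun_sub {S : Finset (ℝ × ℝ)} {ℓ x : ℝ} (hℓ : 0 < ℓ) {c : ℝ × ℝ} (hc : c ∈ S)
    (hx : x ∈ Icc c.1 (c.1 + ℓ)) : ℓ ^ c.2 ≤ genFun S ℓ (x + ℓ) - genFun S ℓ (x - ℓ) := by
  unfold genFun
  rw [← Finset.sum_sub_distrib]
  have h := Finset.single_le_sum (s := S) (f := fun c => ℓ ^ (c.2 - 1) * ramp ℓ (x + ℓ - c.1) -
    ℓ ^ (c.2 - 1) * ramp ℓ (x - ℓ - c.1)) (fun c _ => by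
      rw [← mul_sub]
      exact mul_nonneg (by positivity) (sub_nonneg.2 (ramp_mono ℓ (by linarith)))) hc
  refine le_trans (le_of_eq ?_) h
  rw [ramp_of_le hℓ.le (by linarith [hx.1]), ramp_of_nonpos (by linarith [hx.2]), mul_zero,
    sub_zero, ← Real.rpow_add_one hℓ.ne', sub_add_cancel]

lemma card_le_of_separated {T : Finset (ℝ × ℝ)} {σ A B : ℝ} (hσ : 0 < σ) (hAB : A ≤ B)
    (hT : ∀ c ∈ T, c.1 ∈ Icc A B) (hsep : ∀ c ∈ T, ∀ c' ∈ T, c ≠ c' → σ ≤ |c.1 - c'.1|) :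
    (T.card : ℝ) ≤ (B - A) / σ + 1 := by
  have hcard : T.card ≤ (Finset.range (⌊(B - A) / σ⌋₊ + 1)).card := by
    apply Finset.card_le_card_of_injOn (fun c => ⌊(c.1 - A) / σ⌋₊)
    · intro c hc
      simp only [Finset.coe_range, mem_Iio, Nat.lt_succ_iff]
      apply Nat.floor_le_floor
      gcongr
      exact (hT c hc).2
    · intro c hc c' hc' h
      by_contra hne
      have h1 := hsep c hc c' hc' hne
      simp only at h
      have p1 : 0 ≤ (c.1 - A) / σ := div_nonneg (by linarith [(hT c hc).1]) hσ.le
      have p2 : 0 ≤ (c'.1 - A) / σ := div_nonneg (by linarith [(hT c' hc').1]) hσ.le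
      have q1 := Nat.floor_le p1
      have q2 := Nat.floor_le p2
      have q3 := Nat.lt_floor_add_one ((c.1 - A) / σ)
      have q4 := Nat.lt_floor_add_one ((c'.1 - A) / σ)
      rw [h] at q1 q3
      have : |(c.1 - A) / σ - (c'.1 - A) / σ| < 1 := by rw [abs_lt]; constructor <;> linarith
      rw [← sub_div, abs_div, abs_of_pos hσ, div_lt_one hσ] at this
      rw [show c.1 - A - (c'.1 - A) = c.1 - c'.1 by ring] at this
      linarith
  rw [Finset.card_range] at hcard
  have h2 : ((⌊(B - A) / σ⌋₊ + 1 : ℕ) : ℝ) ≤ (B - A) / σ + 1 := by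
    push_cast
    gcongr
    exact Nat.floor_le (div_nonneg (by linarith) hσ.le)
  exact (Nat.cast_le.2 hcard).trans h2

/-- Quantitative conditions on the positions and exponents of one generation of ramps. -/
structure GenCond (S : Finset (ℝ × ℝ)) (ℓ σ w a δ : ℝ) : Prop where
  pos : 0 < ℓ
  le_one : ℓ ≤ 1
  four_mul_le : 4 * ℓ ≤ σ
  separated : ∀ c ∈ S, ∀ c' ∈ S, c ≠ c' → σ ≤ |c.1 - c'.1|
  le_exp : ∀ c ∈ S, a + δ ≤ c.2
  exp_le : ∀ c ∈ S, c.2 ≤ 1 - δ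
  mass_le : ℓ ^ (a + δ) ≤ w * σ
  rpow_le : ℓ ^ δ ≤ w
  total_le : S.card * ℓ ^ (a + δ) ≤ w

namespace GenCond

variable {S : Finset (ℝ × ℝ)} {ℓ σ w a δ : ℝ}

lemma sigma_pos (h : GenCond S ℓ σ w a δ) : 0 < σ := by linarith [h.pos, h.four_mul_le]

lemma w_nonneg (h : GenCond S ℓ σ w a δ) : 0 ≤ w :=
  (Real.rpow_nonneg h.pos.le _).trans h.rpow_le

lemma genFun_le (h : GenCond S ℓ σ w a δ) (x : ℝ) : genFun S ℓ x ≤ w := by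
  refine le_trans ?_ h.total_le
  rw [← nsmul_eq_mul]
  refine Finset.sum_le_card_nsmul _ _ _ fun c hc => ?_
  calc ℓ ^ (c.2 - 1) * ramp ℓ (x - c.1) ≤ ℓ ^ (c.2 - 1) * ℓ := by
        gcongr
        · exact Real.rpow_nonneg h.pos.le _
        · exact ramp_le h.pos.le _
    _ = ℓ ^ c.2 := by rw [← Real.rpow_add_one h.pos.ne', sub_add_cancel]
    _ ≤ _ := Real.rpow_le_rpow_of_exponent_ge h.pos h.le_one (h.le_exp c hc)

lemma mem_Icc_of_ramp_ne (h : GenCond S ℓ σ w a δ) {x y s : ℝ}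
    (hne : ramp ℓ (y - s) - ramp ℓ (x - s) ≠ 0) : s ∈ Icc (min x y - ℓ) (max x y) := by
  by_contra hs
  apply hne
  rw [mem_Icc, not_and_or, not_le, not_le] at hs
  rcases hs with hs | hs
  · rw [ramp_of_le h.pos.le (by linarith [min_le_right x y]),
      ramp_of_le h.pos.le (by linarith [min_le_left x y]), sub_self]
  · rw [ramp_of_nonpos (by linarith [le_max_right x y]),
      ramp_of_nonpos (by linarith [le_max_left x y]), sub_self]

lemma term_le (h : GenCond S ℓ σ w a δ) {c : ℝ × ℝ} (hc : c ∈ S) (x y : ℝ) :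
    |ℓ ^ (c.2 - 1) * (ramp ℓ (y - c.1) - ramp ℓ (x - c.1))| ≤
      ℓ ^ (a + δ - 1) * min ℓ |y - x| := by
  have hℓ := h.pos
  rw [abs_mul, abs_of_nonneg (by positivity : 0 ≤ ℓ ^ (c.2 - 1))]
  have h1 := abs_ramp_sub_le_min hℓ.le (y - c.1) (x - c.1)
  rw [sub_sub_sub_cancel_right] at h1
  exact mul_le_mul (Real.rpow_le_rpow_of_exponent_ge hℓ h.le_one (by linarith [h.le_exp c hc]))
    h1 (abs_nonneg _) (by positivity)

lemma abs_sum_le (h : GenCond S ℓ σ w a δ) {R : Finset (ℝ × ℝ)} (hR : R ⊆ S) (x y : ℝ) :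
    |∑ c ∈ R, ℓ ^ (c.2 - 1) * (ramp ℓ (y - c.1) - ramp ℓ (x - c.1))| ≤
      (R.filter fun c => ramp ℓ (y - c.1) - ramp ℓ (x - c.1) ≠ 0).card *
        (ℓ ^ (a + δ - 1) * min ℓ |y - x|) := by
  rw [← nsmul_eq_mul]
  refine (Finset.abs_sum_le_sum_abs _ _).trans ?_
  rw [← Finset.sum_filter_of_ne (p := fun c => ramp ℓ (y - c.1) - ramp ℓ (x - c.1) ≠ 0)]
  · refine Finset.sum_le_card_nsmul _ _ _ fun c hc => ?_
    exact h.term_le (hR (Finset.mem_of_mem_filter c hc)) x y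
  · intro c _ hc h0
    apply hc
    rw [h0, mul_zero, abs_zero]

lemma card_filter_le (h : GenCond S ℓ σ w a δ) {R : Finset (ℝ × ℝ)} (hR : R ⊆ S) (x y : ℝ) :
    ((R.filter fun c => ramp ℓ (y - c.1) - ramp ℓ (x - c.1) ≠ 0).card : ℝ) ≤
      (|y - x| + ℓ) / σ + 1 := by
  have hlen : |y - x| + ℓ = max x y - (min x y - ℓ) := by
    rw [← max_sub_min_eq_abs]; ring
  rw [hlen]
  refine card_le_of_separated h.sigma_pos ?_ ?_ ?_
  · linarith [h.pos, min_le_max (a := x) (b := y)]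
  · intro c hc
    exact h.mem_Icc_of_ramp_ne (Finset.mem_filter.1 hc).2
  · intro c hc c' hc'
    exact h.separated c (hR (Finset.mem_filter.1 hc).1) c' (hR (Finset.mem_filter.1 hc').1)

lemma genFun_sub (x y : ℝ) : genFun S ℓ y - genFun S ℓ x =
    ∑ c ∈ S, ℓ ^ (c.2 - 1) * (ramp ℓ (y - c.1) - ramp ℓ (x - c.1)) := by
  unfold genFun
  rw [← Finset.sum_sub_distrib]
  exact Finset.sum_congr rfl fun c _ => by ring

lemma rpow_sub_one_mul (h : GenCond S ℓ σ w a δ) : ℓ ^ (a + δ - 1) * ℓ = ℓ ^ (a + δ) := by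
  rw [← Real.rpow_add_one h.pos.ne', sub_add_cancel]

lemma interpolate (h : GenCond S ℓ σ w a δ) {β γ r : ℝ} (hβ0 : 0 ≤ β) (hβ1 : β ≤ 1) (hr : 0 ≤ r)
    (hγ : β + δ ≤ γ) : ℓ ^ (γ - 1) * min ℓ r ≤ w * r ^ β := by
  have hℓ := h.pos
  calc ℓ ^ (γ - 1) * min ℓ r ≤ ℓ ^ (γ - 1) * (ℓ ^ (1 - β) * r ^ β) := by
        gcongr; exact min_le_rpow_mul_rpow hℓ.le hr hβ0 hβ1
    _ = ℓ ^ (γ - β) * r ^ β := by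
        rw [← mul_assoc, ← Real.rpow_add hℓ]; congr 2; ring
    _ ≤ ℓ ^ δ * r ^ β := by
        gcongr ?_ * _
        exact Real.rpow_le_rpow_of_exponent_ge hℓ h.le_one (by linarith)
    _ ≤ _ := by gcongr; exact h.rpow_le

lemma abs_sub_le_rpow (h : GenCond S ℓ σ w a δ) (ha0 : 0 ≤ a) (ha1 : a ≤ 1) {x y : ℝ}
    (hxy : |y - x| ≤ 1) : |genFun S ℓ y - genFun S ℓ x| ≤ 3 * w * |y - x| ^ a := by
  have hℓ := h.pos
  have hσ := h.sigma_pos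
  set r := |y - x| with hr
  have hr0 : 0 ≤ r := abs_nonneg _
  have hm0 : 0 ≤ ℓ ^ (a + δ - 1) * min ℓ r := by positivity
  rw [genFun_sub]
  have hcard : ((S.filter fun c => ramp ℓ (y - c.1) - ramp ℓ (x - c.1) ≠ 0).card : ℝ) ≤
      r / σ + 2 := by
    refine (h.card_filter_le le_rfl x y).trans ?_
    have : ℓ / σ ≤ 1 := (div_le_one hσ).2 (by linarith [h.four_mul_le])
    rw [add_div]; linarith
  have h1 : r / σ * (ℓ ^ (a + δ - 1) * min ℓ r) ≤ w * r := by
    calc r / σ * (ℓ ^ (a + δ - 1) * min ℓ r) ≤ r / σ * (ℓ ^ (a + δ - 1) * ℓ) := by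
          gcongr; exact min_le_left _ _
      _ ≤ r / σ * (w * σ) := by rw [h.rpow_sub_one_mul]; gcongr; exact h.mass_le
      _ = w * r := by field_simp
  have h2 := h.interpolate ha0 ha1 hr0 (le_refl (a + δ))
  have h3 : r ≤ r ^ a := by
    rcases hr0.eq_or_lt with h0 | h0
    · rw [← h0]; positivity
    · simpa using Real.rpow_le_rpow_of_exponent_ge h0 hxy ha1
  calc _ ≤ (r / σ + 2) * (ℓ ^ (a + δ - 1) * min ℓ r) :=
        (h.abs_sum_le le_rfl x y).trans (by gcongr)
    _ ≤ w * r + 2 * (w * r ^ a) := by rw [add_mul]; gcongr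
    _ ≤ w * r ^ a + 2 * (w * r ^ a) := by gcongr; exact h.w_nonneg
    _ = _ := by ring

lemma abs_sub_le_of_mem (h : GenCond S ℓ σ w a δ) {x : ℝ} {c : ℝ × ℝ} (hc : c ∈ S)
    (hx : x ∈ Icc c.1 (c.1 + ℓ)) (y : ℝ) :
    |genFun S ℓ y - genFun S ℓ x| ≤ ℓ ^ (c.2 - 1) * min ℓ |y - x| + 4 * w * |y - x| := by
  have hℓ := h.pos
  have hσ := h.sigma_pos
  set r := |y - x| with hr
  have hr0 : 0 ≤ r := abs_nonneg _
  rw [genFun_sub, ← Finset.add_sum_erase _ _ hc]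
  have hfirst : |ℓ ^ (c.2 - 1) * (ramp ℓ (y - c.1) - ramp ℓ (x - c.1))| ≤
      ℓ ^ (c.2 - 1) * min ℓ r := by
    rw [abs_mul, abs_of_nonneg (by positivity : 0 ≤ ℓ ^ (c.2 - 1))]
    have h1 := abs_ramp_sub_le_min hℓ.le (y - c.1) (x - c.1)
    rw [sub_sub_sub_cancel_right] at h1
    exact mul_le_mul_of_nonneg_left h1 (by positivity)
  have hcard : (((S.erase c).filter fun c => ramp ℓ (y - c.1) - ramp ℓ (x - c.1) ≠ 0).card : ℝ) ≤
      4 * (r / σ) := by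
    rcases Finset.eq_empty_or_nonempty
      ((S.erase c).filter fun c => ramp ℓ (y - c.1) - ramp ℓ (x - c.1) ≠ 0) with he | ⟨c', hc'⟩
    · rw [he]; simp; positivity
    · rw [Finset.mem_filter, Finset.mem_erase] at hc'
      have hs := h.separated c' hc'.1.2 c hc hc'.1.1
      have hI := h.mem_Icc_of_ramp_ne hc'.2
      have hfar : σ ≤ r + 2 * ℓ := by
        refine hs.trans ?_
        rw [abs_le]
        have e1 : max x y ≤ x + r := max_le (by linarith) (by linarith [le_abs_self (y - x)])
        have e2 : x - r ≤ min x y := le_min (by linarith) (by linarith [neg_abs_le (y - x)])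
        constructor <;> linarith [hI.1, hI.2, hx.1, hx.2]
      have hge : 1 / 2 ≤ r / σ := by
        rw [le_div_iff₀ hσ]; linarith [h.four_mul_le]
      refine (h.card_filter_le (Finset.erase_subset _ _) x y).trans ?_
      have : ℓ / σ ≤ 1 / 4 := by rw [div_le_iff₀ hσ]; linarith [h.four_mul_le]
      rw [add_div]; linarith
  refine (abs_add_le _ _).trans (add_le_add hfirst ?_)
  calc _ ≤ 4 * (r / σ) * (ℓ ^ (a + δ - 1) * min ℓ r) :=
        (h.abs_sum_le (Finset.erase_subset _ _) x y).trans (by gcongr)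
    _ ≤ 4 * (r / σ) * (ℓ ^ (a + δ - 1) * ℓ) := by gcongr; exact min_le_left _ _
    _ ≤ 4 * (r / σ) * (w * σ) := by rw [h.rpow_sub_one_mul]; gcongr; exact h.mass_le
    _ = _ := by field_simp

lemma abs_sub_le_rpow_of_mem (h : GenCond S ℓ σ w a δ) {x y β : ℝ} {c : ℝ × ℝ} (hc : c ∈ S)
    (hx : x ∈ Icc c.1 (c.1 + ℓ)) (hβ0 : 0 ≤ β) (hβ1 : β ≤ 1) (hβ : β + δ ≤ c.2)
    (hxy : |y - x| ≤ 1) : |genFun S ℓ y - genFun S ℓ x| ≤ 5 * w * |y - x| ^ β := by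
  have h3 : |y - x| ≤ |y - x| ^ β := by
    rcases (abs_nonneg (y - x)).eq_or_lt with h0 | h0
    · rw [← h0]; positivity
    · simpa using Real.rpow_le_rpow_of_exponent_ge h0 hxy hβ1
  have hw := h.w_nonneg
  calc _ ≤ ℓ ^ (c.2 - 1) * min ℓ |y - x| + 4 * w * |y - x| := h.abs_sub_le_of_mem hc hx y
    _ ≤ w * |y - x| ^ β + 4 * w * |y - x| ^ β :=
        add_le_add (h.interpolate hβ0 hβ1 (abs_nonneg _) hβ)
          (mul_le_mul_of_nonneg_left h3 (by positivity))
    _ = _ := by ring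

end GenCond

/-! ### Scales and positions of the nested construction -/

lemma eventually_rpow_le {s c : ℝ} (hs : 0 < s) (hc : 0 < c) : ∀ᶠ y : ℝ in 𝓝[>] 0, y ^ s ≤ c := by
  have h : Tendsto (fun y : ℝ => y ^ s) (𝓝[>] 0) (𝓝 0) := by
    have := (Real.continuousAt_rpow_const 0 s (Or.inr hs.le)).tendsto
    rw [Real.zero_rpow hs.ne'] at this
    exact this.mono_left nhdsWithin_le_nhds
  exact (h.eventually (gt_mem_nhds hc)).mono fun y hy => hy.le

/-- The margin separating the exponents of generation `k` from `a` and from `1`. -/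
noncomputable def margin (a : ℝ) (k : ℕ) : ℝ := (1 - a) / (2 * (k + 1))

lemma margin_pos {a : ℝ} (ha : a < 1) (k : ℕ) : 0 < margin a k :=
  div_pos (by linarith) (by positivity)

lemma margin_le {a : ℝ} (ha : a < 1) (k : ℕ) : margin a k ≤ (1 - a) / 2 := by
  unfold margin
  apply div_le_div_of_nonneg_left (by linarith) (by norm_num)
  linarith [(Nat.cast_nonneg k : (0 : ℝ) ≤ k)]

lemma tendsto_margin (a : ℝ) : Tendsto (margin a) atTop (𝓝 0) := by
  have h : margin a = fun k : ℕ => (1 - a) / 2 * (1 / ((k : ℝ) + 1)) := by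
    funext k; unfold margin; field_simp
  rw [h, show (0 : ℝ) = (1 - a) / 2 * 0 by ring]
  exact tendsto_one_div_add_atTop_nhds_zero_nat.const_mul _

/-- Existence of the next scale `y` and of the branching number `m`. -/
lemma exists_next_scale {a v δ w L q N T : ℝ} (hv : 0 ≤ v) (hva : v ≤ a) (hδ : 0 < δ)
    (haδ : a + δ < 1) (hw : 0 < w) (hL : 0 < L) (hq : 0 < q) (hN : 0 < N) (hT : 0 < T) :
    ∃ (y : ℝ) (m : ℕ), 0 < y ∧ y ≤ 1 ∧ 0 < m ∧ 4 * y ≤ L / (N * m) ∧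
      y ^ (a + δ) ≤ w * (L / (N * m)) ∧ q * m * y ^ (v + δ) ≤ w ∧ y ^ δ ≤ w ∧ T ≤ m * y ^ v := by
  set u := v + δ / 2 with hu
  have e1 := eventually_rpow_le (s := 1 - u) (c := L / (8 * N)) (by linarith) (by positivity)
  have e2 := eventually_rpow_le (s := a + δ - u) (c := w * L / (2 * N)) (by linarith)
    (by positivity)
  have e3 := eventually_rpow_le (s := δ / 2) (c := w / (2 * q)) (by linarith) (by positivity)
  have e4 := eventually_rpow_le hδ hw
  have e5 := eventually_rpow_le (s := δ / 2) (c := 1 / T) (by linarith) (by positivity)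
  have e6 : ∀ᶠ y : ℝ in 𝓝[>] 0, y ≤ 1 :=
    mem_nhdsWithin_of_mem_nhds (Iic_mem_nhds one_pos)
  obtain ⟨y, h1, h2, h3, h4, h5, h6, hy⟩ := (e1.and (e2.and (e3.and (e4.and (e5.and
    (e6.and self_mem_nhdsWithin)))))).exists
  have hy : 0 < y := hy
  have hyu : 1 ≤ y ^ (-u) := Real.one_le_rpow_of_pos_of_le_one_of_nonpos hy h6 (by linarith)
  have hm1 : y ^ (-u) ≤ (⌈y ^ (-u)⌉₊ : ℝ) := Nat.le_ceil _
  have hm2 : (⌈y ^ (-u)⌉₊ : ℝ) ≤ 2 * y ^ (-u) := by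
    linarith [Nat.ceil_lt_add_one (zero_le_one.trans hyu)]
  set m := ⌈y ^ (-u)⌉₊ with hm
  have hm0 : (0 : ℝ) < m := by linarith
  have hσ : L * y ^ u / (2 * N) ≤ L / (N * m) := by
    rw [div_le_div_iff₀ (by positivity) (by positivity)]
    have : y ^ u * y ^ (-u) = 1 := by rw [← Real.rpow_add hy]; simp
    have : y ^ u * m ≤ 2 := by
      calc y ^ u * m ≤ y ^ u * (2 * y ^ (-u)) := by gcongr
        _ = 2 := by linear_combination 2 * this
    calc L * y ^ u * (N * m) = L * N * (y ^ u * m) := by ring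
      _ ≤ L * N * 2 := by gcongr
      _ = _ := by ring
  refine ⟨y, m, hy, h6, by exact_mod_cast hm0, ?_, ?_, ?_, h4, ?_⟩
  · refine le_trans ?_ hσ
    have : y = y ^ (1 - u) * y ^ u := by rw [← Real.rpow_add hy]; simp
    calc 4 * y = 4 * (y ^ (1 - u) * y ^ u) := by rw [← this]
      _ ≤ 4 * (L / (8 * N) * y ^ u) := by gcongr
      _ = _ := by field_simp; norm_num
  · refine le_trans ?_ (mul_le_mul_of_nonneg_left hσ hw.le)
    calc y ^ (a + δ) = y ^ (a + δ - u) * y ^ u := by rw [← Real.rpow_add hy]; simp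
      _ ≤ w * L / (2 * N) * y ^ u := by gcongr
      _ = _ := by ring
  · calc q * m * y ^ (v + δ) ≤ q * (2 * y ^ (-u)) * y ^ (v + δ) := by gcongr
      _ = q * 2 * (y ^ (-u) * y ^ (v + δ)) := by ring
      _ = q * 2 * y ^ (δ / 2) := by rw [← Real.rpow_add hy, hu]; ring_nf
      _ ≤ q * 2 * (w / (2 * q)) := by gcongr
      _ = w := by field_simp
  · calc T ≤ y ^ (-(δ / 2)) := by
          rw [Real.rpow_neg hy.le]
          rw [le_inv_comm₀ hT (by positivity)]
          simpa using h5
      _ = y ^ (-u) * y ^ v := by rw [← Real.rpow_add hy, hu]; ring_nf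
      _ ≤ m * y ^ v := by gcongr

/-- The scales `ℓ k`, branching numbers `M k` and partial products `P k` of the construction. -/
structure Scales (a v ρ : ℝ) (ℓ : ℕ → ℝ) (M P : ℕ → ℕ) : Prop where
  zero : ℓ 0 = ρ
  pos : ∀ k, 0 < ℓ k
  le_one : ∀ k, ℓ k ≤ 1
  M_pos : ∀ k, 0 < M k
  P_zero : P 0 = 1
  P_succ : ∀ k, P (k + 1) = P k * M k
  four_mul_le : ∀ k, 4 * ℓ (k + 1) ≤ ℓ k / ((k + 1 : ℕ) * M k)
  mass_le : ∀ k, ℓ (k + 1) ^ (a + margin a k) ≤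
    (1 / 2) ^ (k + 1) * (ℓ k / ((k + 1 : ℕ) * M k))
  card_le : ∀ k, ((k + 1).factorial * P (k + 1) : ℝ) * ℓ (k + 1) ^ (v + margin a k) ≤
    (1 / 2) ^ (k + 1)
  rpow_le : ∀ k, ℓ (k + 1) ^ margin a k ≤ (1 / 2) ^ (k + 1)
  le_card : ∀ k, (k + 1) * ρ ^ v ≤ P k * ℓ k ^ v

lemma exists_scales {a v ρ : ℝ} (hv : 0 ≤ v) (hva : v ≤ a) (ha : a < 1) (hρ : 0 < ρ)
    (hρ1 : ρ ≤ 1) : ∃ ℓ M P, Scales a v ρ ℓ M P := by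
  have step : ∀ (k : ℕ) (s : {s : ℝ × ℕ // 0 < s.1 ∧ s.1 ≤ 1 ∧ 0 < s.2}), ∃ (y : ℝ) (m : ℕ),
      0 < y ∧ y ≤ 1 ∧ 0 < m ∧ 4 * y ≤ s.1.1 / ((k + 1 : ℕ) * m) ∧
      y ^ (a + margin a k) ≤ (1 / 2) ^ (k + 1) * (s.1.1 / ((k + 1 : ℕ) * m)) ∧
      ((k + 1).factorial * s.1.2 : ℝ) * m * y ^ (v + margin a k) ≤ (1 / 2) ^ (k + 1) ∧
      y ^ margin a k ≤ (1 / 2) ^ (k + 1) ∧ (k + 2 : ℝ) ≤ m * y ^ v := by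
    intro k s
    have h1 : (0 : ℝ) < s.1.2 := by exact_mod_cast s.2.2.2
    have h2 : (0 : ℝ) < (k + 1).factorial := by exact_mod_cast Nat.factorial_pos _
    have h3 : (0 : ℝ) < (k + 1 : ℕ) := by exact_mod_cast Nat.succ_pos k
    exact exists_next_scale hv hva (margin_pos ha k)
      (by linarith [margin_le ha k]) (by positivity) s.2.1 (by positivity) h3 (by positivity)
  choose Y m hY0 hY1 hm h1 h2 h3 h4 h5 using step
  let s : ℕ → {s : ℝ × ℕ // 0 < s.1 ∧ s.1 ≤ 1 ∧ 0 < s.2} := fun n =>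
    Nat.rec ⟨(ρ, 1), hρ, hρ1, one_pos⟩
      (fun k s => ⟨(Y k s, s.1.2 * m k s), hY0 k s, hY1 k s, Nat.mul_pos s.2.2.2 (hm k s)⟩) n
  refine ⟨fun k => (s k).1.1, fun k => m k (s k), fun k => (s k).1.2, rfl, fun k => (s k).2.1,
    fun k => (s k).2.2.1, fun k => hm k _, rfl, fun k => rfl, fun k => h1 k _, fun k => h2 k _,
    fun k => ?_, fun k => h4 k _, fun k => ?_⟩
  · have := h3 k (s k)
    have e : (((s (k + 1)).1.2 : ℕ) : ℝ) = (s k).1.2 * m k (s k) := by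
      rw [← Nat.cast_mul]
    rw [e]
    calc _ = _ := by rw [← mul_assoc]
      _ ≤ _ := this
  · cases k with
    | zero => simp [s]
    | succ k =>
      have e : (((s (k + 1)).1.2 : ℕ) : ℝ) = (s k).1.2 * m k (s k) := by
        rw [← Nat.cast_mul]
      have h6 : (1 : ℝ) ≤ (s k).1.2 := by exact_mod_cast (s k).2.2.2
      have h7 : ρ ^ v ≤ 1 := Real.rpow_le_one hρ.le hρ1 hv
      have h8 := h5 k (s k)
      rw [e]
      push_cast
      calc ((k : ℝ) + 1 + 1) * ρ ^ v ≤ (k + 1 + 1) * 1 := by gcongr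
        _ ≤ 1 * (m k (s k) * Y k (s k) ^ v) := by linarith
        _ ≤ (s k).1.2 * (m k (s k) * Y k (s k) ^ v) := by
            gcongr; exact le_trans (by positivity) h8
        _ = _ := by rw [← mul_assoc]

namespace Scales

variable {a v ρ : ℝ} {ℓ : ℕ → ℝ} {M P : ℕ → ℕ}

lemma M_cast_pos (h : Scales a v ρ ℓ M P) (k : ℕ) : (0 : ℝ) < M k := by exact_mod_cast h.M_pos k

lemma P_pos (h : Scales a v ρ ℓ M P) (k : ℕ) : 0 < P k := by
  induction k with
  | zero => simp [h.P_zero]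
  | succ k ih => rw [h.P_succ]; exact Nat.mul_pos ih (h.M_pos k)

lemma succ_le (h : Scales a v ρ ℓ M P) (k : ℕ) : ℓ (k + 1) ≤ ℓ k / 4 := by
  have h1 := h.four_mul_le k
  have h2 : ℓ k / ((k + 1 : ℕ) * M k) ≤ ℓ k := by
    apply div_le_self (h.pos k).le
    have : 1 ≤ (k + 1) * M k := Nat.mul_pos (Nat.succ_pos k) (h.M_pos k)
    exact_mod_cast this
  linarith

lemma le_pow (h : Scales a v ρ ℓ M P) (k : ℕ) : ℓ k ≤ (1 / 4) ^ k := by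
  induction k with
  | zero => simpa using h.le_one 0
  | succ k ih => rw [pow_succ]; linarith [h.succ_le k]

lemma tendsto_zero (h : Scales a v ρ ℓ M P) : Tendsto ℓ atTop (𝓝 0) :=
  squeeze_zero (fun k => (h.pos k).le) h.le_pow
    (tendsto_pow_atTop_nhds_zero_of_lt_one (by norm_num) (by norm_num))

end Scales

/-- The exponent attached to the `e`-th group of children in generation `k + 1`. -/
noncomputable def label (a b : ℝ) (k e : ℕ) : ℝ :=
  max (a + margin a k) (min (a + (b - a) * (e / k)) (1 - margin a k))

lemma le_label (a b : ℝ) (k e : ℕ) : a + margin a k ≤ label a b k e := le_max_left _ _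

lemma label_le {a : ℝ} (ha : a < 1) (b : ℝ) (k e : ℕ) : label a b k e ≤ 1 - margin a k :=
  max_le (by linarith [margin_le ha k]) (min_le_right _ _)

lemma label_le_add {a b : ℝ} (ha : a < 1) (hab : a ≤ b) {k e : ℕ} (he : e ≤ k) :
    label a b k e ≤ b + margin a k := by
  have h1 : (e / k : ℝ) ≤ 1 := div_le_one_of_le₀ (by exact_mod_cast he) (by positivity)
  refine max_le (by linarith) ((min_le_left _ _).trans ?_)
  nlinarith [margin_pos ha k]

/-- The mesh of generation `k + 1` inside an interval of generation `k`. -/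
noncomputable def mesh (ℓ : ℕ → ℝ) (M : ℕ → ℕ) (k : ℕ) : ℝ := ℓ k / ((k + 1 : ℕ) * M k)

/-- The left endpoints and exponents of the intervals of generation `k`. -/
noncomputable def cells (p a b : ℝ) (ℓ : ℕ → ℝ) (M : ℕ → ℕ) : ℕ → Finset (ℝ × ℝ)
  | 0 => {(p, 0)}
  | k + 1 => (cells p a b ℓ M k ×ˢ Finset.range (k + 1) ×ˢ Finset.range (M k)).image fun q =>
      (q.1.1 + (q.2.1 * M k + q.2.2 : ℕ) * mesh ℓ M k, label a b k q.2.1)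

lemma mem_cells_succ {p a b : ℝ} {ℓ : ℕ → ℝ} {M : ℕ → ℕ} {k : ℕ} {c : ℝ × ℝ} :
    c ∈ cells p a b ℓ M (k + 1) ↔ ∃ c' ∈ cells p a b ℓ M k, ∃ e < k + 1, ∃ d < M k,
      c = (c'.1 + (e * M k + d : ℕ) * mesh ℓ M k, label a b k e) := by
  simp only [cells, Finset.mem_image, Finset.mem_product, Finset.mem_range, Prod.exists]
  constructor
  · rintro ⟨x, y, e, d, ⟨h1, h2, h3⟩, rfl⟩
    exact ⟨x, y, h1, e, h2, d, h3, rfl⟩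
  · rintro ⟨x, y, h1, e, h2, d, h3, rfl⟩
    exact ⟨x, y, e, d, ⟨h1, h2, h3⟩, rfl⟩

namespace Scales

variable {p a b v ρ : ℝ} {ℓ : ℕ → ℝ} {M P : ℕ → ℕ}

lemma mesh_pos (h : Scales a v ρ ℓ M P) (k : ℕ) : 0 < mesh ℓ M k :=
  div_pos (h.pos k) (mul_pos (by exact_mod_cast Nat.succ_pos k) (h.M_cast_pos k))

lemma mul_mesh (h : Scales a v ρ ℓ M P) (k : ℕ) :
    (((k + 1) * M k : ℕ) : ℝ) * mesh ℓ M k = ℓ k := by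
  have h1 : (((k + 1) * M k : ℕ) : ℝ) ≠ 0 := by
    exact_mod_cast (Nat.mul_pos (Nat.succ_pos k) (h.M_pos k)).ne'
  unfold mesh
  rw [← Nat.cast_mul, mul_div_cancel₀ _ h1]

lemma index_lt {k e d : ℕ} (he : e < k + 1) (hd : d < M k) : e * M k + d < (k + 1) * M k := by
  calc e * M k + d < e * M k + M k := by omega
    _ = (e + 1) * M k := by ring
    _ ≤ _ := Nat.mul_le_mul_right _ he

lemma mul_mesh_add_le (h : Scales a v ρ ℓ M P) {k j : ℕ} (hj : j < (k + 1) * M k) :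
    j * mesh ℓ M k + mesh ℓ M k ≤ ℓ k := by
  rw [← h.mul_mesh k]
  have h1 : ((j + 1 : ℕ) : ℝ) ≤ ((k + 1) * M k : ℕ) := by exact_mod_cast hj
  have h2 := mul_le_mul_of_nonneg_right h1 (h.mesh_pos k).le
  push_cast at h2 ⊢
  linarith

lemma four_mul_le_mesh (h : Scales a v ρ ℓ M P) (k : ℕ) : 4 * ℓ (k + 1) ≤ mesh ℓ M k :=
  h.four_mul_le k

lemma child_subset (h : Scales a v ρ ℓ M P) {k j : ℕ} (hj : j < (k + 1) * M k) (s : ℝ) :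
    Icc (s + j * mesh ℓ M k) (s + j * mesh ℓ M k + ℓ (k + 1)) ⊆ Icc s (s + ℓ k) := by
  have h1 := h.mul_mesh_add_le hj
  have h2 := h.four_mul_le_mesh k
  have h3 := h.pos (k + 1)
  have h4 : 0 ≤ (j : ℝ) * mesh ℓ M k := mul_nonneg (by positivity) (h.mesh_pos k).le
  exact Icc_subset_Icc (by linarith) (by linarith)

lemma mesh_le_abs_sub (h : Scales a v ρ ℓ M P) (k : ℕ)
    (hsep : ∀ c ∈ cells p a b ℓ M k, ∀ c' ∈ cells p a b ℓ M k, c ≠ c' → 4 * ℓ k ≤ |c.1 - c'.1|) :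
    ∀ c ∈ cells p a b ℓ M (k + 1), ∀ c' ∈ cells p a b ℓ M (k + 1), c ≠ c' →
      mesh ℓ M k ≤ |c.1 - c'.1| := by
  intro c hc c' hc' hne
  have hm := h.mesh_pos k
  obtain ⟨q, hq, e, he, d, hd, rfl⟩ := mem_cells_succ.1 hc
  obtain ⟨q', hq', e', he', d', hd', rfl⟩ := mem_cells_succ.1 hc'
  have hj := index_lt he hd
  have hj' := index_lt he' hd'
  have b1 := h.mul_mesh_add_le hj
  have b2 := h.mul_mesh_add_le hj'
  have b3 : 0 ≤ ((e * M k + d : ℕ) : ℝ) * mesh ℓ M k := by positivity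
  have b4 : 0 ≤ ((e' * M k + d' : ℕ) : ℝ) * mesh ℓ M k := by positivity
  by_cases hqq : q = q'
  · subst hqq
    have hjj : e * M k + d ≠ e' * M k + d' := by
      intro heq
      have h1 : e = e' := by
        have := congrArg (· / M k) heq
        simpa [Nat.mul_comm _ (M k), Nat.mul_add_div (h.M_pos k), Nat.div_eq_of_lt hd,
          Nat.div_eq_of_lt hd'] using this
      subst h1
      exact hne (by rw [heq])
    have h1 : (1 : ℝ) ≤ |((e * M k + d : ℕ) : ℝ) - (e' * M k + d' : ℕ)| := by
      have h2 : (1 : ℤ) ≤ |((e * M k + d : ℕ) : ℤ) - (e' * M k + d' : ℕ)| :=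
        Int.one_le_abs (sub_ne_zero.2 (by exact_mod_cast hjj))
      exact_mod_cast h2
    rw [add_sub_add_left_eq_sub, ← sub_mul, abs_mul, abs_of_pos hm]
    nlinarith
  · have h1 := hsep q hq q' hq' hqq
    have h2 := h.pos k
    simp only
    rcases le_abs.1 h1 with h3 | h3
    · exact le_abs.2 (Or.inl (by linarith))
    · exact le_abs.2 (Or.inr (by linarith))

lemma cells_separated (h : Scales a v ρ ℓ M P) (k : ℕ) :
    ∀ c ∈ cells p a b ℓ M k, ∀ c' ∈ cells p a b ℓ M k, c ≠ c' → 4 * ℓ k ≤ |c.1 - c'.1| := by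
  induction k with
  | zero => simp [cells]
  | succ k ih =>
    intro c hc c' hc' hne
    exact (h.four_mul_le_mesh k).trans (h.mesh_le_abs_sub k ih c hc c' hc' hne)

lemma card_cells_le (h : Scales a v ρ ℓ M P) (k : ℕ) :
    (cells p a b ℓ M k).card ≤ k.factorial * P k := by
  induction k with
  | zero => simp [cells, h.P_zero]
  | succ k ih =>
    calc _ ≤ _ := Finset.card_image_le
      _ = (cells p a b ℓ M k).card * ((k + 1) * M k) := by
          simp [Finset.card_product]
      _ ≤ k.factorial * P k * ((k + 1) * M k) := Nat.mul_le_mul_right _ ih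
      _ = _ := by rw [h.P_succ, Nat.factorial_succ]; ring

lemma card_cells_mul_le (h : Scales a v ρ ℓ M P) (k : ℕ) :
    (cells p a b ℓ M (k + 1)).card * ℓ (k + 1) ^ (v + margin a k) ≤ (1 / 2) ^ (k + 1) := by
  refine le_trans ?_ (h.card_le k)
  have := h.pos (k + 1)
  gcongr
  exact_mod_cast h.card_cells_le (k + 1)

lemma genCond (h : Scales a v ρ ℓ M P) (hva : v ≤ a) (ha : a < 1) (k : ℕ) :
    GenCond (cells p a b ℓ M (k + 1)) (ℓ (k + 1)) (mesh ℓ M k) ((1 / 2) ^ (k + 1)) a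
      (margin a k) where
  pos := h.pos _
  le_one := h.le_one _
  four_mul_le := h.four_mul_le_mesh k
  separated := h.mesh_le_abs_sub k (h.cells_separated k)
  le_exp c hc := by
    obtain ⟨q, hq, e, he, d, hd, rfl⟩ := mem_cells_succ.1 hc
    exact le_label a b k e
  exp_le c hc := by
    obtain ⟨q, hq, e, he, d, hd, rfl⟩ := mem_cells_succ.1 hc
    exact label_le ha b k e
  mass_le := h.mass_le k
  rpow_le := h.rpow_le k
  total_le := by
    refine le_trans ?_ (h.card_cells_mul_le (p := p) (b := b) k)
    gcongr ?_ * ?_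
    exact Real.rpow_le_rpow_of_exponent_ge (h.pos _) (h.le_one _) (by linarith)

end Scales

/-- The union of the intervals of generation `k`. -/
def level (p a b : ℝ) (ℓ : ℕ → ℝ) (M : ℕ → ℕ) (k : ℕ) : Set ℝ :=
  ⋃ c ∈ cells p a b ℓ M k, Icc c.1 (c.1 + ℓ k)

lemma mem_level {p a b : ℝ} {ℓ : ℕ → ℝ} {M : ℕ → ℕ} {k : ℕ} {x : ℝ} :
    x ∈ level p a b ℓ M k ↔ ∃ c ∈ cells p a b ℓ M k, x ∈ Icc c.1 (c.1 + ℓ k) := by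
  simp only [level, mem_iUnion, exists_prop]

lemma isClosed_level (p a b : ℝ) (ℓ : ℕ → ℝ) (M : ℕ → ℕ) (k : ℕ) :
    IsClosed (level p a b ℓ M k) :=
  (Finset.finite_toSet _).isClosed_biUnion fun _ _ => isClosed_Icc

namespace Scales

variable {p a b v ρ : ℝ} {ℓ : ℕ → ℝ} {M P : ℕ → ℕ}

lemma level_antitone (h : Scales a v ρ ℓ M P) : Antitone (level p a b ℓ M) := by
  refine antitone_nat_of_succ_le fun k x hx => ?_
  obtain ⟨c, hc, hxc⟩ := mem_level.1 hx
  obtain ⟨q, hq, e, he, d, hd, rfl⟩ := mem_cells_succ.1 hc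
  exact mem_level.2 ⟨q, hq, h.child_subset (index_lt he hd) q.1 hxc⟩

lemma level_zero (h : Scales a v ρ ℓ M P) : level p a b ℓ M 0 = Icc p (p + ρ) := by
  simp [level, cells, h.zero]

lemma Icc_subset_of_mem_cells (h : Scales a v ρ ℓ M P) {k : ℕ} {c : ℝ × ℝ}
    (hc : c ∈ cells p a b ℓ M k) : Icc c.1 (c.1 + ℓ k) ⊆ Icc p (p + ρ) := by
  rw [← h.level_zero (b := b)]
  intro x hx
  exact h.level_antitone (Nat.zero_le k) (mem_level.2 ⟨c, hc, hx⟩)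

lemma cell_bounds (h : Scales a v ρ ℓ M P) {k : ℕ} {c : ℝ × ℝ}
    (hc : c ∈ cells p a b ℓ M k) : p ≤ c.1 ∧ c.1 + ℓ k ≤ p + ρ :=
  (Icc_subset_Icc_iff (by linarith [h.pos k])).1 (h.Icc_subset_of_mem_cells hc)

lemma cell_unique (h : Scales a v ρ ℓ M P) {k : ℕ} {c c' : ℝ × ℝ} {x : ℝ}
    (hc : c ∈ cells p a b ℓ M k) (hc' : c' ∈ cells p a b ℓ M k) (hx : x ∈ Icc c.1 (c.1 + ℓ k))
    (hx' : x ∈ Icc c'.1 (c'.1 + ℓ k)) : c = c' := by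
  by_contra hne
  have h1 := h.cells_separated k c hc c' hc' hne
  have h2 : |c.1 - c'.1| ≤ ℓ k := by
    rw [abs_le]; constructor <;> linarith [hx.1, hx.2, hx'.1, hx'.2]
  linarith [h.pos k]

end Scales

/-! ### The limit function of the nested construction -/

lemma abs_tsum_sub_tsum_le {g : ℕ → ℝ → ℝ} {C : ℕ → ℝ} {x y r : ℝ}
    (hx : Summable fun k => g k x) (hy : Summable fun k => g k y) (hC : Summable C)
    (hb : ∀ k, |g k y - g k x| ≤ C k * r) :
    |∑' k, g k y - ∑' k, g k x| ≤ (∑' k, C k) * r := by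
  rw [← hy.tsum_sub hx, ← tsum_mul_right]
  exact tsum_of_norm_bounded (f := fun k => g k y - g k x) (hC.mul_right r).hasSum hb

lemma summable_half_pow : Summable fun k : ℕ => (1 / 2 : ℝ) ^ (k + 1) :=
  (summable_nat_add_iff 1).2 summable_geometric_two

lemma tsum_half_pow : ∑' k : ℕ, (1 / 2 : ℝ) ^ (k + 1) = 1 := by
  simp only [pow_succ]
  rw [tsum_mul_right, tsum_geometric_two]; norm_num

/-- The contribution of the intervals of generation `k + 1`. -/
noncomputable def genStep (p a b : ℝ) (ℓ : ℕ → ℝ) (M : ℕ → ℕ) (k : ℕ) : ℝ → ℝ :=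
  genFun (cells p a b ℓ M (k + 1)) (ℓ (k + 1))

/-- The sum of the contributions of all generations. -/
noncomputable def blockFun (p a b : ℝ) (ℓ : ℕ → ℝ) (M : ℕ → ℕ) (x : ℝ) : ℝ :=
  ∑' k, genStep p a b ℓ M k x

/-- The limit set of the nested construction. -/
def blockSet (p a b : ℝ) (ℓ : ℕ → ℝ) (M : ℕ → ℕ) : Set ℝ := ⋂ k, level p a b ℓ M k

/-- The exponent of the interval of generation `k + 1` containing `x`. -/
noncomputable def cellExp (p a b : ℝ) (ℓ : ℕ → ℝ) (M : ℕ → ℕ) (x : ℝ) (k : ℕ) : ℝ :=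
  if h : ∃ c ∈ cells p a b ℓ M (k + 1), x ∈ Icc c.1 (c.1 + ℓ (k + 1)) then h.choose.2 else 0

/-- The pointwise exponent at a point of the limit set. -/
noncomputable def blockExp (p a b : ℝ) (ℓ : ℕ → ℝ) (M : ℕ → ℕ) (x : ℝ) : ℝ :=
  liminf (cellExp p a b ℓ M x) atTop

namespace Scales

variable {p a b v ρ : ℝ} {ℓ : ℕ → ℝ} {M P : ℕ → ℕ}

lemma cellExp_eq (h : Scales a v ρ ℓ M P) {x : ℝ} {k : ℕ} {c : ℝ × ℝ}
    (hc : c ∈ cells p a b ℓ M (k + 1)) (hx : x ∈ Icc c.1 (c.1 + ℓ (k + 1))) :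
    cellExp p a b ℓ M x k = c.2 := by
  have hex : ∃ c ∈ cells p a b ℓ M (k + 1), x ∈ Icc c.1 (c.1 + ℓ (k + 1)) := ⟨c, hc, hx⟩
  rw [cellExp, dif_pos hex, h.cell_unique hex.choose_spec.1 hc hex.choose_spec.2 hx]

lemma exists_cell {x : ℝ} (hx : x ∈ blockSet p a b ℓ M) (k : ℕ) :
    ∃ c ∈ cells p a b ℓ M k, x ∈ Icc c.1 (c.1 + ℓ k) := mem_level.1 (mem_iInter.1 hx k)

lemma genStep_nonneg (h : Scales a v ρ ℓ M P) (k : ℕ) (x : ℝ) : 0 ≤ genStep p a b ℓ M k x :=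
  genFun_nonneg _ (h.pos _).le x

lemma genStep_le (h : Scales a v ρ ℓ M P) (hva : v ≤ a) (ha : a < 1) (k : ℕ) (x : ℝ) :
    genStep p a b ℓ M k x ≤ (1 / 2) ^ (k + 1) := (h.genCond hva ha k).genFun_le x

lemma summable_genStep (h : Scales a v ρ ℓ M P) (hva : v ≤ a) (ha : a < 1) (x : ℝ) :
    Summable fun k => genStep p a b ℓ M k x :=
  Summable.of_nonneg_of_le (fun k => h.genStep_nonneg k x) (fun k => h.genStep_le hva ha k x)
    summable_half_pow

lemma genStep_eq_of_notMem (h : Scales a v ρ ℓ M P) {k : ℕ} {x y : ℝ}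
    (hxy : ∀ z ∈ uIcc x y, z ∉ level p a b ℓ M (k + 1)) :
    genStep p a b ℓ M k y = genStep p a b ℓ M k x := by
  refine genFun_eq_of_disjoint _ (h.pos _).le fun c hc => ?_
  have hpos := h.pos (k + 1)
  by_contra hcon
  rw [not_or, not_and_or, not_and_or, not_le, not_le, not_le, not_le] at hcon
  obtain ⟨h1, h2⟩ := hcon
  have h3 : c.1 < max x y := lt_max_iff.2 h1
  have h4 : min x y < c.1 + ℓ (k + 1) := min_lt_iff.2 h2
  refine hxy (max (min x y) c.1) ⟨le_max_left _ _, max_le min_le_max h3.le⟩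
    (mem_level.2 ⟨c, hc, le_max_right _ _, max_le h4.le (by linarith)⟩)

lemma blockFun_mono (h : Scales a v ρ ℓ M P) (hva : v ≤ a) (ha : a < 1) :
    Monotone (blockFun p a b ℓ M) := fun x y hxy =>
  (h.summable_genStep hva ha x).tsum_le_tsum (fun _ => genFun_mono _ (h.pos _).le hxy)
    (h.summable_genStep hva ha y)

lemma blockFun_nonneg (h : Scales a v ρ ℓ M P) (x : ℝ) : 0 ≤ blockFun p a b ℓ M x :=
  tsum_nonneg fun k => h.genStep_nonneg k x

lemma blockFun_le_one (h : Scales a v ρ ℓ M P) (hva : v ≤ a) (ha : a < 1) (x : ℝ) :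
    blockFun p a b ℓ M x ≤ 1 := by
  rw [← tsum_half_pow]
  exact (h.summable_genStep hva ha x).tsum_le_tsum (fun k => h.genStep_le hva ha k x)
    summable_half_pow

lemma blockFun_of_le (h : Scales a v ρ ℓ M P) {x : ℝ} (hx : x ≤ p) :
    blockFun p a b ℓ M x = 0 := by
  have : ∀ k, genStep p a b ℓ M k x = 0 := fun k => Finset.sum_eq_zero fun c hc => by
    rw [ramp_of_nonpos (by linarith [(h.cell_bounds hc).1]), mul_zero]
  simp [blockFun, this]

lemma blockFun_of_ge (h : Scales a v ρ ℓ M P) {x : ℝ} (hx : p + ρ ≤ x) :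
    blockFun p a b ℓ M x = blockFun p a b ℓ M (p + ρ) := by
  refine tsum_congr fun k => genFun_eq_of_disjoint _ (h.pos _).le fun c hc => Or.inr ?_
  have := (h.cell_bounds hc).2
  exact ⟨this, by linarith⟩

lemma abs_blockFun_sub_le (h : Scales a v ρ ℓ M P) (hva : v ≤ a) (ha0 : 0 ≤ a) (ha : a < 1)
    (x y : ℝ) : |blockFun p a b ℓ M y - blockFun p a b ℓ M x| ≤ 4 * |y - x| ^ a := by
  rcases le_or_gt |y - x| 1 with hxy | hxy
  · have hb := abs_tsum_sub_tsum_le (h.summable_genStep (p := p) (b := b) hva ha x)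
      (h.summable_genStep hva ha y)
      (summable_half_pow.mul_left 3) fun k => (h.genCond hva ha k).abs_sub_le_rpow ha0 ha.le hxy
    rw [tsum_mul_left, tsum_half_pow] at hb
    refine hb.trans ?_
    gcongr; norm_num
  · have h1 : 1 ≤ |y - x| ^ a := Real.one_le_rpow hxy.le ha0
    have h2 := h.blockFun_nonneg (p := p) (b := b) x
    have h3 := h.blockFun_nonneg (p := p) (b := b) y
    have h4 := h.blockFun_le_one (p := p) (b := b) hva ha x
    have h5 := h.blockFun_le_one (p := p) (b := b) hva ha y
    rw [abs_le]
    constructor <;> linarith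

/-- Off the limit set the block function is locally a finite sum of ramps. -/
lemma exists_finite_of_notMem (h : Scales a v ρ ℓ M P) (hva : v ≤ a) (ha : a < 1) {x : ℝ}
    (hx : x ∉ blockSet p a b ℓ M) :
    ∃ n : ℕ, ∀ᶠ y in 𝓝 x, blockFun p a b ℓ M y - blockFun p a b ℓ M x =
      (∑ k ∈ Finset.range n, genStep p a b ℓ M k y) -
        ∑ k ∈ Finset.range n, genStep p a b ℓ M k x := by
  obtain ⟨n, hn⟩ : ∃ n, x ∉ level p a b ℓ M n := by simpa [blockSet] using hx
  have hopen := (isClosed_level p a b ℓ M n).isOpen_compl.mem_nhds hn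
  obtain ⟨r, hr, hball⟩ := Metric.mem_nhds_iff.1 hopen
  refine ⟨n, ?_⟩
  filter_upwards [Metric.ball_mem_nhds x hr] with y hy
  have htail : ∀ k, genStep p a b ℓ M (k + n) y = genStep p a b ℓ M (k + n) x := by
    intro k
    refine h.genStep_eq_of_notMem fun z hz hzl => ?_
    refine hball ?_ (h.level_antitone (by omega : n ≤ k + n + 1) hzl)
    rw [Real.ball_eq_Ioo] at hy ⊢
    have h1 : x ∈ Ioo (x - r) (x + r) := ⟨by linarith, by linarith⟩
    exact (ordConnected_Ioo.uIcc_subset h1 hy) hz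
  unfold blockFun
  rw [← (h.summable_genStep hva ha y).sum_add_tsum_nat_add n,
    ← (h.summable_genStep hva ha x).sum_add_tsum_nat_add n, tsum_congr htail]
  ring

lemma rightAffine_blockFun (h : Scales a v ρ ℓ M P) (hva : v ≤ a) (ha : a < 1) {x : ℝ}
    (hx : x ∉ blockSet p a b ℓ M) : RightAffine (blockFun p a b ℓ M) x := by
  obtain ⟨n, hn⟩ := h.exists_finite_of_notMem hva ha hx
  obtain ⟨c, hc⟩ := RightAffine.sum (s := Finset.range n) (F := genStep p a b ℓ M) (x := x)
    fun k _ => rightAffine_genFun _ (h.pos _).le x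
  refine ⟨c, ?_⟩
  filter_upwards [nhdsWithin_le_nhds hn, hc] with y h1 h2
  rw [h1, h2]

lemma isBigO_blockFun_of_notMem (h : Scales a v ρ ℓ M P) (hva : v ≤ a) (ha : a < 1) {x : ℝ}
    (hx : x ∉ blockSet p a b ℓ M) :
    (fun y => blockFun p a b ℓ M y - blockFun p a b ℓ M x) =O[𝓝 x] fun y => y - x := by
  obtain ⟨n, hn⟩ := h.exists_finite_of_notMem hva ha hx
  refine Asymptotics.IsBigO.congr' (f₁ := fun y => ∑ k ∈ Finset.range n,
    (genStep p a b ℓ M k y - genStep p a b ℓ M k x)) (g₁ := fun y => y - x) ?_ ?_ EventuallyEq.rfl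
  · refine Asymptotics.IsBigO.fun_sum fun k _ => Asymptotics.IsBigO.of_bound
      (∑ c ∈ cells p a b ℓ M (k + 1), ℓ (k + 1) ^ (c.2 - 1)) (.of_forall fun y => ?_)
    exact abs_genFun_sub_le _ (h.pos _).le x y
  · filter_upwards [hn] with y hy
    rw [hy, Finset.sum_sub_distrib]

lemma le_cellExp (h : Scales a v ρ ℓ M P) (hva : v ≤ a) (ha : a < 1) {x : ℝ}
    (hx : x ∈ blockSet p a b ℓ M) (k : ℕ) : a ≤ cellExp p a b ℓ M x k := by
  obtain ⟨c, hc, hxc⟩ := exists_cell hx (k + 1)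
  rw [h.cellExp_eq hc hxc]
  linarith [(h.genCond hva ha k).le_exp c hc, margin_pos ha k]

lemma cellExp_le (h : Scales a v ρ ℓ M P) (hab : a ≤ b) (ha : a < 1) {x : ℝ}
    (hx : x ∈ blockSet p a b ℓ M) (k : ℕ) : cellExp p a b ℓ M x k ≤ b + margin a k := by
  obtain ⟨c, hc, hxc⟩ := exists_cell hx (k + 1)
  rw [h.cellExp_eq hc hxc]
  obtain ⟨q, hq, e, he, d, hd, rfl⟩ := mem_cells_succ.1 hc
  exact label_le_add ha hab (by omega)

lemma isBoundedUnder_ge_cellExp (h : Scales a v ρ ℓ M P) (hva : v ≤ a) (ha : a < 1) {x : ℝ}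
    (hx : x ∈ blockSet p a b ℓ M) :
    IsBoundedUnder (· ≥ ·) atTop (cellExp p a b ℓ M x) :=
  isBoundedUnder_of ⟨a, h.le_cellExp hva ha hx⟩

lemma isCoboundedUnder_ge_cellExp (h : Scales a v ρ ℓ M P) (hab : a ≤ b) (ha : a < 1) {x : ℝ}
    (hx : x ∈ blockSet p a b ℓ M) :
    IsCoboundedUnder (· ≥ ·) atTop (cellExp p a b ℓ M x) :=
  IsBoundedUnder.isCoboundedUnder_ge (isBoundedUnder_of ⟨b + (1 - a) / 2, fun k =>
    (h.cellExp_le hab ha hx k).trans (by linarith [margin_le ha k])⟩)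

lemma blockExp_mem (h : Scales a v ρ ℓ M P) (hva : v ≤ a) (hab : a ≤ b) (ha : a < 1) {x : ℝ}
    (hx : x ∈ blockSet p a b ℓ M) : blockExp p a b ℓ M x ∈ Icc a b := by
  constructor
  · exact le_liminf_of_le (h.isCoboundedUnder_ge_cellExp hab ha hx)
      (.of_forall (h.le_cellExp hva ha hx))
  · have ht : Tendsto (fun k => b + margin a k) atTop (𝓝 b) := by
      simpa using (tendsto_margin a).const_add b
    exact (liminf_le_liminf (.of_forall (h.cellExp_le hab ha hx))
      (h.isBoundedUnder_ge_cellExp hva ha hx) ht.isCoboundedUnder_ge).trans ht.liminf_eq.le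

lemma isBigO_blockFun_of_mem (h : Scales a v ρ ℓ M P) (hva : v ≤ a) (hab : a ≤ b) (ha : a < 1)
    (hb : b ≤ 1) {x : ℝ} (hx : x ∈ blockSet p a b ℓ M) {β : ℝ} (hβ0 : 0 < β)
    (hβ : β < blockExp p a b ℓ M x) :
    (fun y => blockFun p a b ℓ M y - blockFun p a b ℓ M x) =O[𝓝 x] fun y => |y - x| ^ β := by
  have hβ1 : β ≤ 1 := hβ.le.trans ((h.blockExp_mem hva hab ha hx).2.trans hb)
  obtain ⟨β', h1, h2⟩ := exists_between hβ
  have e1 := eventually_lt_of_lt_liminf h2 (h.isBoundedUnder_ge_cellExp hva ha hx)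
  have e2 := (tendsto_margin a).eventually (gt_mem_nhds (sub_pos.2 h1))
  obtain ⟨n, hn⟩ := eventually_atTop.1 (e1.and e2)
  let C : ℕ → ℝ := fun k => if k < n then ∑ c ∈ cells p a b ℓ M (k + 1), ℓ (k + 1) ^ (c.2 - 1)
    else 5 * (1 / 2) ^ (k + 1)
  have hC : Summable C := by
    refine (summable_half_pow.mul_left 5).congr_cofinite ?_
    rw [Nat.cofinite_eq_atTop]
    filter_upwards [eventually_ge_atTop n] with k hk
    simp [C, not_lt.2 hk]
  refine Asymptotics.IsBigO.of_bound (∑' k, C k) ?_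
  filter_upwards [Metric.ball_mem_nhds x one_pos] with y hy
  have hxy : |y - x| ≤ 1 := by rw [mem_ball, Real.dist_eq] at hy; exact hy.le
  rw [Real.norm_eq_abs, Real.norm_eq_abs, abs_of_nonneg (Real.rpow_nonneg (abs_nonneg _) _)]
  refine abs_tsum_sub_tsum_le (h.summable_genStep hva ha x) (h.summable_genStep hva ha y) hC
    fun k => ?_
  by_cases hk : k < n
  · simp only [C, if_pos hk]
    have hlip := abs_genFun_sub_le (cells p a b ℓ M (k + 1)) (h.pos (k + 1)).le x y
    refine hlip.trans ?_
    have h3 : |y - x| ≤ |y - x| ^ β := by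
      rcases (abs_nonneg (y - x)).eq_or_lt with h0 | h0
      · rw [← h0]; positivity
      · simpa using Real.rpow_le_rpow_of_exponent_ge h0 hxy hβ1
    exact mul_le_mul_of_nonneg_left h3
      (Finset.sum_nonneg fun c _ => Real.rpow_nonneg (h.pos _).le _)
  · simp only [C, if_neg hk]
    obtain ⟨c, hc, hxc⟩ := exists_cell hx (k + 1)
    have h4 := hn k (not_lt.1 hk)
    rw [h.cellExp_eq hc hxc] at h4
    exact (h.genCond hva ha k).abs_sub_le_rpow_of_mem hc hxc hβ0.le hβ1 (by linarith) hxy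

lemma rpow_cellExp_le (h : Scales a v ρ ℓ M P) (hva : v ≤ a) (ha : a < 1) {x : ℝ}
    (hx : x ∈ blockSet p a b ℓ M) (k : ℕ) : ℓ (k + 1) ^ cellExp p a b ℓ M x k ≤
      blockFun p a b ℓ M (x + ℓ (k + 1)) - blockFun p a b ℓ M (x - ℓ (k + 1)) := by
  obtain ⟨c, hc, hxc⟩ := exists_cell hx (k + 1)
  rw [h.cellExp_eq hc hxc]
  refine (le_genFun_sub (h.pos _) hc hxc).trans ?_
  have hpos := h.pos (k + 1)
  unfold blockFun
  rw [← (h.summable_genStep hva ha _).tsum_sub (h.summable_genStep hva ha _)]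
  refine ((h.summable_genStep hva ha _).sub (h.summable_genStep hva ha _)).le_tsum k
    fun j _ => sub_nonneg.2 ?_
  exact genFun_mono _ (h.pos _).le (by linarith)

/-- A lower bound for the symmetric increments at the scales `ℓ k` gives a lower bound for
one-sided increments. -/
lemma frequently_lt_abs_sub (h : Scales a v ρ ℓ M P) {F : ℝ → ℝ} {x C β : ℝ}
    (hf : ∃ᶠ k in atTop, 2 * (C * ℓ (k + 1) ^ β) < F (x + ℓ (k + 1)) - F (x - ℓ (k + 1))) :
    ∃ᶠ y in 𝓝 x, C * |y - x| ^ β < |F y - F x| := by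
  rw [Filter.frequently_iff]
  intro U hU
  obtain ⟨r, hr, hball⟩ := Metric.mem_nhds_iff.1 hU
  have e1 := ((tendsto_add_atTop_iff_nat 1).2 h.tendsto_zero).eventually (gt_mem_nhds hr)
  obtain ⟨k, hk1, hk2⟩ := (hf.and_eventually e1).exists
  have hpos := h.pos (k + 1)
  by_cases hcase : C * ℓ (k + 1) ^ β < |F (x + ℓ (k + 1)) - F x|
  · exact ⟨x + ℓ (k + 1), hball (by simpa [Real.dist_eq, abs_of_pos hpos] using hk2),
      by simpa [abs_of_pos hpos] using hcase⟩
  · refine ⟨x - ℓ (k + 1), hball (by simpa [Real.dist_eq, abs_of_pos hpos] using hk2), ?_⟩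
    rw [show x - ℓ (k + 1) - x = -ℓ (k + 1) by ring, abs_neg, abs_of_pos hpos]
    have h1 := (le_abs_self _).trans (not_lt.1 hcase)
    have h2 := neg_le_abs (F (x - ℓ (k + 1)) - F x)
    linarith

lemma frequently_lt_of_blockExp_lt (h : Scales a v ρ ℓ M P) (hva : v ≤ a) (hab : a ≤ b)
    (ha : a < 1) {x : ℝ} (hx : x ∈ blockSet p a b ℓ M) {β : ℝ}
    (hβ : blockExp p a b ℓ M x < β) (C : ℝ) :
    ∃ᶠ y in 𝓝 x, C * |y - x| ^ β < |blockFun p a b ℓ M y - blockFun p a b ℓ M x| := by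
  obtain ⟨β', h1, h2⟩ := exists_between hβ
  have e1 := frequently_lt_of_liminf_lt (h.isCoboundedUnder_ge_cellExp hab ha hx) h1
  have hc : 0 < 1 / (2 * (|C| + 1)) := by positivity
  have hℓ : Tendsto (fun k => ℓ (k + 1)) atTop (𝓝[>] 0) :=
    tendsto_nhdsWithin_iff.2 ⟨(tendsto_add_atTop_iff_nat 1).2 h.tendsto_zero,
      .of_forall fun k => h.pos _⟩
  have e2 := hℓ.eventually (eventually_rpow_le (sub_pos.2 h2) hc)
  refine h.frequently_lt_abs_sub ((e1.and_eventually e2).mono ?_)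
  rintro k ⟨h3, h4⟩
  have hpos := h.pos (k + 1)
  refine lt_of_lt_of_le ?_ (h.rpow_cellExp_le hva ha hx k)
  calc 2 * (C * ℓ (k + 1) ^ β) = 2 * C * (ℓ (k + 1) ^ (β - β') * ℓ (k + 1) ^ β') := by
        rw [← Real.rpow_add hpos, sub_add_cancel]; ring
    _ ≤ 2 * |C| * (1 / (2 * (|C| + 1)) * ℓ (k + 1) ^ β') := by
        gcongr; exact le_abs_self C
    _ = |C| / (|C| + 1) * ℓ (k + 1) ^ β' := by field_simp
    _ < 1 * ℓ (k + 1) ^ β' := by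
        gcongr
        rw [div_lt_one (by positivity)]; linarith
    _ ≤ _ := by
        rw [one_mul]
        exact Real.rpow_le_rpow_of_exponent_ge hpos (h.le_one _) h3.le

lemma frequently_superlinear (h : Scales a v ρ ℓ M P) (hva : v ≤ a) (ha : a < 1) {x : ℝ}
    (hx : x ∈ blockSet p a b ℓ M) (C : ℝ) :
    ∃ᶠ y in 𝓝 x, C * |y - x| < |blockFun p a b ℓ M y - blockFun p a b ℓ M x| := by
  have hc : 0 < 1 / (2 * (|C| + 1)) := by positivity
  have e1 : ∀ᶠ k : ℕ in atTop, (1 / 2 : ℝ) ^ (k + 1) ≤ 1 / (2 * (|C| + 1)) :=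
    ((summable_half_pow.tendsto_atTop_zero).eventually (gt_mem_nhds hc)).mono fun _ hk => hk.le
  have := h.frequently_lt_abs_sub (F := blockFun p a b ℓ M) (x := x) (C := C) (β := 1)
    (e1.mono ?_).frequently
  · simpa using this
  intro k hk
  have hpos := h.pos (k + 1)
  refine lt_of_lt_of_le ?_ (h.rpow_cellExp_le hva ha hx k)
  obtain ⟨c, hc, hxc⟩ := exists_cell hx (k + 1)
  rw [h.cellExp_eq hc hxc, Real.rpow_one]
  have hg := h.genCond (p := p) (b := b) hva ha k
  calc 2 * (C * ℓ (k + 1)) = 2 * C * (ℓ (k + 1) ^ margin a k * ℓ (k + 1) ^ (1 - margin a k)) := by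
        rw [← Real.rpow_add hpos]; simp [mul_assoc]
    _ ≤ 2 * |C| * (1 / (2 * (|C| + 1)) * ℓ (k + 1) ^ (1 - margin a k)) := by
        gcongr
        · exact le_abs_self C
        · exact hg.rpow_le.trans hk
    _ = |C| / (|C| + 1) * ℓ (k + 1) ^ (1 - margin a k) := by field_simp
    _ < 1 * ℓ (k + 1) ^ (1 - margin a k) := by
        gcongr
        rw [div_lt_one (by positivity)]; linarith
    _ ≤ _ := by
        rw [one_mul]
        exact Real.rpow_le_rpow_of_exponent_ge hpos (h.le_one _) (hg.exp_le c hc)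

end Scales

/-! ### Dimension of the limit set -/

lemma dimH_le_of_tendsto_card {s : Set ℝ} {T : ℕ → Finset (ℝ × ℝ)} {L : ℕ → ℝ} {v : ℝ}
    (hv : 0 ≤ v) (hL0 : ∀ k, 0 ≤ L k) (hL : Tendsto L atTop (𝓝 0))
    (hs : ∀ k, s ⊆ ⋃ c ∈ T k, Icc c.1 (c.1 + L k))
    (hd : ∀ d > v, Tendsto (fun k => (T k).card * L k ^ d) atTop (𝓝 0)) :
    dimH s ≤ ENNReal.ofReal v := by
  refine dimH_le fun d htop => ?_
  by_contra hlt
  rw [not_le, ENNReal.ofReal_lt_iff_lt_toReal hv ENNReal.coe_ne_top, ENNReal.coe_toReal] at hlt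
  have hlim : Tendsto (fun k => ENNReal.ofReal ((T k).card * L k ^ (d : ℝ))) atTop (𝓝 0) := by
    simpa using ENNReal.tendsto_ofReal (hd d hlt)
  have hdiam : ∀ k (c : T k), ediam (Icc c.1.1 (c.1.1 + L k)) = ENNReal.ofReal (L k) := by
    intro k c
    rw [Real.ediam_Icc, add_sub_cancel_left]
  have h := Measure.hausdorffMeasure_le_liminf_sum (ι := fun k => T k) (d : ℝ) s (l := atTop)
    (fun k => ENNReal.ofReal (L k)) (by simpa using ENNReal.tendsto_ofReal hL)
    (fun k c => Icc c.1.1 (c.1.1 + L k)) (.of_forall fun k c => (hdiam k c).le)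
    (.of_forall fun k => by
      refine (hs k).trans fun x hx => ?_
      simp only [mem_iUnion] at hx ⊢
      obtain ⟨c, hc, hx⟩ := hx
      exact ⟨⟨c, hc⟩, hx⟩)
  have hsum : (fun k => ∑ c : T k, ediam (Icc c.1.1 (c.1.1 + L k)) ^ (d : ℝ)) =
      fun k => ENNReal.ofReal ((T k).card * L k ^ (d : ℝ)) := by
    funext k
    simp only [hdiam]
    rw [Finset.sum_const, nsmul_eq_mul, ENNReal.ofReal_mul (by positivity),
      ENNReal.ofReal_rpow_of_nonneg (hL0 k) d.coe_nonneg]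
    simp
  rw [hsum, hlim.liminf_eq, htop] at h
  simp at h

lemma le_dimH_image_of_abs_sub_le {X : ℝ → ℝ} {C v : ℝ} (hC : 0 ≤ C) (hv : 0 ≤ v)
    (h : ∀ t ∈ Ico (0 : ℝ) 1, ∀ t' ∈ Ico (0 : ℝ) 1, |t - t'| ≤ C * |X t - X t'| ^ v) :
    ENNReal.ofReal v ≤ dimH (X '' Ico 0 1) := by
  rcases hv.eq_or_lt with rfl | hv0
  · simp
  have hinj : InjOn X (Ico 0 1) := by
    intro t ht t' ht' heq
    have := h t ht t' ht'
    rw [heq, sub_self, abs_zero, Real.zero_rpow hv0.ne', mul_zero] at this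
    exact sub_eq_zero.1 (abs_nonpos_iff.1 this)
  have hhol : HolderOnWith C.toNNReal v.toNNReal (Function.invFunOn X (Ico 0 1))
      (X '' Ico 0 1) := by
    rintro _ ⟨t, ht, rfl⟩ _ ⟨t', ht', rfl⟩
    rw [hinj.leftInvOn_invFunOn ht, hinj.leftInvOn_invFunOn ht', edist_dist, edist_dist,
      Real.dist_eq, Real.dist_eq, Real.coe_toNNReal v hv,
      ENNReal.ofReal_rpow_of_nonneg (abs_nonneg _) hv]
    change _ ≤ ENNReal.ofReal C * _
    rw [← ENNReal.ofReal_mul hC]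
    exact ENNReal.ofReal_le_ofReal (h t ht t' ht')
  have hle := hhol.dimH_image_le (by simpa using hv0)
  rw [hinj.leftInvOn_invFunOn.image_image, Real.dimH_of_mem_nhds (x := (1 / 2 : ℝ))
    (Ico_mem_nhds (by norm_num) (by norm_num)), Module.finrank_self, Nat.cast_one] at hle
  change 1 ≤ _ / ENNReal.ofReal v at hle
  rwa [ENNReal.le_div_iff_mul_le (Or.inl (by simpa using hv0)) (Or.inl ENNReal.ofReal_ne_top),
    one_mul] at hle

/-- The left endpoint of the interval of generation `k` with address given by the group indices
`e` and the digits `d`. -/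
noncomputable def addr (p : ℝ) (ℓ : ℕ → ℝ) (M e d : ℕ → ℕ) : ℕ → ℝ
  | 0 => p
  | k + 1 => addr p ℓ M e d k + (e k * M k + d k : ℕ) * mesh ℓ M k

lemma addr_congr {p : ℝ} {ℓ : ℕ → ℝ} {M e d d' : ℕ → ℕ} {k : ℕ} (h : ∀ j < k, d j = d' j) :
    addr p ℓ M e d k = addr p ℓ M e d' k := by
  induction k with
  | zero => rfl
  | succ k ih => rw [addr, addr, ih fun j hj => h j (by omega), h k (by omega)]

/-- The point of the limit set with given address. -/
noncomputable def addrPoint (p : ℝ) (ℓ : ℕ → ℝ) (M e d : ℕ → ℕ) : ℝ := ⨆ k, addr p ℓ M e d k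

/-- The `k`-th digit of `t` in the mixed radix expansion with partial products `P`. -/
noncomputable def digit (M P : ℕ → ℕ) (t : ℝ) (k : ℕ) : ℕ := ⌊t * P (k + 1)⌋₊ % M k

namespace Scales

variable {p a b v ρ : ℝ} {ℓ : ℕ → ℝ} {M P e d d' : ℕ → ℕ}

lemma isClosed_blockSet (p a b : ℝ) (ℓ : ℕ → ℝ) (M : ℕ → ℕ) : IsClosed (blockSet p a b ℓ M) :=
  isClosed_iInter fun k => isClosed_level p a b ℓ M k

lemma blockSet_subset (h : Scales a v ρ ℓ M P) : blockSet p a b ℓ M ⊆ Icc p (p + ρ) := by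
  rw [← h.level_zero (b := b)]
  exact iInter_subset _ 0

lemma dimH_blockSet_le (h : Scales a v ρ ℓ M P) (hv : 0 ≤ v) :
    dimH (blockSet p a b ℓ M) ≤ ENNReal.ofReal v := by
  refine dimH_le_of_tendsto_card (T := fun k => cells p a b ℓ M (k + 1))
    (L := fun k => ℓ (k + 1)) hv (fun k => (h.pos _).le)
    ((tendsto_add_atTop_iff_nat 1).2 h.tendsto_zero) (fun k => iInter_subset _ (k + 1)) ?_
  intro d hd
  have e1 := (tendsto_margin a).eventually (gt_mem_nhds (sub_pos.2 hd))
  refine squeeze_zero' (.of_forall fun k => ?_) (e1.mono fun k hk => ?_)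
    summable_half_pow.tendsto_atTop_zero
  · have := h.pos (k + 1)
    positivity
  · refine le_trans ?_ (h.card_cells_mul_le (p := p) (b := b) k)
    gcongr ?_ * ?_
    exact Real.rpow_le_rpow_of_exponent_ge (h.pos _) (h.le_one _) (by linarith)

lemma exists_addr_mem_cells (he : ∀ k, e k < k + 1) (hd : ∀ k, d k < M k) (k : ℕ) :
    ∃ r, (addr p ℓ M e d k, r) ∈ cells p a b ℓ M k := by
  induction k with
  | zero => exact ⟨0, by simp [addr, cells]⟩
  | succ k ih =>
    obtain ⟨r, hr⟩ := ih
    exact ⟨label a b k (e k), mem_cells_succ.2 ⟨_, hr, e k, he k, d k, hd k, rfl⟩⟩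

lemma addr_mem_cells (he : ∀ k, e k < k + 1) (hd : ∀ k, d k < M k) (k : ℕ) :
    (addr p ℓ M e d (k + 1), label a b k (e k)) ∈ cells p a b ℓ M (k + 1) := by
  obtain ⟨r, hr⟩ := exists_addr_mem_cells (p := p) (a := a) (b := b) (ℓ := ℓ) he hd k
  exact mem_cells_succ.2 ⟨_, hr, e k, he k, d k, hd k, rfl⟩

lemma addrPoint_mem_Icc (h : Scales a v ρ ℓ M P) (he : ∀ k, e k < k + 1) (hd : ∀ k, d k < M k)
    (k : ℕ) :
    addrPoint p ℓ M e d ∈ Icc (addr p ℓ M e d k) (addr p ℓ M e d k + ℓ k) := by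
  refine mem_iInter.1 (ciSup_mem_iInter_Icc_of_antitone_Icc (f := addr p ℓ M e d)
    (g := fun k => addr p ℓ M e d k + ℓ k) ?_ fun k => by linarith [h.pos k]) k
  exact antitone_nat_of_succ_le fun k => h.child_subset (index_lt (he k) (hd k)) _

lemma addrPoint_mem (h : Scales a v ρ ℓ M P) (he : ∀ k, e k < k + 1) (hd : ∀ k, d k < M k) :
    addrPoint p ℓ M e d ∈ blockSet p a b ℓ M := by
  refine mem_iInter.2 fun k => ?_
  obtain ⟨r, hr⟩ := exists_addr_mem_cells (p := p) (a := a) (b := b) (ℓ := ℓ) he hd k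
  exact mem_level.2 ⟨_, hr, h.addrPoint_mem_Icc he hd k⟩

lemma cellExp_addrPoint (h : Scales a v ρ ℓ M P) (he : ∀ k, e k < k + 1)
    (hd : ∀ k, d k < M k) (k : ℕ) :
    cellExp p a b ℓ M (addrPoint p ℓ M e d) k = label a b k (e k) :=
  h.cellExp_eq (addr_mem_cells he hd k) (h.addrPoint_mem_Icc he hd (k + 1))

lemma le_abs_addrPoint_sub (h : Scales a v ρ ℓ M P) (he : ∀ k, e k < k + 1)
    (hd : ∀ k, d k < M k) (hd' : ∀ k, d' k < M k) {k : ℕ} (heq : ∀ j < k, d j = d' j)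
    (hne : d k ≠ d' k) : |(d k : ℝ) - d' k| * mesh ℓ M k ≤
      2 * |addrPoint p ℓ M e d - addrPoint p ℓ M e d'| := by
  have h1 := h.addrPoint_mem_Icc (p := p) he hd (k + 1)
  have h2 := h.addrPoint_mem_Icc (p := p) he hd' (k + 1)
  have h3 : (1 : ℝ) ≤ |(d k : ℝ) - d' k| := by
    have : (1 : ℤ) ≤ |(d k : ℤ) - d' k| :=
      Int.one_le_abs (sub_ne_zero.2 (by exact_mod_cast hne))
    exact_mod_cast this
  have h4 := h.four_mul_le_mesh k
  have h5 := h.mesh_pos k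
  set x := addrPoint p ℓ M e d
  set x' := addrPoint p ℓ M e d'
  have h6 : addr p ℓ M e d (k + 1) - addr p ℓ M e d' (k + 1) =
      ((d k : ℝ) - d' k) * mesh ℓ M k := by
    rw [addr, addr, addr_congr heq]; push_cast; ring
  have h7 : |((d k : ℝ) - d' k) * mesh ℓ M k - (x - x')| ≤ ℓ (k + 1) := by
    rw [← h6, abs_le]; constructor <;> linarith [h1.1, h1.2, h2.1, h2.2]
  have h8 := abs_sub_abs_le_abs_sub (((d k : ℝ) - d' k) * mesh ℓ M k) (x - x')
  rw [abs_mul, abs_of_pos h5] at h8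
  nlinarith

lemma digit_lt (h : Scales a v ρ ℓ M P) (t : ℝ) (k : ℕ) : digit M P t k < M k :=
  Nat.mod_lt _ (h.M_pos k)

lemma floor_eq_digit (h : Scales a v ρ ℓ M P) (t : ℝ) (k : ℕ) :
    ⌊t * P (k + 1)⌋₊ = M k * ⌊t * P k⌋₊ + digit M P t k := by
  have h1 : ⌊t * P k⌋₊ = ⌊t * P (k + 1)⌋₊ / M k := by
    rw [← Nat.floor_div_natCast, h.P_succ, Nat.cast_mul, ← mul_assoc,
      mul_div_cancel_right₀ _ (h.M_cast_pos k).ne']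
  rw [h1, digit, Nat.div_add_mod]

lemma floor_eq_of_digit_eq (h : Scales a v ρ ℓ M P) {t t' : ℝ} (ht : t ∈ Ico (0 : ℝ) 1)
    (ht' : t' ∈ Ico (0 : ℝ) 1) {k : ℕ} (heq : ∀ j < k, digit M P t j = digit M P t' j) :
    ⌊t * P k⌋₊ = ⌊t' * P k⌋₊ := by
  induction k with
  | zero => simp [h.P_zero, Nat.floor_eq_zero.2 ht.2, Nat.floor_eq_zero.2 ht'.2]
  | succ k ih =>
    rw [h.floor_eq_digit, h.floor_eq_digit, ih fun j hj => heq j (by omega), heq k (by omega)]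

lemma abs_mul_sub_mul_lt {t t' q : ℝ} (ht : 0 ≤ t) (ht' : 0 ≤ t') (hq : 0 ≤ q) :
    |t - t'| * q < |(⌊t * q⌋₊ : ℝ) - ⌊t' * q⌋₊| + 1 := by
  have h1 := Nat.floor_le (mul_nonneg ht hq)
  have h2 := Nat.floor_le (mul_nonneg ht' hq)
  have h3 := Nat.lt_floor_add_one (t * q)
  have h4 := Nat.lt_floor_add_one (t' * q)
  rw [← abs_of_nonneg hq, ← abs_mul, abs_of_nonneg hq, sub_mul]
  have h5 := le_abs_self ((⌊t * q⌋₊ : ℝ) - ⌊t' * q⌋₊)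
  have h6 := neg_le_abs ((⌊t * q⌋₊ : ℝ) - ⌊t' * q⌋₊)
  rw [abs_lt]
  constructor <;> linarith

lemma exists_digit_ne (h : Scales a v ρ ℓ M P) (hv : 0 ≤ v) (hρ : 0 < ρ) {t t' : ℝ}
    (ht : t ∈ Ico (0 : ℝ) 1) (ht' : t' ∈ Ico (0 : ℝ) 1) (hne : t ≠ t') :
    ∃ k, digit M P t k ≠ digit M P t' k := by
  by_contra hall
  push Not at hall
  have hpos : 0 < |t - t'| := abs_pos.2 (sub_ne_zero.2 hne)
  have hb : ∀ k : ℕ, |t - t'| * ((k + 1) * ρ ^ v) < 1 := by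
    intro k
    have h1 := abs_mul_sub_mul_lt ht.1 ht'.1 (Nat.cast_nonneg (P k))
    rw [h.floor_eq_of_digit_eq ht ht' fun j _ => hall j, sub_self, abs_zero, zero_add] at h1
    refine lt_of_le_of_lt (mul_le_mul_of_nonneg_left ((h.le_card k).trans ?_) hpos.le) h1
    exact mul_le_of_le_one_right (by positivity) (Real.rpow_le_one (h.pos k).le (h.le_one k) hv)
  have hc : 0 < |t - t'| * ρ ^ v := by positivity
  obtain ⟨n, hn⟩ := exists_nat_gt (1 / (|t - t'| * ρ ^ v))
  have h1 := hb n
  rw [div_lt_iff₀ hc] at hn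
  nlinarith

lemma abs_sub_le_addrPoint (h : Scales a v ρ ℓ M P) (hv : 0 ≤ v) (hv1 : v ≤ 1) (hρ : 0 < ρ)
    (he : ∀ k, e k < k + 1) {t t' : ℝ} (ht : t ∈ Ico (0 : ℝ) 1) (ht' : t' ∈ Ico (0 : ℝ) 1) :
    |t - t'| ≤ 4 / ρ ^ v *
      |addrPoint p ℓ M e (digit M P t) - addrPoint p ℓ M e (digit M P t')| ^ v := by
  rcases eq_or_ne t t' with rfl | hne
  · rw [sub_self, abs_zero]; positivity
  classical
  have hex := h.exists_digit_ne hv hρ ht ht' hne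
  set k := Nat.find hex
  have hk : digit M P t k ≠ digit M P t' k := Nat.find_spec hex
  have heq : ∀ j < k, digit M P t j = digit M P t' j := fun j hj => not_not.1 (Nat.find_min hex hj)
  have hX := h.le_abs_addrPoint_sub (p := p) he (h.digit_lt t) (h.digit_lt t') heq hk
  set Δ := |addrPoint p ℓ M e (digit M P t) - addrPoint p ℓ M e (digit M P t')|
  have hT := abs_mul_sub_mul_lt ht.1 ht'.1 (Nat.cast_nonneg (P (k + 1)))
  have hD : (⌊t * P (k + 1)⌋₊ : ℝ) - ⌊t' * P (k + 1)⌋₊ =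
      (digit M P t k : ℝ) - digit M P t' k := by
    rw [h.floor_eq_digit, h.floor_eq_digit, h.floor_eq_of_digit_eq ht ht' heq]
    push_cast; ring
  rw [hD] at hT
  set D := |(digit M P t k : ℝ) - digit M P t' k| with hDdef
  have hD1 : 1 ≤ D := by
    have : (1 : ℤ) ≤ |(digit M P t k : ℤ) - digit M P t' k| :=
      Int.one_le_abs (sub_ne_zero.2 (by exact_mod_cast hk))
    rw [hDdef]
    exact_mod_cast this
  have hDM : D ≤ M k := by
    have h1 : (digit M P t k : ℝ) < M k := by exact_mod_cast h.digit_lt t k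
    have h2 : (digit M P t' k : ℝ) < M k := by exact_mod_cast h.digit_lt t' k
    rw [hDdef, abs_le]
    constructor <;> linarith [(Nat.cast_nonneg _ : (0 : ℝ) ≤ digit M P t k),
      (Nat.cast_nonneg _ : (0 : ℝ) ≤ digit M P t' k)]
  have hM := h.M_cast_pos k
  have hP : (0 : ℝ) < P k := by exact_mod_cast h.P_pos k
  have hℓ := h.pos k
  have hcard := h.le_card k
  have hΔ : 0 ≤ Δ := abs_nonneg _
  have hr : D / M k ≤ (D / M k) ^ v := by
    simpa using Real.rpow_le_rpow_of_exponent_ge (x := D / M k) (by positivity)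
      ((div_le_one hM).2 hDM) hv1
  have hs : (1 : ℝ) / (k + 1) ≤ (1 / (k + 1)) ^ v := by
    simpa using Real.rpow_le_rpow_of_exponent_ge (x := (1 : ℝ) / (k + 1)) (by positivity)
      ((div_le_one (by positivity)).2 (by linarith [(Nat.cast_nonneg k : (0 : ℝ) ≤ k)])) hv1
  have hmesh : D * mesh ℓ M k = D / M k * (1 / (k + 1)) * ℓ k := by
    unfold mesh; push_cast; field_simp
  have h2v : (2 : ℝ) ^ v ≤ 2 := by
    simpa using Real.rpow_le_rpow_of_exponent_le (by norm_num : (1 : ℝ) ≤ 2) hv1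
  have hΔv : D / M k * (1 / (k + 1)) * ℓ k ^ v ≤ 2 * Δ ^ v := by
    calc D / M k * (1 / (k + 1)) * ℓ k ^ v ≤ (D / M k) ^ v * (1 / (k + 1)) ^ v * ℓ k ^ v := by
          gcongr
      _ = (D * mesh ℓ M k) ^ v := by
          rw [hmesh, Real.mul_rpow (by positivity) hℓ.le, Real.mul_rpow (by positivity)
            (by positivity)]
      _ ≤ (2 * Δ) ^ v := by
          have := h.mesh_pos k
          exact Real.rpow_le_rpow (by positivity) hX hv
      _ = 2 ^ v * Δ ^ v := Real.mul_rpow (by norm_num) hΔ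
      _ ≤ 2 * Δ ^ v := by gcongr
  have hρv : 0 < ρ ^ v := by positivity
  rw [h.P_succ, Nat.cast_mul] at hT
  have hfin : |t - t'| ≤ 2 * (D / M k) / P k := by
    rw [le_div_iff₀ hP, ← mul_div_assoc, le_div_iff₀ hM]
    linarith
  refine hfin.trans ?_
  have h1P : 1 / (P k : ℝ) ≤ 1 / (k + 1) * ℓ k ^ v / ρ ^ v := by
    rw [le_div_iff₀ hρv, one_div_mul_eq_div, one_div_mul_eq_div, div_le_div_iff₀ hP (by positivity)]
    linarith
  calc 2 * (D / M k) / P k = 2 * (D / M k) * (1 / P k) := by ring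
    _ ≤ 2 * (D / M k) * (1 / (k + 1) * ℓ k ^ v / ρ ^ v) := by gcongr
    _ = 2 / ρ ^ v * (D / M k * (1 / (k + 1)) * ℓ k ^ v) := by ring
    _ ≤ 2 / ρ ^ v * (2 * Δ ^ v) := by gcongr
    _ = _ := by ring

lemma tendsto_label {θ : ℝ} (hθ0 : 0 ≤ θ) (h0 : a ≤ a + (b - a) * θ)
    (h1 : a + (b - a) * θ ≤ 1) :
    Tendsto (fun k : ℕ => label a b k ⌊θ * k⌋₊) atTop (𝓝 (a + (b - a) * θ)) := by
  have t1 : Tendsto (fun k : ℕ => (⌊θ * k⌋₊ : ℝ) / k) atTop (𝓝 θ) :=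
    (tendsto_nat_floor_mul_div_atTop hθ0).comp tendsto_natCast_atTop_atTop
  have t2 : Tendsto (fun k : ℕ => a + margin a k) atTop (𝓝 a) := by
    simpa using (tendsto_margin a).const_add a
  have t3 : Tendsto (fun k : ℕ => 1 - margin a k) atTop (𝓝 1) := by
    simpa using (tendsto_margin a).const_sub 1
  have t4 := t2.max (((t1.const_mul (b - a)).const_add a).min t3)
  rwa [min_eq_left h1, max_eq_right h0] at t4

lemma blockExp_level (h : Scales a v ρ ℓ M P) (hv : 0 ≤ v) (hv1 : v ≤ 1)
    (hρ : 0 < ρ) {H : ℝ} (hH : H ∈ Icc a b) (hH1 : H ≤ 1) :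
    {x ∈ blockSet p a b ℓ M | blockExp p a b ℓ M x = H}.Nonempty ∧
      ENNReal.ofReal v ≤ dimH {x ∈ blockSet p a b ℓ M | blockExp p a b ℓ M x = H} := by
  obtain ⟨θ, hθ0, hθ1, hθ⟩ : ∃ θ : ℝ, 0 ≤ θ ∧ θ ≤ 1 ∧ a + (b - a) * θ = H := by
    rcases (hH.1.trans hH.2).eq_or_lt with rfl | hlt
    · exact ⟨0, le_rfl, zero_le_one, by linarith [hH.1, hH.2]⟩
    · have : 0 < b - a := by linarith
      refine ⟨(H - a) / (b - a), div_nonneg (by linarith [hH.1]) this.le,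
        (div_le_one this).2 (by linarith [hH.2]), by field_simp; ring⟩
  have he : ∀ k : ℕ, ⌊θ * k⌋₊ < k + 1 := fun k => by
    rw [Nat.lt_succ_iff]
    refine Nat.floor_le_of_le ?_
    exact mul_le_of_le_one_left (Nat.cast_nonneg k) hθ1
  have hsub : (fun t => addrPoint p ℓ M (fun k => ⌊θ * k⌋₊) (digit M P t)) '' Ico 0 1 ⊆
      {x ∈ blockSet p a b ℓ M | blockExp p a b ℓ M x = H} := by
    rintro _ ⟨t, -, rfl⟩
    refine ⟨h.addrPoint_mem he (h.digit_lt t), ?_⟩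
    unfold blockExp
    rw [show cellExp p a b ℓ M (addrPoint p ℓ M (fun k : ℕ => ⌊θ * k⌋₊) (digit M P t)) =
      fun k : ℕ => label a b k ⌊θ * k⌋₊ from funext (h.cellExp_addrPoint he (h.digit_lt t)), ← hθ]
    exact (tendsto_label hθ0 (by linarith [hH.1]) (by linarith)).liminf_eq
  refine ⟨((nonempty_Ico.2 one_pos).image _).mono hsub, le_trans ?_ (dimH_mono hsub)⟩
  exact le_dimH_image_of_abs_sub_le (by positivity) hv fun t ht t' ht' =>
    h.abs_sub_le_addrPoint hv hv1 hρ he ht ht'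

end Scales

/-- A block: a monotone function `F` on `[p, p + ρ]`, singular with pointwise exponents `H` on the
closed set `K` and locally Lipschitz elsewhere. -/
structure IsBlock (p ρ a b v : ℝ) (K : Set ℝ) (F H : ℝ → ℝ) : Prop where
  isClosed : IsClosed K
  subset : K ⊆ Icc p (p + ρ)
  mono : Monotone F
  nonneg : ∀ x, 0 ≤ F x
  le_one : ∀ x, F x ≤ 1
  of_le : ∀ {x}, x ≤ p → F x = 0
  of_ge : ∀ {x}, p + ρ ≤ x → F x = F (p + ρ)
  abs_sub_le : ∀ x y, |F y - F x| ≤ 4 * |y - x| ^ a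
  rightAffine : ∀ {x}, x ∉ K → RightAffine F x
  isBigO_of_notMem : ∀ {x}, x ∉ K → (fun y => F y - F x) =O[𝓝 x] fun y => y - x
  exp_mem : ∀ {x}, x ∈ K → H x ∈ Icc a b
  isBigO_of_mem : ∀ {x}, x ∈ K → ∀ {β}, 0 < β → β < H x →
    (fun y => F y - F x) =O[𝓝 x] fun y => |y - x| ^ β
  growth : ∀ {x}, x ∈ K → ∀ {β}, H x < β → ∀ C, ∃ᶠ y in 𝓝 x, C * |y - x| ^ β < |F y - F x|
  superlinear : ∀ {x}, x ∈ K → ∀ C, ∃ᶠ y in 𝓝 x, C * |y - x| < |F y - F x|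
  dimH_le : dimH K ≤ ENNReal.ofReal v
  dimH_lt : dimH K < 1
  nonempty_exp : ∀ {h}, h ∈ Icc a b → h < 1 → {x ∈ K | H x = h}.Nonempty
  le_dimH : ∀ {h}, h ∈ Icc a b → h < 1 → ENNReal.ofReal v ≤ dimH {x ∈ K | H x = h}

lemma exists_isBlock (p : ℝ) {ρ a b v : ℝ} (hρ : 0 < ρ) (hρ1 : ρ ≤ 1) (ha0 : 0 < a) (hab : a ≤ b)
    (hb : b ≤ 1) (hv : 0 ≤ v) (hva : v ≤ a) : ∃ K F H, IsBlock p ρ a b v K F H := by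
  rcases (hab.trans hb).eq_or_lt with ha | ha
  · refine ⟨∅, fun _ => 0, fun _ => 0, ?_⟩
    exact {
      isClosed := isClosed_empty
      subset := empty_subset _
      mono := monotone_const
      nonneg := fun _ => le_rfl
      le_one := fun _ => zero_le_one
      of_le := fun _ => rfl
      of_ge := fun _ => rfl
      abs_sub_le := fun x y => by rw [sub_self, abs_zero]; positivity
      rightAffine := fun _ => ⟨0, by simp⟩
      isBigO_of_notMem := fun _ => by simpa using Asymptotics.isBigO_zero _ _
      exp_mem := fun hx => hx.elim
      isBigO_of_mem := fun hx => hx.elim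
      growth := fun hx => hx.elim
      superlinear := fun hx => hx.elim
      dimH_le := by simp
      dimH_lt := by simp
      nonempty_exp := fun hH hH1 => absurd hH.1 (by linarith)
      le_dimH := fun hH hH1 => absurd hH.1 (by linarith) }
  · obtain ⟨ℓ, M, P, h⟩ := exists_scales hv hva ha hρ hρ1
    refine ⟨blockSet p a b ℓ M, blockFun p a b ℓ M, blockExp p a b ℓ M, ?_⟩
    exact {
      isClosed := Scales.isClosed_blockSet p a b ℓ M
      subset := h.blockSet_subset
      mono := h.blockFun_mono hva ha
      nonneg := h.blockFun_nonneg
      le_one := h.blockFun_le_one hva ha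
      of_le := h.blockFun_of_le
      of_ge := h.blockFun_of_ge
      abs_sub_le := h.abs_blockFun_sub_le hva ha0.le ha
      rightAffine := h.rightAffine_blockFun hva ha
      isBigO_of_notMem := h.isBigO_blockFun_of_notMem hva ha
      exp_mem := h.blockExp_mem hva hab ha
      isBigO_of_mem := fun hx _ => h.isBigO_blockFun_of_mem hva hab ha hb hx
      growth := fun hx _ => h.frequently_lt_of_blockExp_lt hva hab ha hx
      superlinear := h.frequently_superlinear hva ha
      dimH_le := h.dimH_blockSet_le hv
      dimH_lt := (h.dimH_blockSet_le hv).trans_lt (by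
        rw [← ENNReal.ofReal_one]
        exact (ENNReal.ofReal_lt_ofReal_iff one_pos).2 (by linarith))
      nonempty_exp := fun hH hH1 => (h.blockExp_level hv (by linarith) hρ hH hH1.le).1
      le_dimH := fun hH hH1 => (h.blockExp_level hv (by linarith) hρ hH hH1.le).2 }

/-! ### Adding blocks one at a time -/

/-- `F` grows faster than linearly along some sequence of points converging to `x`. -/
def Superlinear (F : ℝ → ℝ) (x : ℝ) : Prop :=
  ∀ C : ℝ, ∃ᶠ y in 𝓝 x, C * |y - x| < |F y - F x|

lemma abs_sub_add_abs_sub_of_monotone {F G : ℝ → ℝ} (hF : Monotone F) (hG : Monotone G)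
    (x y : ℝ) : |F y + G y - (F x + G x)| = |F y - F x| + |G y - G x| := by
  rcases le_total x y with h | h
  · have h1 := hF h
    have h2 := hG h
    rw [abs_of_nonneg (by linarith), abs_of_nonneg (by linarith), abs_of_nonneg (by linarith)]
    ring
  · have h1 := hF h
    have h2 := hG h
    rw [abs_of_nonpos (by linarith), abs_of_nonpos (by linarith), abs_of_nonpos (by linarith)]
    ring

lemma Superlinear.add_right {F G : ℝ → ℝ} {x : ℝ} (h : Superlinear F x) (hF : Monotone F)
    (hG : Monotone G) : Superlinear (fun y => F y + G y) x := fun C =>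
  (h C).mono fun y hy => by
    rw [abs_sub_add_abs_sub_of_monotone hF hG]
    linarith [abs_nonneg (G y - G x)]

lemma Superlinear.add_left {F G : ℝ → ℝ} {x : ℝ} (h : Superlinear G x) (hF : Monotone F)
    (hG : Monotone G) : Superlinear (fun y => F y + G y) x := by
  simpa only [add_comm] using h.add_right hG hF

lemma Superlinear.const_mul {F : ℝ → ℝ} {x m : ℝ} (h : Superlinear F x) (hm : 0 < m) :
    Superlinear (fun y => m * F y) x := fun C =>
  (h (C / m)).mono fun y hy => by
    rw [← mul_sub, abs_mul, abs_of_pos hm]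
    calc C * |y - x| = m * (C / m * |y - x|) := by field_simp
      _ < _ := by gcongr

lemma Superlinear.slopeGap {G : ℝ → ℝ} {x ε : ℝ} (h : Superlinear G x) (hε : 0 < ε) :
    SlopeGap G x ε := by
  set s := (G (x + ε / 2) - G x) / (ε / 2) with hs
  have hev : ∀ᶠ y in 𝓝 x, |y - x| < ε := by
    filter_upwards [Metric.ball_mem_nhds x hε] with y hy
    rwa [← Real.dist_eq]
  obtain ⟨y, hy, hyε⟩ := ((h (|s| + (2 * ε) ^ ε)).and_eventually hev).exists
  have hyx : 0 < |y - x| := by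
    rw [abs_pos, sub_ne_zero]
    rintro rfl
    simp at hy
  have hε2 : |ε / 2| = ε / 2 := abs_of_pos (by positivity)
  refine ⟨y - x, ε / 2, hyx, hyε, by rw [hε2]; positivity, by rw [hε2]; linarith, ?_⟩
  rw [← hs, add_sub_cancel]
  have h1 : |s| + (2 * ε) ^ ε < |(G y - G x) / (y - x)| := by
    rwa [abs_div (G y - G x), lt_div_iff₀ hyx]
  have h2 : (|y - x| + |ε / 2|) ^ ε ≤ (2 * ε) ^ ε := by
    rw [hε2]
    gcongr
    linarith
  linarith [abs_sub_abs_le_abs_sub ((G y - G x) / (y - x)) s]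

lemma RightAffine.slopeGap {G : ℝ → ℝ} {x ε : ℝ} (h : RightAffine (fun y => G y - baseFun y) x)
    (hε : 0 < ε) : SlopeGap G x ε := by
  obtain ⟨c, hc⟩ := h
  obtain ⟨r, hr, hc⟩ := mem_nhdsGT_iff_exists_Ioo_subset.1 hc
  obtain ⟨u, hu, hur, hgap⟩ := exists_slope_baseFun x hε (lt_min (sub_pos.2 hr) hε)
  have h1 := hur.trans_le (min_le_left _ _)
  have h2 := hur.trans_le (min_le_right _ _)
  have e1 : G (x + u) - baseFun (x + u) - (G x - baseFun x) = c * (x + u - x) :=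
    hc ⟨by linarith, by linarith⟩
  have e2 : G (x + 2 * u) - baseFun (x + 2 * u) - (G x - baseFun x) = c * (x + 2 * u - x) :=
    hc ⟨by linarith, by linarith⟩
  have a1 : |u| = u := abs_of_pos hu
  have a2 : |2 * u| = 2 * u := abs_of_pos (by positivity)
  refine ⟨u, 2 * u, by rwa [a1], by rw [a1]; linarith, by rw [a2]; positivity, by rwa [a2], ?_⟩
  have f1 : (G (x + u) - G x) / u = c + (baseFun (x + u) - baseFun x) / u := by
    field_simp
    linarith
  have f2 : (G (x + 2 * u) - G x) / (2 * u)
      = c + (baseFun (x + 2 * u) - baseFun x) / (2 * u) := by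
    field_simp
    linarith
  rw [f1, f2, add_sub_add_left_eq_sub, a1, a2]
  convert hgap using 2
  ring

/-- The invariants of the partial sums of the construction: outside the closed nowhere dense set
`U` the function is `baseFun` up to an affine function on the right, on `U` it grows
superlinearly. -/
structure Stage (G : ℝ → ℝ) (U : Set ℝ) : Prop where
  continuous : Continuous G
  mono : Monotone G
  isClosed : IsClosed U
  interior_eq : interior U = ∅
  rightAffine {x : ℝ} : x ∉ U → RightAffine (fun y => G y - baseFun y) x
  superlinear {x : ℝ} : x ∈ U → Superlinear G x

lemma stage_baseFun : Stage baseFun ∅ where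
  continuous := continuous_baseFun
  mono := baseFun_strictMono.monotone
  isClosed := isClosed_empty
  interior_eq := interior_empty
  rightAffine _ := ⟨0, by simp⟩
  superlinear h := h.elim

lemma Stage.slopeGap {G : ℝ → ℝ} {U : Set ℝ} (h : Stage G U) {ε : ℝ} (hε : 0 < ε) (x : ℝ) :
    SlopeGap G x ε := by
  by_cases hx : x ∈ U
  · exact (h.superlinear hx).slopeGap hε
  · exact (h.rightAffine hx).slopeGap hε

lemma interior_eq_empty_of_dimH_lt_one {K : Set ℝ} (h : dimH K < 1) : interior K = ∅ := by
  by_contra hne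
  have := Real.dimH_of_nonempty_interior (s := K) (nonempty_iff_ne_empty.2 hne)
  simp [this] at h

lemma IsBlock.continuous {p ρ a b v : ℝ} {K : Set ℝ} {F H : ℝ → ℝ}
    (h : IsBlock p ρ a b v K F H) (ha : 0 < a) : Continuous F := by
  refine continuous_iff_continuousAt.2 fun x => ?_
  refine tendsto_iff_dist_tendsto_zero.2 ?_
  refine squeeze_zero (fun _ => dist_nonneg) (fun y => h.abs_sub_le x y) ?_
  have hc : Continuous fun y : ℝ => 4 * |y - x| ^ a :=
    continuous_const.mul ((by fun_prop : Continuous fun y : ℝ => |y - x|).rpow_const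
      fun _ => Or.inr ha.le)
  simpa [Real.zero_rpow ha.ne'] using hc.tendsto x

lemma Stage.add {G : ℝ → ℝ} {U : Set ℝ} (h : Stage G U) {p ρ a b v : ℝ} {K : Set ℝ}
    {F H : ℝ → ℝ} (hF : IsBlock p ρ a b v K F H) (ha : 0 < a) {m : ℝ} (hm : 0 < m) :
    Stage (fun y => G y + m * F y) (U ∪ K) where
  continuous := h.continuous.add (continuous_const.mul (hF.continuous ha))
  mono := h.mono.add (hF.mono.const_mul hm.le)
  isClosed := h.isClosed.union hF.isClosed
  interior_eq := by
    rw [interior_union_isClosed_of_interior_empty h.isClosed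
      (interior_eq_empty_of_dimH_lt_one hF.dimH_lt), h.interior_eq]
  rightAffine {x} hx := by
    rw [mem_union, not_or] at hx
    convert (h.rightAffine hx.1).add ((hF.rightAffine hx.2).const_mul m) using 2
    ring
  superlinear {x} hx := by
    rcases hx with hx | hx
    · exact (h.superlinear hx).add_right h.mono (hF.mono.const_mul hm.le)
    · exact Superlinear.add_left (Superlinear.const_mul (fun C => hF.superlinear hx C) hm) h.mono
        (hF.mono.const_mul hm.le)

lemma exists_Icc_subset_diff {U : Set ℝ} (hU : IsClosed U) (hi : interior U = ∅) {l r : ℝ}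
    (hlr : l < r) {w : ℝ} (hw : 0 < w) :
    ∃ p ρ : ℝ, 0 < ρ ∧ ρ ≤ w ∧ Icc p (p + ρ) ⊆ Ioo l r \ U := by
  have hne : (Ioo l r \ U).Nonempty := by
    by_contra hempty
    rw [not_nonempty_iff_eq_empty, sdiff_eq_empty] at hempty
    have := interior_maximal hempty isOpen_Ioo
    rw [hi] at this
    exact (nonempty_Ioo.2 hlr).not_subset_empty this
  obtain ⟨p, hp⟩ := hne
  obtain ⟨δ, hδ, hsub⟩ := Metric.isOpen_iff.1 (isOpen_Ioo.sdiff hU) p hp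
  refine ⟨p, min (δ / 2) w, lt_min (by positivity) hw, min_le_right _ _, fun y hy => hsub ?_⟩
  rw [Metric.mem_ball, Real.dist_eq, abs_of_nonneg (by linarith [hy.1])]
  linarith [hy.2, min_le_left (δ / 2) w]

lemma exists_pos_le_dist {U L : Set ℝ} (hU : IsClosed U) (hL : IsCompact L) (hd : Disjoint U L) :
    ∃ c > 0, ∀ x ∈ U, ∀ y ∈ L, c ≤ |x - y| := by
  obtain ⟨r, hr, h⟩ := hd.symm.exists_cthickenings hL hU
  refine ⟨r, hr, fun x hx y hy => ?_⟩
  by_contra! hlt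
  refine disjoint_left.1 h (mem_cthickening_of_dist_le x y r L hy ?_)
    (self_subset_cthickening U hx)
  rw [Real.dist_eq]
  exact hlt.le

lemma Stage.exists_next {G : ℝ → ℝ} {U : Set ℝ} (h : Stage G U) {η : ℝ} (hη : 0 < η)
    {a b v : ℝ} (ha : 0 < a) (hab : a ≤ b) (hb : b ≤ 1) (hv : 0 ≤ v) (hva : v ≤ a)
    {l r : ℝ} (hlr : l < r) {w N ε : ℝ} (hw : 0 < w) (hw1 : w ≤ 1) (hN : 0 < N) (hε : 0 < ε) :
    ∃ (p ρ m : ℝ) (K : Set ℝ) (F H : ℝ → ℝ) (η' : ℝ), IsBlock p ρ a b v K F H ∧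
      (0 < m ∧ ρ ≤ w ∧ N * m ≤ w ∧ 0 < ρ) ∧ Icc p (p + ρ) ⊆ Ioo l r ∧
      (∀ x ∈ U, ∀ y ∈ Icc p (p + ρ), N * m ≤ |x - y|) ∧ m ≤ η ∧
      Stage (fun y => G y + m * F y) (U ∪ K) ∧ 0 < η' ∧ η' ≤ η / 2 ∧
      ∀ Z : ℝ → ℝ, (∀ z, |Z z - (G z + m * F z)| ≤ 2 * η') →
        ∀ x ∈ Icc (0 : ℝ) 1, SlopeGap Z x ε := by
  obtain ⟨p, ρ, hρ, hρw, hsub⟩ := exists_Icc_subset_diff h.isClosed h.interior_eq hlr hw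
  obtain ⟨K, F, H, hF⟩ := exists_isBlock p hρ (hρw.trans hw1) ha hab hb hv hva
  obtain ⟨c, hc, hdist⟩ := exists_pos_le_dist h.isClosed (isCompact_Icc (a := p) (b := p + ρ))
    (disjoint_right.2 fun y hy => (hsub hy).2)
  set m := min η (min (c / N) (w / N)) with hm
  have hm0 : 0 < m := lt_min hη (lt_min (by positivity) (by positivity))
  have hmc : N * m ≤ c := by
    rw [mul_comm, ← le_div_iff₀ hN]
    exact (min_le_right _ _).trans (min_le_left _ _)
  have hmw : N * m ≤ w := by
    rw [mul_comm, ← le_div_iff₀ hN]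
    exact (min_le_right _ _).trans (min_le_right _ _)
  have hst := h.add hF ha hm0
  obtain ⟨θ, hθ, hstab⟩ := exists_stable_slopeGap hst.continuous
    (isCompact_Icc (a := (0 : ℝ)) (b := 1)) (hst.slopeGap hε)
  refine ⟨p, ρ, m, K, F, H, min (η / 2) (θ / 2), hF, ⟨hm0, hρw, hmw, hρ⟩, fun y hy => (hsub hy).1,
    fun x hx y hy => hmc.trans (hdist x hx y hy), min_le_left _ _, hst,
    lt_min (by positivity) (by positivity), min_le_left _ _, fun Z hZ => hstab Z fun z => ?_⟩
  exact (hZ z).trans (by linarith [min_le_right (η / 2) (θ / 2)])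

/-- The widths of the successive blocks. -/
noncomputable def width (j : ℕ) : ℝ := (1 / 2) ^ (j ^ 2)

lemma width_pos (j : ℕ) : 0 < width j := by unfold width; positivity

lemma width_le_one (j : ℕ) : width j ≤ 1 := pow_le_one₀ (by norm_num) (by norm_num)

/-- A sequence of blocks with parameters `a j, b j, v j` placed in the intervals
`(l j, r j)`, with weights `m j`, each of them far away from the supports of the previous ones. -/
structure Assembly (a b v l r : ℕ → ℝ) (p ρ m : ℕ → ℝ) (K : ℕ → Set ℝ) (F H : ℕ → ℝ → ℝ) :
    Prop where
  block (j : ℕ) : IsBlock (p j) (ρ j) (a j) (b j) (v j) (K j) (F j) (H j)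
  weight_pos (j : ℕ) : 0 < m j
  length_pos (j : ℕ) : 0 < ρ j
  length_le (j : ℕ) : ρ j ≤ width j
  weight_le (j : ℕ) : 2 ^ j * m j ≤ width j
  subset_Ioo (j : ℕ) : Icc (p j) (p j + ρ j) ⊆ Ioo (l j) (r j)
  far {i j : ℕ} : i < j → ∀ x ∈ K i, ∀ y ∈ Icc (p j) (p j + ρ j), 2 ^ j * m j ≤ |x - y|
  slopeGap (j : ℕ) {x : ℝ} : x ∈ Icc (0 : ℝ) 1 →
    SlopeGap (fun y => baseFun y + ∑' j, m j * F j y) x (1 / (j + 1))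

lemma exists_assembly {a b v l r : ℕ → ℝ} (ha : ∀ j, 0 < a j) (hab : ∀ j, a j ≤ b j)
    (hb : ∀ j, b j ≤ 1) (hv : ∀ j, 0 ≤ v j) (hva : ∀ j, v j ≤ a j) (hlr : ∀ j, l j < r j) :
    ∃ p ρ m K F H, Assembly a b v l r p ρ m K F H := by
  have step : ∀ (j : ℕ) (s : {s : (ℝ → ℝ) × Set ℝ × ℝ // Stage s.1 s.2.1 ∧ 0 < s.2.2}), _ :=
    fun j s => s.2.1.exists_next s.2.2 (ha j) (hab j) (hb j) (hv j) (hva j) (hlr j)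
      (width_pos j) (width_le_one j) (pow_pos two_pos j) (Nat.one_div_pos_of_nat (n := j))
  choose p ρ m K F H η hblock hm hsub hfar hmη hstage hη hη2 hstab using step
  let s : ℕ → {s : (ℝ → ℝ) × Set ℝ × ℝ // Stage s.1 s.2.1 ∧ 0 < s.2.2} := fun n =>
    Nat.rec ⟨(baseFun, ∅, 1), stage_baseFun, one_pos⟩
      (fun k s => ⟨(fun y => s.1.1 y + m k s * F k s y, s.1.2.1 ∪ K k s, η k s),
        hstage k s, hη k s⟩) n
  have hK : ∀ {i j}, i < j → K i (s i) ⊆ (s j).1.2.1 := by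
    intro i j hij
    induction j, hij using Nat.le_induction with
    | base => exact subset_union_right
    | succ j _ ih => exact ih.trans subset_union_left
  have hsum : ∀ n y, (s n).1.1 y = baseFun y + ∑ j ∈ Finset.range n, m j (s j) * F j (s j) y := by
    intro n y
    induction n with
    | zero => simp [s]
    | succ n ih =>
      rw [Finset.sum_range_succ, ← add_assoc, ← ih]
  have hgeom : ∀ n k, (s (n + k)).1.2.2 ≤ (1 / 2) ^ k * (s n).1.2.2 := by
    intro n k
    induction k with
    | zero => simp
    | succ k ih =>
      calc (s (n + k + 1)).1.2.2 ≤ (s (n + k)).1.2.2 / 2 := hη2 _ _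
        _ ≤ (1 / 2) ^ k * (s n).1.2.2 / 2 := by gcongr
        _ = _ := by ring
  have hterm : ∀ n k y, ‖m (k + n) (s (k + n)) * F (k + n) (s (k + n)) y‖
      ≤ (1 / 2) ^ k * (s n).1.2.2 := by
    intro n k y
    have h1 := (hblock (k + n) (s (k + n))).nonneg y
    have h2 := (hblock (k + n) (s (k + n))).le_one y
    have h3 := (hm (k + n) (s (k + n))).1
    rw [Real.norm_of_nonneg (by positivity)]
    calc _ ≤ m (k + n) (s (k + n)) * 1 := by gcongr
      _ ≤ (s (k + n)).1.2.2 := by rw [mul_one]; exact hmη _ _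
      _ ≤ _ := by rw [add_comm k n]; exact hgeom n k
  have hS : ∀ n y, Summable fun k => m (k + n) (s (k + n)) * F (k + n) (s (k + n)) y := fun n y =>
    Summable.of_norm_bounded (summable_geometric_two.mul_right _) (hterm n · y)
  refine ⟨fun j => p j (s j), fun j => ρ j (s j), fun j => m j (s j), fun j => K j (s j),
    fun j => F j (s j), fun j => H j (s j), fun j => hblock _ _, fun j => (hm _ _).1,
    fun j => (hm _ _).2.2.2, fun j => (hm _ _).2.1, fun j => (hm _ _).2.2.1, fun j => hsub _ _,
    fun hij x hx y hy => hfar _ _ x (hK hij hx) y hy, fun j x hx => ?_⟩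
  refine hstab j (s j) _ (fun z => ?_) x hx
  have e : ∑' k, m k (s k) * F k (s k) z - ∑ k ∈ Finset.range (j + 1), m k (s k) * F k (s k) z
      = ∑' k, m (k + (j + 1)) (s (k + (j + 1))) * F (k + (j + 1)) (s (k + (j + 1))) z :=
    sub_eq_iff_eq_add'.2 ((show Summable fun k => m k (s k) * F k (s k) z from
      hS 0 z).sum_add_tsum_nat_add (j + 1)).symm
  have key := tsum_of_norm_bounded (summable_geometric_two.mul_right _).hasSum (hterm (j + 1) · z)
  rw [← e, tsum_mul_right, tsum_geometric_two, ← add_sub_add_left_eq_sub _ _ (baseFun z),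
    ← hsum] at key
  exact key

/-! ### The limit of the construction -/

lemma width_antitone : Antitone width := fun _ _ h =>
  pow_le_pow_of_le_one (by norm_num) (by norm_num) (Nat.pow_le_pow_left h 2)

lemma tendsto_width : Tendsto width atTop (𝓝 0) :=
  (tendsto_pow_atTop_nhds_zero_of_lt_one (by norm_num) (by norm_num : (1 / 2 : ℝ) < 1)).comp
    (tendsto_pow_atTop two_ne_zero)

lemma width_rpow_le {d : ℝ} (hd : 0 < d) (j : ℕ) : width j ^ d ≤ ((1 / 2 : ℝ) ^ d) ^ j := by
  rw [width, ← Real.rpow_natCast_mul (by norm_num), mul_comm, Real.rpow_mul_natCast (by norm_num)]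
  exact pow_le_pow_of_le_one (by positivity) (Real.rpow_le_one (by norm_num) (by norm_num) hd.le)
    (Nat.le_self_pow two_ne_zero j)

lemma dimH_eq_zero_of_frequently {p q : ℕ → ℝ} (hpq : ∀ j, q j - p j ≤ 3 * width j) :
    dimH {x | ∃ᶠ j in atTop, x ∈ Icc (p j) (q j)} = 0 := by
  refine le_antisymm (ENNReal.le_of_forall_pos_le_add fun d hd _ => ?_) zero_le
  have hd0 : (0 : ℝ) < d := hd
  rw [zero_add]
  refine dimH_le_of_hausdorffMeasure_ne_top (ne_top_of_le_ne_top ENNReal.zero_ne_top ?_)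
  have hsum : ∑' j, ediam (Icc (p j) (q j)) ^ (d : ℝ) ≠ ⊤ := by
    have hq : (1 / 2 : ℝ) ^ (d : ℝ) < 1 := Real.rpow_lt_one (by norm_num) (by norm_num) hd0
    have hs : Summable fun j : ℕ => 3 ^ (d : ℝ) * ((1 / 2 : ℝ) ^ (d : ℝ)) ^ j :=
      (summable_geometric_of_lt_one (by positivity) hq).mul_left _
    refine ne_top_of_le_ne_top hs.tsum_ofReal_ne_top (ENNReal.tsum_le_tsum fun j => ?_)
    rw [Real.ediam_Icc]
    calc ENNReal.ofReal (q j - p j) ^ (d : ℝ) ≤ ENNReal.ofReal (3 * width j) ^ (d : ℝ) := by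
          gcongr
          exact hpq j
      _ = ENNReal.ofReal ((3 * width j) ^ (d : ℝ)) :=
          ENNReal.ofReal_rpow_of_nonneg (by have := width_pos j; positivity) hd0.le
      _ ≤ _ := by
          rw [Real.mul_rpow (by norm_num) (width_pos j).le]
          gcongr
          exact width_rpow_le hd0 j
  have hr : Tendsto (fun n => ENNReal.ofReal (3 * width n)) atTop (𝓝 0) := by
    simpa using ENNReal.tendsto_ofReal (tendsto_width.const_mul 3)
  refine (Measure.hausdorffMeasure_le_liminf_tsum (d : ℝ) _ _ hr
    (fun n i => Icc (p (i + n)) (q (i + n))) (Eventually.of_forall fun n i => ?_)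
    (Eventually.of_forall fun n x hx => ?_)).trans
    (ENNReal.tendsto_sum_nat_add _ hsum).liminf_eq.le
  · rw [Real.ediam_Icc]
    gcongr
    exact (hpq _).trans (by gcongr; exact width_antitone (Nat.le_add_left n i))
  · obtain ⟨j, hj, hxj⟩ := frequently_atTop.1 hx n
    exact mem_iUnion.2 ⟨j - n, by rwa [Nat.sub_add_cancel hj]⟩

lemma isBigO_abs_rpow {x β : ℝ} (hβ1 : β ≤ 1) :
    (fun y => y - x) =O[𝓝 x] fun y => |y - x| ^ β := by
  refine Asymptotics.IsBigO.of_bound 1 ?_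
  filter_upwards [Metric.ball_mem_nhds x one_pos] with y hy
  rw [Metric.mem_ball, Real.dist_eq] at hy
  rw [Real.norm_eq_abs, Real.norm_of_nonneg (by positivity), one_mul]
  simpa using Real.rpow_le_rpow_of_exponent_ge_of_imp (abs_nonneg _) hy.le hβ1
    (fun _ h => absurd h one_ne_zero)

lemma isBigO_baseFun (x : ℝ) : (fun y => baseFun y - baseFun x) =O[𝓝 x] fun y => y - x :=
  Asymptotics.IsBigO.of_bound 14 (Eventually.of_forall fun y => abs_baseFun_sub_le x y)

/-- The interval `[p, p + ρ]` is far away from `x` compared to the number `c`. -/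
def Far (p ρ c x : ℝ) : Prop := ∀ y ∈ Icc p (p + ρ), c ≤ |x - y|

lemma IsBlock.abs_sub_le_of_far {p ρ a b v c x : ℝ} {K : Set ℝ} {F H : ℝ → ℝ}
    (h : IsBlock p ρ a b v K F H) (hρ : 0 ≤ ρ) (hc : 0 < c) (hx : Far p ρ c x) (y : ℝ) :
    c * |F y - F x| ≤ |y - x| := by
  have hle : |F y - F x| ≤ 1 :=
    abs_le.2 ⟨by linarith [h.nonneg y, h.le_one x], by linarith [h.nonneg x, h.le_one y]⟩
  have hmain : F y = F x ∨ c ≤ |y - x| := by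
    have h1 := hx p ⟨le_rfl, by linarith⟩
    have h2 := hx (p + ρ) ⟨by linarith, le_rfl⟩
    rcases lt_or_ge x p with hxp | hxp
    · rcases le_or_gt y p with hyp | hyp
      · exact Or.inl (by rw [h.of_le hyp, h.of_le hxp.le])
      · right
        rw [abs_of_neg (by linarith)] at h1
        rw [abs_of_pos (by linarith)]
        linarith
    rcases le_or_gt x (p + ρ) with hxq | hxq
    · have := hx x ⟨hxp, hxq⟩
      simp at this
      linarith
    · rcases le_or_gt (p + ρ) y with hyp | hyp
      · exact Or.inl (by rw [h.of_ge hyp, h.of_ge hxq.le])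
      · right
        rw [abs_of_pos (by linarith)] at h2
        rw [abs_of_neg (by linarith)]
        linarith
  rcases hmain with h0 | h0
  · simp [h0]
  · calc c * |F y - F x| ≤ c * 1 := by gcongr
      _ ≤ _ := by simpa using h0

namespace Assembly

variable {a b v l r p ρ m : ℕ → ℝ} {K : ℕ → Set ℝ} {F H : ℕ → ℝ → ℝ}

/-- The sum of `baseFun` and of all the weighted blocks. -/
noncomputable def limit (m : ℕ → ℝ) (F : ℕ → ℝ → ℝ) (y : ℝ) : ℝ := baseFun y + ∑' j, m j * F j y

lemma weight_le_pow (A : Assembly a b v l r p ρ m K F H) (j : ℕ) : m j ≤ (1 / 2) ^ j := by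
  have h := (A.weight_le j).trans (width_le_one j)
  rw [one_div, inv_pow, ← one_div, le_div_iff₀' (by positivity)]
  exact h

lemma norm_le (A : Assembly a b v l r p ρ m K F H) (j : ℕ) (y : ℝ) :
    ‖m j * F j y‖ ≤ (1 / 2) ^ j := by
  have h0 := (A.block j).nonneg y
  have h1 := (A.weight_pos j).le
  rw [Real.norm_of_nonneg (by positivity)]
  exact (mul_le_of_le_one_right h1 ((A.block j).le_one y)).trans (A.weight_le_pow j)

lemma summable (A : Assembly a b v l r p ρ m K F H) (y : ℝ) : Summable fun j => m j * F j y :=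
  Summable.of_norm_bounded summable_geometric_two (A.norm_le · y)

lemma continuous_limit (A : Assembly a b v l r p ρ m K F H) (ha : ∀ j, 0 < a j) :
    Continuous (limit m F) :=
  continuous_baseFun.add (continuous_tsum
    (fun j => continuous_const.mul ((A.block j).continuous (ha j))) summable_geometric_two
    A.norm_le)

lemma monotone_tsum (A : Assembly a b v l r p ρ m K F H) :
    Monotone fun y => ∑' j, m j * F j y := fun _ _ hxy =>
  (A.summable _).tsum_le_tsum
    (fun j => mul_le_mul_of_nonneg_left ((A.block j).mono hxy) (A.weight_pos j).le) (A.summable _)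

lemma strictMono_limit (A : Assembly a b v l r p ρ m K F H) : StrictMono (limit m F) :=
  baseFun_strictMono.add_monotone A.monotone_tsum

lemma le_abs_sub_limit (A : Assembly a b v l r p ρ m K F H) (i : ℕ) (x y : ℝ) :
    m i * |F i y - F i x| ≤ |limit m F y - limit m F x| := by
  have key : ∀ {x y}, x ≤ y → m i * |F i y - F i x| ≤ |limit m F y - limit m F x| := by
    intro x y hxy
    have h1 := ((A.summable y).sub (A.summable x)).le_tsum i fun j _ => by
      rw [← mul_sub]
      exact mul_nonneg (A.weight_pos j).le (sub_nonneg.2 ((A.block j).mono hxy))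
    rw [(A.summable y).tsum_sub (A.summable x)] at h1
    have h2 := baseFun_strictMono.monotone hxy
    rw [abs_of_nonneg (sub_nonneg.2 ((A.block i).mono hxy))]
    refine le_trans ?_ (le_abs_self _)
    simp only [limit]
    linarith
  rcases le_total x y with h | h
  · exact key h
  · rw [abs_sub_comm (F i y), abs_sub_comm (limit m F y)]
    exact key h

lemma isBigO_limit (A : Assembly a b v l r p ρ m K F H) {h₀ : ℝ} (h0 : 0 < h₀)
    (ha : ∀ j, h₀ ≤ a j) (h1 : h₀ ≤ 1) (x : ℝ) :
    (fun y => limit m F y - limit m F x) =O[𝓝 x] fun y => |y - x| ^ h₀ := by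
  have e : (fun y => limit m F y - limit m F x) = fun y => (baseFun y - baseFun x) +
      (∑' j, m j * F j y - ∑' j, m j * F j x) := by
    ext y
    simp only [limit]
    ring
  rw [e]
  refine Asymptotics.IsBigO.add ?_ ?_
  · exact (isBigO_baseFun x).trans (isBigO_abs_rpow h1)
  · refine Asymptotics.IsBigO.of_bound ((∑' j : ℕ, (1 / 2 : ℝ) ^ j) * 4) ?_
    filter_upwards [Metric.ball_mem_nhds x one_pos] with y hy
    rw [Metric.mem_ball, Real.dist_eq] at hy
    rw [Real.norm_eq_abs, Real.norm_of_nonneg (by positivity), mul_assoc]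
    refine abs_tsum_sub_tsum_le (g := fun j y => m j * F j y) (A.summable x) (A.summable y)
      summable_geometric_two fun j => ?_
    rw [← mul_sub, abs_mul, abs_of_pos (A.weight_pos j)]
    have h3 := (A.block j).abs_sub_le x y
    have h4 : |y - x| ^ a j ≤ |y - x| ^ h₀ :=
      Real.rpow_le_rpow_of_exponent_ge_of_imp (abs_nonneg _) hy.le (ha j)
        fun _ h => absurd h (by linarith [ha j])
    gcongr
    · exact A.weight_le_pow j
    · linarith

lemma abs_sub_le_of_far (A : Assembly a b v l r p ρ m K F H) {j : ℕ} {x : ℝ}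
    (h : Far (p j) (ρ j) (2 ^ j * m j) x) (y : ℝ) :
    |m j * F j y - m j * F j x| ≤ (1 / 2) ^ j * |y - x| := by
  have h1 := (A.block j).abs_sub_le_of_far (A.length_pos j).le
    (mul_pos (by positivity) (A.weight_pos j)) h y
  rw [← mul_sub, abs_mul, abs_of_pos (A.weight_pos j), one_div, inv_pow,
    inv_mul_eq_div, le_div_iff₀' (by positivity), ← mul_assoc]
  exact h1

lemma isBigO_limit_of_far (A : Assembly a b v l r p ρ m K F H) {x β : ℝ} (hβ1 : β ≤ 1)
    (hfar : ∀ᶠ j in atTop, Far (p j) (ρ j) (2 ^ j * m j) x)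
    (hO : ∀ j, (fun y => F j y - F j x) =O[𝓝 x] fun y => |y - x| ^ β) :
    (fun y => limit m F y - limit m F x) =O[𝓝 x] fun y => |y - x| ^ β := by
  obtain ⟨N, hN⟩ := eventually_atTop.1 hfar
  have e : (fun y => limit m F y - limit m F x) = fun y => (baseFun y - baseFun x) +
      (∑ j ∈ Finset.range N, m j * (F j y - F j x) +
        (∑' j, m (j + N) * F (j + N) y - ∑' j, m (j + N) * F (j + N) x)) := by
    ext y
    simp only [limit, mul_sub, Finset.sum_sub_distrib, ← (A.summable y).sum_add_tsum_nat_add N,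
      ← (A.summable x).sum_add_tsum_nat_add N]
    ring
  rw [e]
  refine Asymptotics.IsBigO.add ?_ (Asymptotics.IsBigO.add ?_ ?_)
  · exact (isBigO_baseFun x).trans (isBigO_abs_rpow hβ1)
  · exact Asymptotics.IsBigO.fun_sum fun j _ => (hO j).const_mul_left _
  · refine (Asymptotics.IsBigO.of_bound (∑' j : ℕ, (1 / 2 : ℝ) ^ (j + N))
      (Eventually.of_forall fun y => ?_)).trans (isBigO_abs_rpow hβ1)
    exact abs_tsum_sub_tsum_le (g := fun j y => m (j + N) * F (j + N) y)
      ((summable_nat_add_iff N).2 (A.summable x))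
      ((summable_nat_add_iff N).2 (A.summable y))
      ((summable_nat_add_iff N).2 summable_geometric_two)
      fun j => A.abs_sub_le_of_far (hN (j + N) (by lia)) y

lemma far_of_mem (A : Assembly a b v l r p ρ m K F H) {i : ℕ} {x : ℝ} (hx : x ∈ K i) :
    ∀ᶠ j in atTop, Far (p j) (ρ j) (2 ^ j * m j) x := by
  filter_upwards [eventually_gt_atTop i] with j hj
  exact A.far hj x hx

lemma notMem_of_lt (A : Assembly a b v l r p ρ m K F H) {i j : ℕ} (hij : i < j) {x : ℝ}
    (hx : x ∈ K i) : x ∉ K j := fun hxj => by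
  have h1 := A.far hij x hx x ((A.block j).subset hxj)
  have h2 : 0 < 2 ^ j * m j := mul_pos (by positivity) (A.weight_pos j)
  simp at h1
  linarith

lemma notMem_of_ne (A : Assembly a b v l r p ρ m K F H) {i j : ℕ} (hij : i ≠ j) {x : ℝ}
    (hx : x ∈ K i) : x ∉ K j := by
  rcases hij.lt_or_gt with h | h
  · exact A.notMem_of_lt h hx
  · exact fun hxj => A.notMem_of_lt h hxj hx

lemma le_one_of_holderAt (A : Assembly a b v l r p ρ m K F H) {x α : ℝ} (hx : x ∈ Icc (0 : ℝ) 1)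
    (h : HolderAt (limit m F) α x) : α ≤ 1 :=
  HolderAt.le_one (fun n => A.slopeGap n hx) h

lemma holderExp_of_mem (A : Assembly a b v l r p ρ m K F H) (ha : ∀ j, 0 < a j)
    (hb : ∀ j, b j ≤ 1) {i : ℕ} {x : ℝ} (hx : x ∈ Icc (0 : ℝ) 1) (hxK : x ∈ K i) :
    holderExp (limit m F) x = H i x := by
  obtain ⟨hHa, hHb⟩ := (A.block i).exp_mem hxK
  have hH1 : H i x ≤ 1 := hHb.trans (hb i)
  refine holderExp_eq ((ha i).trans_le hHa) (fun α hα => ?_) fun β hβ hβH => ?_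
  · rcases hH1.eq_or_lt with hH | hH
    · rw [hH]
      exact A.le_one_of_holderAt hx hα
    by_contra! hlt
    obtain ⟨β, hβ, hβ'⟩ := exists_between (lt_min hlt hH)
    obtain ⟨C, hC⟩ := (hα.isBigO (((ha i).trans_le hHa).trans hβ)
      (hβ'.trans_le (min_le_left _ _)).le (hβ'.trans_le (min_le_right _ _)).le).bound
    obtain ⟨y, hy, hy'⟩ := (((A.block i).growth hxK hβ (C / m i)).and_eventually hC).exists
    have hm := A.weight_pos i
    rw [Real.norm_eq_abs, Real.norm_of_nonneg (by positivity)] at hy'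
    have h1 := A.le_abs_sub_limit i x y
    have h2 : C * |y - x| ^ β < m i * |F i y - F i x| := by
      calc C * |y - x| ^ β = m i * (C / m i * |y - x| ^ β) := by field_simp
        _ < _ := by gcongr
    linarith
  · refine A.isBigO_limit_of_far (hβH.le.trans hH1) (A.far_of_mem hxK) fun j => ?_
    by_cases hij : i = j
    · subst hij
      exact (A.block i).isBigO_of_mem hxK hβ hβH
    · exact ((A.block j).isBigO_of_notMem (A.notMem_of_ne hij hxK)).trans
        (isBigO_abs_rpow (hβH.le.trans hH1))

lemma holderExp_of_notMem (A : Assembly a b v l r p ρ m K F H) {x : ℝ} (hx : x ∈ Icc (0 : ℝ) 1)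
    (hxK : ∀ j, x ∉ K j) (hfar : ∀ᶠ j in atTop, Far (p j) (ρ j) (2 ^ j * m j) x) :
    holderExp (limit m F) x = 1 := by
  refine holderExp_eq one_pos (fun α hα => A.le_one_of_holderAt hx hα) fun β hβ hβ1 => ?_
  exact A.isBigO_limit_of_far hβ1.le hfar fun j =>
    ((A.block j).isBigO_of_notMem (hxK j)).trans (isBigO_abs_rpow hβ1.le)

lemma dimH_not_far (A : Assembly a b v l r p ρ m K F H) :
    dimH {x | ¬ ∀ᶠ j in atTop, Far (p j) (ρ j) (2 ^ j * m j) x} = 0 := by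
  refine le_antisymm ((dimH_mono fun x hx => ?_).trans (dimH_eq_zero_of_frequently
    (p := fun j => p j - width j) (q := fun j => p j + ρ j + width j) fun j => ?_).le) zero_le
  · refine (not_eventually.1 hx).mono fun j hj => ?_
    simp only [Far, not_forall, not_le] at hj
    obtain ⟨y, hy, hxy⟩ := hj
    obtain ⟨h1, h2⟩ := abs_lt.1 (hxy.trans_le (A.weight_le j))
    exact ⟨by linarith [hy.1], by linarith [hy.2]⟩
  · linarith [A.length_le j]

end Assembly

/-! ### Prescribing the spectrum -/

lemma volume_eq_zero_of_dimH_lt_one {s : Set ℝ} (h : dimH s < 1) : volume s = 0 := by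
  have := hausdorffMeasure_of_dimH_lt (d := 1) (by simpa using h)
  rwa [NNReal.coe_one, hausdorffMeasure_real] at this

lemma one_le_dimH_of_volume_ne_zero {s : Set ℝ} (h : volume s ≠ 0) : 1 ≤ dimH s := by
  have : μH[((1 : NNReal) : ℝ)] s ≠ 0 := by simpa [hausdorffMeasure_real] using h
  simpa using le_dimH_of_hausdorffMeasure_ne_zero this

/-- Given countably many triples `(A n, B n, V n)`, there is a strictly increasing continuous
function whose level sets of the Hölder exponent in `[A n, B n]` have dimension at least `V n` in
every interval, and not more than these constraints impose. -/
theorem exists_strictMono_holderExp {h₀ : ℝ} {A B V : ℕ → ℝ} (h0 : 0 < h₀) (hA : ∀ n, h₀ ≤ A n)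
    (hAB : ∀ n, A n ≤ B n) (hB : ∀ n, B n ≤ 1) (hV : ∀ n, 0 ≤ V n) (hVA : ∀ n, V n ≤ A n) :
    ∃ Z : ℝ → ℝ, Continuous Z ∧ StrictMono Z ∧
      (∀ x ∈ Icc (0 : ℝ) 1, h₀ ≤ holderExp Z x ∧ holderExp Z x ≤ 1) ∧
      (∀ (n : ℕ) (h : ℝ), h ∈ Icc (A n) (B n) → h < 1 → ∀ l r : ℝ, 0 ≤ l → l < r → r ≤ 1 →
        ∃ E ⊆ {x ∈ Ioo l r | holderExp Z x = h}, E.Nonempty ∧ ENNReal.ofReal (V n) ≤ dimH E) ∧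
      (∀ h : ℝ, h < 1 → ∀ D : ℝ≥0∞, (∀ n, h ∈ Icc (A n) (B n) → ENNReal.ofReal (V n) ≤ D) →
        dimH {x ∈ Icc (0 : ℝ) 1 | holderExp Z x = h} ≤ D) ∧
      volume {x ∈ Icc (0 : ℝ) 1 | holderExp Z x ≠ 1} = 0 := by
  obtain ⟨t, ht⟩ := exists_surjective_nat (ℕ × ℚ × ℚ)
  set l : ℕ → ℝ := fun j => if (t j).2.1 < (t j).2.2 then (t j).2.1 else 0 with hl
  set r : ℕ → ℝ := fun j => if (t j).2.1 < (t j).2.2 then (t j).2.2 else 1 with hr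
  have hlr : ∀ j, l j < r j := by
    intro j
    simp only [hl, hr]
    split_ifs with h
    · exact_mod_cast h
    · exact one_pos
  have ha : ∀ j, 0 < A (t j).1 := fun j => h0.trans_le (hA _)
  obtain ⟨p, ρ, m, K, F, H, S⟩ := exists_assembly (a := fun j => A (t j).1)
    (b := fun j => B (t j).1) (v := fun j => V (t j).1) ha (fun j => hAB _) (fun j => hB _)
    (fun j => hV _) (fun j => hVA _) hlr
  have hexp : ∀ {x} {i}, x ∈ Icc (0 : ℝ) 1 → x ∈ K i →
      holderExp (Assembly.limit m F) x = H i x := fun hx hxK =>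
    S.holderExp_of_mem ha (fun j => hB _) hx hxK
  refine ⟨Assembly.limit m F, S.continuous_limit ha, S.strictMono_limit, fun x hx => ⟨?_, ?_⟩,
    fun n h hh hh1 l' r' hl' hlr' hr' => ?_, fun h hh1 D hD => ?_, ?_⟩
  · exact le_holderExp h0.le (holderAt_of_isBigO h0 (S.isBigO_limit h0 (fun j => hA _)
      ((hA 0).trans ((hAB 0).trans (hB 0))) x))
  · exact holderExp_le fun α hα => S.le_one_of_holderAt hx hα
  · obtain ⟨q, hq, hq'⟩ := exists_rat_btwn hlr'
    obtain ⟨q', hqq, hq''⟩ := exists_rat_btwn hq'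
    obtain ⟨j, hj⟩ := ht (n, q, q')
    have hn : (t j).1 = n := by rw [hj]
    have hlj : l j = q ∧ r j = q' := by
      have : q < q' := by exact_mod_cast hqq
      simp [hl, hr, hj, this]
    refine ⟨{x ∈ K j | H j x = h}, fun x hx => ?_, (S.block j).nonempty_exp (by rwa [hn]) hh1, ?_⟩
    · have h1 := S.subset_Ioo j ((S.block j).subset hx.1)
      rw [hlj.1, hlj.2] at h1
      have h2 : x ∈ Ioo l' r' := ⟨hq.trans h1.1, h1.2.trans hq''⟩
      refine ⟨h2, ?_⟩
      rw [hexp ⟨hl'.trans h2.1.le, h2.2.le.trans hr'⟩ hx.1, hx.2]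
    · have := (S.block j).le_dimH (by rwa [hn]) hh1
      rwa [hn] at this
  · have hsub : {x ∈ Icc (0 : ℝ) 1 | holderExp (Assembly.limit m F) x = h} ⊆
        {x | ¬ ∀ᶠ j in atTop, Far (p j) (ρ j) (2 ^ j * m j) x} ∪
          ⋃ j ∈ {j | h ∈ Icc (A (t j).1) (B (t j).1)}, K j := by
      rintro x ⟨hx, hxh⟩
      by_contra hnot
      simp only [mem_union, mem_ofPred_eq, not_or, not_not, mem_iUnion, not_exists] at hnot
      have hK : ∀ j, x ∉ K j := fun j hxj => by
        rw [hexp hx hxj, EReal.coe_eq_coe_iff] at hxh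
        exact hnot.2 j (hxh ▸ (S.block j).exp_mem hxj) hxj
      rw [S.holderExp_of_notMem hx hK hnot.1] at hxh
      exact hh1.ne (by exact_mod_cast hxh.symm)
    refine (dimH_mono hsub).trans ?_
    rw [dimH_union, S.dimH_not_far, dimH_bUnion (to_countable _)]
    exact max_le zero_le (iSup₂_le fun j hj => (S.block j).dimH_le.trans (hD _ hj))
  · have hsub : {x ∈ Icc (0 : ℝ) 1 | holderExp (Assembly.limit m F) x ≠ 1} ⊆
        {x | ¬ ∀ᶠ j in atTop, Far (p j) (ρ j) (2 ^ j * m j) x} ∪ ⋃ j, K j := by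
      rintro x ⟨hx, hxh⟩
      by_contra hnot
      simp only [mem_union, mem_ofPred_eq, not_or, not_not, mem_iUnion, not_exists] at hnot
      exact hxh (S.holderExp_of_notMem hx hnot.2 hnot.1)
    refine measure_mono_null hsub (measure_union_null ?_ (measure_iUnion_null fun j => ?_))
    · exact volume_eq_zero_of_dimH_lt_one (by rw [S.dimH_not_far]; exact one_pos)
    · exact volume_eq_zero_of_dimH_lt_one (S.block j).dimH_lt

lemma dimHE_of_nonempty {s : Set ℝ} (h : s.Nonempty) : dimHE s = dimH s := if_pos h

lemma dimHE_empty : dimHE ∅ = ⊥ := if_neg Set.not_nonempty_empty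

lemma dimHE_eq_one_of_volume_ne_zero {s : Set ℝ} (h : volume s ≠ 0) : dimHE s = 1 := by
  rw [dimHE_of_nonempty (nonempty_of_measure_ne_zero h)]
  have : dimH s = 1 := le_antisymm (Real.dimH_univ ▸ dimH_mono (subset_univ s))
    (one_le_dimH_of_volume_ne_zero h)
  simp [this]

/-- Prescription of the multifractal spectrum of a homogeneously multifractal, strictly
increasing continuous function: for every `f ∈ 𝓕` there is a HM, strictly increasing,
continuous `Z : [0,1] → ℝ` with `d_Z(h) = max (f h) 0` for all `h ∈ Support*(f) \ {1}`
(where `Support*(f) = [sInf Support(f), 1]`), `d_Z(h) = -∞` for `h ∈ [0,∞) \ Support*(f)`,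
and `{x ∈ [0,1] : h_Z(x) = 1}` of Lebesgue measure `1` (so that `d_Z(1) = 1`). -/
theorem prescription_HM_function (f : ℝ → EReal) (hf : MemF f) :
    ∃ Z : ℝ → ℝ, Continuous Z ∧ StrictMonoOn Z (Set.Icc 0 1) ∧ IsHMF Z ∧
      (∀ h : ℝ, h ∈ Set.Icc (sInf {x : ℝ | ⊥ < f x}) 1 → h ≠ 1 →
        specF Z (h : EReal) = max (f h) 0) ∧
      (∀ h : ℝ, 0 ≤ h → h ∉ Set.Icc (sInf {x : ℝ | ⊥ < f x}) 1 →
        specF Z (h : EReal) = ⊥) ∧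
      volume {x ∈ Set.Icc (0:ℝ) 1 | holderExp Z x = (1 : EReal)} = 1 ∧
      specF Z (1 : EReal) = 1 := by
  obtain ⟨I, v, hI, hI1, ⟨c, hc, hcI⟩, hv, hvI, hf⟩ := hf
  choose a b hab hIab using hI
  have haI : ∀ n, a n ∈ I n := fun n => by rw [hIab]; exact left_mem_Icc.2 (hab n)
  have hbI : ∀ n, b n ∈ I n := fun n => by rw [hIab]; exact right_mem_Icc.2 (hab n)
  have hsupp : {x : ℝ | ⊥ < f x} = ⋃ n, I n := by
    ext x
    rw [mem_ofPred_eq, hf, lt_iSup_iff, mem_iUnion]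
    refine exists_congr fun n => ?_
    split_ifs with hx
    · simp [hx, EReal.bot_lt_zero.trans_le (hv n).1]
    · simp [hx]
  have hlow : c ∈ lowerBounds (⋃ n, I n) := fun x hx => by
    obtain ⟨n, hn⟩ := mem_iUnion.1 hx
    exact hcI n x hn
  set h₀ := sInf {x : ℝ | ⊥ < f x} with hh₀
  rw [hsupp] at hh₀
  have hh₀I : ∀ n, ∀ x ∈ I n, h₀ ≤ x := fun n x hx =>
    hh₀ ▸ csInf_le ⟨c, hlow⟩ (mem_iUnion.2 ⟨n, hx⟩)
  have h0 : 0 < h₀ := hc.trans_le (hh₀ ▸ le_csInf ⟨a 0, mem_iUnion.2 ⟨0, haI 0⟩⟩ hlow)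
  have hvreal : ∀ n, ((v n).toReal : EReal) = v n := fun n =>
    EReal.coe_toReal (ne_top_of_le_ne_top (EReal.coe_ne_top 1) (hv n).2)
      (EReal.bot_lt_zero.trans_le (hv n).1).ne'
  have hv0 : ∀ n, 0 ≤ (v n).toReal := fun n => EReal.toReal_nonneg (hv n).1
  have hva : ∀ n, (v n).toReal ≤ a n := fun n => by
    have := hvI n (a n) (haI n)
    rwa [← hvreal, EReal.coe_le_coe_iff] at this
  have hofReal : ∀ n, ((ENNReal.ofReal (v n).toReal : ℝ≥0∞) : EReal) = v n := fun n => by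
    rw [EReal.coe_ennreal_ofReal, max_eq_left (hv0 n), hvreal]
  have hh₀1 : h₀ ≤ 1 := (hh₀I 0 _ (haI 0)).trans (hI1 0 (haI 0)).2
  obtain ⟨Z, hZc, hZm, hZb, hZlow, hZup, hZ1⟩ := exists_strictMono_holderExp
    (h₀ := h₀) (A := fun n => n.casesOn h₀ a) (B := fun n => n.casesOn 1 b)
    (V := fun n => n.casesOn 0 fun n => (v n).toReal) h0
    (by rintro (_ | n); exacts [le_rfl, hh₀I n _ (haI n)])
    (by rintro (_ | n); exacts [hh₀1, hab n])
    (by rintro (_ | n); exacts [le_rfl, (hI1 n (hbI n)).2])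
    (by rintro (_ | n); exacts [le_rfl, hv0 n])
    (by rintro (_ | n); exacts [h0.le, hva n])
  have hspec : ∀ {W : Set ℝ} {l r : ℝ}, 0 ≤ l → l < r → r ≤ 1 → Ioo l r ⊆ W → W ⊆ Icc 0 1 →
      ∀ h : ℝ, h ∈ Icc h₀ 1 → h ≠ 1 → dimHE {x ∈ W | holderExp Z x = h} = max (f h) 0 := by
    intro W l r hl hlr hr hlW hW h hh hh1
    have hlt : h < 1 := lt_of_le_of_ne hh.2 hh1
    have hlWE : {x ∈ Ioo l r | holderExp Z x = h} ⊆ {x ∈ W | holderExp Z x = h} :=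
      fun x hx => ⟨hlW hx.1, hx.2⟩
    obtain ⟨E, hE, hEne, -⟩ := hZlow 0 h hh hlt l r hl hlr hr
    rw [dimHE_of_nonempty (hEne.mono (hE.trans hlWE))]
    apply le_antisymm
    · rw [← EReal.coe_toENNReal (le_max_right (f h) 0), EReal.coe_ennreal_le_coe_ennreal_iff]
      refine (dimH_mono fun x hx => And.intro (hW hx.1) hx.2).trans (hZup h hlt _ ?_)
      rintro (_ | n) hn
      · simp
      · rw [← EReal.coe_ennreal_le_coe_ennreal_iff, EReal.coe_toENNReal (le_max_right _ _)]
        refine (hofReal n).le.trans (le_max_of_le_left ?_)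
        rw [hf]
        exact (if_pos (hIab n ▸ hn)).ge.trans
          (le_iSup (fun n => if h ∈ I n then v n else ⊥) n)
    · refine max_le ?_ (EReal.coe_ennreal_nonneg _)
      rw [hf]
      refine iSup_le fun n => ?_
      split_ifs with hn
      · obtain ⟨E', hE', -, hdim⟩ := hZlow (n + 1) h (hIab n ▸ hn) hlt l r hl hlr hr
        rw [← hofReal n, EReal.coe_ennreal_le_coe_ennreal_iff]
        exact hdim.trans (dimH_mono (hE'.trans hlWE))
      · exact bot_le
  have hspec1 : ∀ {W : Set ℝ} {l r : ℝ}, 0 ≤ l → l < r → r ≤ 1 → Ioo l r ⊆ W →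
      dimHE {x ∈ W | holderExp Z x = 1} = 1 := by
    intro W l r hl hlr hr hlW
    refine dimHE_eq_one_of_volume_ne_zero fun h => ?_
    have hsub : Ioo l r ⊆
        {x ∈ W | holderExp Z x = 1} ∪ {x ∈ Icc (0 : ℝ) 1 | holderExp Z x ≠ 1} := by
      intro x hx
      by_cases hx1 : holderExp Z x = 1
      · exact Or.inl ⟨hlW hx, hx1⟩
      · exact Or.inr ⟨⟨hl.trans hx.1.le, hx.2.le.trans hr⟩, hx1⟩
    have := measure_mono_null hsub (measure_union_null h hZ1)
    rw [Real.volume_Ioo, ENNReal.ofReal_eq_zero] at this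
    linarith
  have hspecbot : ∀ {W : Set ℝ}, W ⊆ Icc 0 1 → ∀ h : EReal, ¬ ((h₀ : EReal) ≤ h ∧ h ≤ 1) →
      dimHE {x ∈ W | holderExp Z x = h} = ⊥ := by
    intro W hW h hh
    have : {x ∈ W | holderExp Z x = h} = ∅ :=
      eq_empty_of_forall_notMem fun x hx => hh (hx.2 ▸ hZb x (hW hx.1))
    rw [this, dimHE_empty]
  refine ⟨Z, hZc, hZm.strictMonoOn _, fun l r hl hlr hr h => ?_, fun h hh hh1 => ?_,
    fun h _ hh => ?_, ?_, ?_⟩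
  · have hsub : Ioo l r ⊆ Icc (0 : ℝ) 1 := fun x hx => ⟨hl.trans hx.1.le, hx.2.le.trans hr⟩
    by_cases hh : (h₀ : EReal) ≤ h ∧ h ≤ 1
    · induction h with
      | bot => simp at hh
      | top => exact absurd (top_le_iff.1 hh.2) (EReal.coe_ne_top 1)
      | coe h =>
        by_cases h1 : h = 1
        · subst h1
          exact (hspec1 hl hlr hr Subset.rfl).trans
            (hspec1 le_rfl one_pos le_rfl Ioo_subset_Icc_self).symm
        · have hmem : h ∈ Icc h₀ 1 := ⟨by exact_mod_cast hh.1, by exact_mod_cast hh.2⟩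
          exact (hspec hl hlr hr Subset.rfl hsub h hmem h1).trans
            (hspec le_rfl one_pos le_rfl Ioo_subset_Icc_self Subset.rfl h hmem h1).symm
    · exact (hspecbot hsub h hh).trans (hspecbot Subset.rfl h hh).symm
  · exact hspec le_rfl one_pos le_rfl Ioo_subset_Icc_self Subset.rfl h hh hh1
  · exact hspecbot Subset.rfl h fun hh' => hh ⟨by exact_mod_cast hh'.1, by exact_mod_cast hh'.2⟩
  · have e : {x ∈ Icc (0 : ℝ) 1 | holderExp Z x = 1} =
        Icc 0 1 \ {x ∈ Icc (0 : ℝ) 1 | holderExp Z x ≠ 1} := by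
      ext x
      simp only [mem_ofPred_eq, Set.mem_sdiff]
      tauto
    rw [e, measure_sdiff_null hZ1]
    simp
  · exact hspec1 le_rfl one_pos le_rfl Ioo_subset_Icc_self
end

section
/- Let g : ℝ → ℝ be the 4-periodic function with g(x) = 0 on [0,1], g(x) = 1 on [2,3], g linear on [1,2] and on [3,4]. Let (a_n)_{n≥1} ⊂ (0,1] and positive integers (b_n)_{n≥1} satisfy a_1 = 1, b_1 = 4, and for every n > 1: b_n ≡ 3 (mod 4), a_{n−1}/300 > a_n > (4 b_n)^{−1/n}, and a_n b_n / 100 > Σ_{n'=1}^{n−1} a_{n'} b_{n'}. Set G(x) = Σ_{n=1}^∞ a_n g(b_n x) and Z(x) = ∫_0^x G(t) dt. Then G is continuous, Z is continuously differentiable with Z' = G, and the pointwise Hölder exponent satisfies h_Z(x) = 1 for every x ∈ [0,1]. -/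
open MeasureTheory Metric Filter Set
open scoped ENNReal Topology
open Classical

/-- A `1`-Lipschitz function with values in `[0, 1]` that vanishes on each `[4m, 4m + 1]` and equals
`1` on each `[4m + 2, 4m + 3]`. -/
structure IsUnitWave (g : ℝ → ℝ) : Prop where
  nonneg : ∀ x, 0 ≤ g x
  le_one : ∀ x, g x ≤ 1
  lipschitz : ∀ x y, |g x - g y| ≤ |x - y|
  zero : ∀ (m : ℤ) (x : ℝ), 4 * (m : ℝ) ≤ x → x ≤ 4 * m + 1 → g x = 0
  one : ∀ (m : ℤ) (x : ℝ), 4 * (m : ℝ) + 2 ≤ x → x ≤ 4 * m + 3 → g x = 1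

lemma isUnitWave_of_periodic (g : ℝ → ℝ) (hgper : ∀ x, g (x + 4) = g x)
    (hg01 : ∀ x ∈ Set.Icc (0:ℝ) 1, g x = 0)
    (hg23 : ∀ x ∈ Set.Icc (2:ℝ) 3, g x = 1)
    (hg12 : ∀ x ∈ Set.Icc (1:ℝ) 2, g x = x - 1)
    (hg34 : ∀ x ∈ Set.Icc (3:ℝ) 4, g x = 4 - x) : IsUnitWave g := by
  have hper : Function.Periodic g 4 := hgper
  have hshift : ∀ (m : ℤ) (x : ℝ), g (x - 4 * m) = g x := by
    intro m x
    have := hper.sub_int_mul_eq (x := x) m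
    rwa [mul_comm] at this
  have hred : ∀ x : ℝ, ∃ m : ℤ, 0 ≤ x - 4 * m ∧ x - 4 * m ≤ 4 := by
    intro x
    refine ⟨⌊x / 4⌋, ?_, ?_⟩
    · linarith [Int.floor_le (x / 4)]
    · linarith [Int.lt_floor_add_one (x / 4)]
  have hpieces : ∀ x : ℝ, 0 ≤ x → x ≤ 5 →
      (x ≤ 1 ∧ g x = 0) ∨ (1 ≤ x ∧ x ≤ 2 ∧ g x = x - 1) ∨ (2 ≤ x ∧ x ≤ 3 ∧ g x = 1) ∨
      (3 ≤ x ∧ x ≤ 4 ∧ g x = 4 - x) ∨ (4 ≤ x ∧ g x = 0) := by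
    intro x h0 h5
    rcases le_total x 1 with h1 | h1
    · exact Or.inl ⟨h1, hg01 x ⟨h0, h1⟩⟩
    rcases le_total x 2 with h2 | h2
    · exact Or.inr (Or.inl ⟨h1, h2, hg12 x ⟨h1, h2⟩⟩)
    rcases le_total x 3 with h3 | h3
    · exact Or.inr (Or.inr (Or.inl ⟨h2, h3, hg23 x ⟨h2, h3⟩⟩))
    rcases le_total x 4 with h4 | h4
    · exact Or.inr (Or.inr (Or.inr (Or.inl ⟨h3, h4, hg34 x ⟨h3, h4⟩⟩)))
    · refine Or.inr (Or.inr (Or.inr (Or.inr ⟨h4, ?_⟩)))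
      have h := hgper (x - 4)
      rw [sub_add_cancel] at h
      rw [h]
      exact hg01 _ ⟨by linarith, by linarith⟩
  have hbound : ∀ x, 0 ≤ g x ∧ g x ≤ 1 := by
    intro x
    obtain ⟨m, h0, h4⟩ := hred x
    rw [← hshift m x]
    rcases hpieces _ h0 (by linarith) with h | h | h | h | h <;> constructor <;> linarith
  have hlip : ∀ x y, x ≤ y → |g x - g y| ≤ y - x := by
    intro x y hxy
    have hx := hbound x
    have hy := hbound y
    rcases le_total 1 (y - x) with h | h
    · rw [abs_le]
      constructor <;> linarith
    obtain ⟨m, h0, h4⟩ := hred x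
    rw [← hshift m x, ← hshift m y] at *
    rw [abs_le]
    rcases hpieces _ h0 (by linarith) with h1 | h1 | h1 | h1 | h1 <;>
    rcases hpieces (y - 4 * m) (by linarith) (by linarith) with h2 | h2 | h2 | h2 | h2 <;>
    constructor <;> linarith
  refine ⟨fun x => (hbound x).1, fun x => (hbound x).2, ?_, ?_, ?_⟩
  · intro x y
    rcases le_total x y with h | h
    · rw [abs_sub_comm x y, abs_of_nonneg (sub_nonneg.2 h)]
      exact hlip x y h
    · rw [abs_sub_comm (g x), abs_of_nonneg (sub_nonneg.2 h)]
      exact hlip y x h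
  · intro m x h0 h1
    rw [← hshift m x]
    exact hg01 _ ⟨by linarith, by linarith⟩
  · intro m x h0 h1
    rw [← hshift m x]
    exact hg23 _ ⟨by linarith, by linarith⟩

/-- A function that is `C^α` at a point with `α > 1` is approximated by an affine function up to
order `β` for some `1 < β ≤ 2`. -/
lemma HolderAt.exists_affine {Z : ℝ → ℝ} {α x₀ : ℝ} (h : HolderAt Z α x₀) (hα : 1 < α) :
    ∃ β c₀ c₁ D δ : ℝ, 1 < β ∧ 0 < D ∧ 0 < δ ∧
      ∀ x, |x - x₀| < δ → |Z x - (c₀ + c₁ * (x - x₀))| ≤ D * |x - x₀| ^ β := by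
  obtain ⟨P, C, δ, hC, hδ, -, hP⟩ := h
  obtain ⟨M, hM⟩ := (isCompact_Icc (a := (-1:ℝ)) (b := 1)).exists_bound_of_continuousOn
    (P.divX.divX.continuous.continuousOn)
  have hM0 : 0 ≤ M := (norm_nonneg _).trans (hM 0 (by constructor <;> norm_num))
  refine ⟨min α 2, P.coeff 0, P.divX.coeff 0, C + M, min δ 1, lt_min hα (by norm_num),
    by linarith, lt_min hδ one_pos, ?_⟩
  intro x hx
  set t := x - x₀ with ht
  have ht1 : |t| ≤ 1 := (hx.trans_le (min_le_right _ _)).le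
  have heval : P.eval t = P.coeff 0 + P.divX.coeff 0 * t + t ^ 2 * P.divX.divX.eval t := by
    conv_lhs => rw [← P.divX_mul_X_add, ← P.divX.divX_mul_X_add]
    simp only [Polynomial.eval_add, Polynomial.eval_mul, Polynomial.eval_X, Polynomial.eval_C]
    ring
  have h1 := hP x (hx.trans_le (min_le_left _ _))
  rw [← ht] at h1
  have h2 : |P.divX.divX.eval t| ≤ M := hM t (abs_le.1 ht1)
  have hpow : ∀ γ : ℝ, min α 2 ≤ γ → |t| ^ γ ≤ |t| ^ (min α 2) := fun γ hγ =>
    Real.rpow_le_rpow_of_exponent_ge_of_imp (abs_nonneg _) ht1 hγ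
      (fun _ h0 => absurd h0 (lt_of_lt_of_le (lt_min (by linarith) two_pos) hγ).ne')
  have h3 := hpow α (min_le_left _ _)
  have h4 := hpow 2 (min_le_right _ _)
  rw [Real.rpow_two] at h4
  calc |Z x - (P.coeff 0 + P.divX.coeff 0 * t)|
      = |(Z x - P.eval t) + t ^ 2 * P.divX.divX.eval t| := by rw [heval]; ring_nf
    _ ≤ |Z x - P.eval t| + |t ^ 2 * P.divX.divX.eval t| := abs_add_le _ _
    _ = |Z x - P.eval t| + |t| ^ 2 * |P.divX.divX.eval t| := by rw [abs_mul, abs_pow]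
    _ ≤ C * |t| ^ (min α 2) + |t| ^ (min α 2) * M := by
        refine add_le_add (h1.trans (mul_le_mul_of_nonneg_left h3 hC.le)) ?_
        exact mul_le_mul h4 h2 (abs_nonneg _) (Real.rpow_nonneg (abs_nonneg _) _)
    _ = (C + M) * |t| ^ (min α 2) := by ring

section WaveSeries

variable {g : ℝ → ℝ} {A B : ℕ → ℝ}

lemma le_mul_pow_of_decay (hdec : ∀ n, A (n + 1) < A n / 300) (k j : ℕ) :
    A (k + j) ≤ A k * (1 / 300) ^ j := by
  induction j with
  | zero => simp
  | succ j ih =>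
    have := hdec (k + j)
    rw [← add_assoc, pow_succ]
    linarith

lemma summable_of_decay (hA : ∀ n, 0 < A n) (hdec : ∀ n, A (n + 1) < A n / 300) :
    Summable A := by
  refine Summable.of_nonneg_of_le (fun n => (hA n).le) (fun n => ?_)
    ((summable_geometric_of_lt_one (by norm_num) (by norm_num : (1 / 300 : ℝ) < 1)).mul_left (A 0))
  simpa using le_mul_pow_of_decay hdec 0 n

lemma tsum_tail_le_of_decay (hA : ∀ n, 0 < A n) (hdec : ∀ n, A (n + 1) < A n / 300) (k : ℕ) :
    ∑' j, A (j + (k + 1)) ≤ A k / 299 := by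
  have hgeo := summable_geometric_of_lt_one (by norm_num) (by norm_num : (1 / 300 : ℝ) < 1)
  calc ∑' j, A (j + (k + 1)) ≤ ∑' j, A (k + 1) * (1 / 300) ^ j := by
        refine Summable.tsum_le_tsum (fun j => ?_)
          ((summable_nat_add_iff (k + 1)).2 (summable_of_decay hA hdec)) (hgeo.mul_left _)
        rw [add_comm j]
        exact le_mul_pow_of_decay hdec (k + 1) j
    _ = A (k + 1) * (300 / 299) := by
        rw [tsum_mul_left, tsum_geometric_of_lt_one (by norm_num) (by norm_num)]
        norm_num
    _ ≤ A k / 299 := by linarith [hdec k]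

lemma IsUnitWave.norm_mul_le (hg : IsUnitWave g) {c : ℝ} (hc : 0 < c) (x : ℝ) :
    ‖c * g x‖ ≤ c := by
  rw [Real.norm_of_nonneg (mul_nonneg hc.le (hg.nonneg x))]
  exact mul_le_of_le_one_right hc.le (hg.le_one x)

lemma IsUnitWave.continuous (hg : IsUnitWave g) : Continuous g :=
  (LipschitzWith.of_dist_le_mul (K := 1) fun x y => by
    simpa [Real.dist_eq] using hg.lipschitz x y).continuous

lemma IsUnitWave.continuous_series (hg : IsUnitWave g) (hA : ∀ n, 0 < A n) (hs : Summable A) :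
    Continuous fun x => ∑' n, A n * g (B n * x) := by
  have := hg.continuous
  exact continuous_tsum (fun n => by fun_prop) hs fun n x => hg.norm_mul_le (hA n) _

lemma IsUnitWave.abs_series_le (hg : IsUnitWave g) (hA : ∀ n, 0 < A n) (hs : Summable A) (x : ℝ) :
    |∑' n, A n * g (B n * x)| ≤ ∑' n, A n :=
  tsum_of_norm_bounded hs.hasSum fun n => hg.norm_mul_le (hA n) _

/-- At scale `1 / B k` the `k`-th term dominates the increments of the series. -/
lemma IsUnitWave.half_le_series_sub (hg : IsUnitWave g) (hA : ∀ n, 0 < A n) (hB : ∀ n, 0 < B n)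
    (hdec : ∀ n, A (n + 1) < A n / 300) {k : ℕ}
    (hgrow : ∑ i ∈ Finset.range k, A i * B i < A k * B k / 100) (m : ℤ) {x : ℝ}
    (hx : 4 * (m : ℝ) ≤ B k * x) (hx' : B k * x ≤ 4 * m + 1) :
    A k / 2 ≤ (∑' n, A n * g (B n * (x + 2 / B k))) - ∑' n, A n * g (B n * x) := by
  have hs := summable_of_decay hA hdec
  have hsum : ∀ y, Summable fun n => A n * g (B n * y) := fun y =>
    hs.of_norm_bounded fun n => hg.norm_mul_le (hA n) _
  have hBk := hB k
  set d : ℕ → ℝ := fun n => A n * g (B n * (x + 2 / B k)) - A n * g (B n * x) with hd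
  have hds : Summable d := (hsum _).sub (hsum _)
  rw [← (hsum _).tsum_sub (hsum _), ← hds.sum_add_tsum_nat_add (k + 1), Finset.sum_range_succ]
  have hlow : -(A k / 50) ≤ ∑ i ∈ Finset.range k, d i := by
    have hterm : ∀ i ∈ Finset.range k, -(2 / B k) * (A i * B i) ≤ d i := by
      intro i _
      have h := (abs_le.1 (hg.lipschitz (B i * (x + 2 / B k)) (B i * x))).1
      have he : B i * (x + 2 / B k) - B i * x = B i * (2 / B k) := by ring
      rw [he, abs_of_nonneg (by have := hB i; positivity)] at h
      have := mul_le_mul_of_nonneg_left h (hA i).le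
      simp only [hd]
      linarith
    refine le_trans ?_ (Finset.sum_le_sum hterm)
    rw [← Finset.mul_sum]
    have h := mul_le_mul_of_nonneg_left hgrow.le (by positivity : 0 ≤ 2 / B k)
    have he : 2 / B k * (A k * B k / 100) = A k / 50 := by field_simp; ring
    linarith
  have hmid : d k = A k := by
    have he : B k * (x + 2 / B k) = B k * x + 2 := by field_simp
    simp only [hd]
    rw [hg.zero m _ hx hx', he, hg.one m _ (by linarith) (by linarith)]
    ring
  have hhigh : -(A k / 299) ≤ ∑' j, d (j + (k + 1)) := by
    have hb : ‖∑' j, d (j + (k + 1))‖ ≤ ∑' j, A (j + (k + 1)) := by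
      refine tsum_of_norm_bounded ((summable_nat_add_iff (k + 1)).2 hs).hasSum fun j => ?_
      have h0 := hA (j + (k + 1))
      simp only [hd]
      rw [← mul_sub, norm_mul, Real.norm_of_nonneg h0.le]
      refine mul_le_of_le_one_right h0.le ?_
      rw [Real.norm_eq_abs, abs_le]
      constructor <;> linarith [hg.nonneg (B (j + (k + 1)) * x), hg.le_one (B (j + (k + 1)) * x),
        hg.nonneg (B (j + (k + 1)) * (x + 2 / B k)), hg.le_one (B (j + (k + 1)) * (x + 2 / B k))]
    have h1 := tsum_tail_le_of_decay hA hdec k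
    linarith [(abs_le.1 (show |_| ≤ _ from hb)).1]
  have := hA k
  rw [hmid]
  linarith

end WaveSeries

/-- If an affine function approximates a primitive `Z` of `G` at `x₀` to order `β`, an increment
of `G` over a distance `2 / b` near `x₀` is at most of order `b ^ (1 - β)`. -/
lemma le_of_affine_approx {G Z : ℝ → ℝ} (hG : Continuous G) (hZ : ∀ x, Z x = ∫ t in (0:ℝ)..x, G t)
    {x₀ β c₀ c₁ D δ b v : ℝ} (hβ : 0 < β) (hD : 0 < D) (hb : 0 < b) (hbδ : 4 / b < δ)
    (hZβ : ∀ x, |x - x₀| < δ → |Z x - (c₀ + c₁ * (x - x₀))| ≤ D * |x - x₀| ^ β)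
    (hinc : ∀ (m : ℤ) (x : ℝ), 4 * (m : ℝ) ≤ b * x → b * x ≤ 4 * m + 1 →
      v ≤ G (x + 2 / b) - G x) :
    v / b ≤ 4 * (D * (4 / b) ^ β) := by
  set m : ℤ := ⌊b * x₀ / 4⌋ with hm
  have hm1 : 4 * (m : ℝ) ≤ b * x₀ := by linarith [Int.floor_le (b * x₀ / 4)]
  have hm2 : b * x₀ ≤ 4 * m + 4 := by linarith [Int.lt_floor_add_one (b * x₀ / 4)]
  set p : ℝ := 4 * m / b with hp
  have hbp : b * p = 4 * m := by rw [hp]; field_simp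
  have hapx : ∀ s : ℝ, 0 ≤ s → s ≤ 3 →
      |Z (p + s / b) - (c₀ + c₁ * (p + s / b - x₀))| ≤ D * (4 / b) ^ β := by
    intro s hs0 hs3
    have hdist : |p + s / b - x₀| ≤ 4 / b := by
      have he : p + s / b - x₀ = (4 * m + s - b * x₀) / b := by rw [hp]; field_simp
      rw [he, abs_div, abs_of_pos hb]
      refine div_le_div_of_nonneg_right ?_ hb.le
      rw [abs_le]
      constructor <;> linarith
    refine (hZβ _ (hdist.trans_lt hbδ)).trans (mul_le_mul_of_nonneg_left ?_ hD.le)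
    exact Real.rpow_le_rpow (abs_nonneg _) hdist hβ.le
  have hint : ∀ u w, IntervalIntegrable G volume u w := fun u w => hG.intervalIntegrable u w
  have hZsub : ∀ u w, Z w - Z u = ∫ t in u..w, G t := fun u w => by
    rw [hZ, hZ, intervalIntegral.integral_interval_sub_left (hint _ _) (hint _ _)]
  have hshift : Z (p + 3 / b) - Z (p + 2 / b) = ∫ t in p..(p + 1 / b), G (t + 2 / b) := by
    rw [hZsub, intervalIntegral.integral_comp_add_right]
    congr 1
    ring
  have hlow : v / b ≤ (Z (p + 3 / b) - Z (p + 2 / b)) - (Z (p + 1 / b) - Z p) := by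
    have hG' : Continuous fun t => G (t + 2 / b) := by fun_prop
    rw [hshift, hZsub p, ← intervalIntegral.integral_sub (hG'.intervalIntegrable _ _) (hint _ _)]
    have hconst : v / b = ∫ _ in p..(p + 1 / b), v := by
      rw [intervalIntegral.integral_const, smul_eq_mul]
      ring
    rw [hconst]
    refine intervalIntegral.integral_mono_on (by linarith [show 0 < 1 / b by positivity])
      (by simp) ((hG'.sub hG).intervalIntegrable _ _) fun t ht => hinc m t ?_ ?_
    · rw [← hbp]
      exact mul_le_mul_of_nonneg_left ht.1 hb.le
    · have h := mul_le_mul_of_nonneg_left ht.2 hb.le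
      rwa [mul_add, hbp, mul_one_div_cancel hb.ne'] at h
  have h0 := abs_le.1 (hapx 0 (by norm_num) (by norm_num))
  have h1 := abs_le.1 (hapx 1 (by norm_num) (by norm_num))
  have h2 := abs_le.1 (hapx 2 (by norm_num) (by norm_num))
  have h3 := abs_le.1 (hapx 3 (by norm_num) (by norm_num))
  rw [zero_div, add_zero] at h0
  have haff : c₁ * (p + 3 / b - x₀) - c₁ * (p + 2 / b - x₀) - c₁ * (p + 1 / b - x₀)
      + c₁ * (p - x₀) = 0 := by ring
  linarith [h0.1, h0.2, h1.1, h1.2, h2.1, h2.2, h3.1, h3.2]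

/-- A sequence decaying slower than every power of `B` is not `O(B ^ (1 - β))` for `β > 1`. -/
lemma false_of_power_decay {A B : ℕ → ℝ} (hB : Tendsto B atTop atTop) {β D : ℝ} (hβ : 1 < β)
    (hlow : ∀ᶠ k : ℕ in atTop, (4 * B k) ^ (-1 / ((k : ℝ) + 1)) < A k)
    (hup : ∀ᶠ k in atTop, A k / 2 / B k ≤ 4 * (D * (4 / B k) ^ β)) : False := by
  have hX : Tendsto (fun k => 4 * B k) atTop atTop := hB.const_mul_atTop (by norm_num)
  have hpow := (tendsto_rpow_atTop (y := (β - 1) / 2) (by linarith)).comp hX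
  have hexp : ∀ᶠ k : ℕ in atTop, 1 / ((k : ℝ) + 1) < (β - 1) / 2 :=
    tendsto_one_div_add_atTop_nhds_zero_nat.eventually (gt_mem_nhds (by linarith))
  obtain ⟨k, hlk, huk, hpk, hek, hBk⟩ := (hlow.and (hup.and ((hpow.eventually_gt_atTop
    (2 * D * 16 ^ β)).and (hexp.and (hB.eventually_ge_atTop 1))))).exists
  have hB0 : 0 < B k := by linarith
  simp only [Function.comp_apply] at hpk
  set X := 4 * B k with hXdef
  have hX0 : 0 < X := by linarith
  have hdiv : 4 / B k = 16 / X := by rw [hXdef]; field_simp; norm_num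
  rw [hdiv, Real.div_rpow (by norm_num) hX0.le, div_le_iff₀ hB0] at huk
  have hAk : A k ≤ 2 * D * 16 ^ β * (X ^ β)⁻¹ * X := by
    have : 4 * (D * (16 ^ β / X ^ β)) * B k = D * 16 ^ β * (X ^ β)⁻¹ * X := by
      rw [hXdef]; ring
    linarith
  have h1 : X ^ (-((β - 1) / 2)) ≤ X ^ (-1 / ((k : ℝ) + 1)) := by
    refine Real.rpow_le_rpow_of_exponent_le (by linarith) ?_
    rw [neg_div]
    linarith
  have h2 : X ^ (-((β - 1) / 2)) = X ^ ((β - 1) / 2) * ((X ^ β)⁻¹ * X) := by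
    rw [← Real.rpow_neg hX0.le]
    nth_rewrite 4 [← Real.rpow_one X]
    rw [← Real.rpow_add hX0, ← Real.rpow_add hX0]
    congr 1
    ring
  have h3 : 0 < (X ^ β)⁻¹ * X := by positivity
  have h4 := mul_lt_mul_of_pos_right hpk h3
  rw [← h2] at h4
  linarith

/-- The Weierstrass-type construction of Proposition `homone`: with `g` the `4`-periodic
piecewise-linear tent-like function (equal to `0` on `[0,1]`, `1` on `[2,3]`, linear on
`[1,2]` and `[3,4]`), and sequences `(aₙ) ⊆ (0,1]`, `(bₙ) ⊆ ℕ` satisfying `a₁ = 1`, `b₁ = 4`,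
and for every `n > 1`: `bₙ ≡ 3 (mod 4)`, `a_{n-1}/300 > aₙ > (4bₙ)^{-1/n}` and
`aₙbₙ/100 > Σ_{n'<n} a_{n'} b_{n'}`, the functions `G(x) = Σₙ aₙ g(bₙ x)` and
`Z(x) = ∫₀ˣ G` satisfy: `G` is continuous, `Z` is differentiable with `Z' = G`, and
`h_Z(x) = 1` for every `x ∈ [0,1]`. -/
theorem weierstrass_monofractal
    (g : ℝ → ℝ) (hgper : ∀ x, g (x + 4) = g x)
    (hg01 : ∀ x ∈ Set.Icc (0:ℝ) 1, g x = 0)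
    (hg23 : ∀ x ∈ Set.Icc (2:ℝ) 3, g x = 1)
    (hg12 : ∀ x ∈ Set.Icc (1:ℝ) 2, g x = x - 1)
    (hg34 : ∀ x ∈ Set.Icc (3:ℝ) 4, g x = 4 - x)
    (a : ℕ → ℝ) (b : ℕ → ℕ)
    (hapos : ∀ n, 1 ≤ n → 0 < a n) (haone : ∀ n, 1 ≤ n → a n ≤ 1)
    (ha1 : a 1 = 1) (hb1 : b 1 = 4)
    (hbmod : ∀ n, 2 ≤ n → b n % 4 = 3)
    (hadec : ∀ n, 1 ≤ n → a (n + 1) < a n / 300)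
    (halow : ∀ n, 1 ≤ n →
      ((4 * (b (n + 1) : ℝ))) ^ (-1 / ((n : ℝ) + 1)) < a (n + 1))
    (hgrow : ∀ n, 1 ≤ n →
      (∑ k ∈ Finset.Icc 1 n, a k * (b k : ℝ)) < a (n + 1) * (b (n + 1) : ℝ) / 100)
    (G Z : ℝ → ℝ)
    (hG : ∀ x, G x = ∑' n : ℕ, a (n + 1) * g ((b (n + 1) : ℝ) * x))
    (hZ : ∀ x, Z x = ∫ t in (0:ℝ)..x, G t) :
    Continuous G ∧ (∀ x, HasDerivAt Z (G x) x) ∧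
    ∀ x ∈ Set.Icc (0:ℝ) 1, holderExp Z x = (1 : EReal) := by
  have hg := isUnitWave_of_periodic g hgper hg01 hg23 hg12 hg34
  set A : ℕ → ℝ := fun n => a (n + 1) with hAdef
  set B : ℕ → ℝ := fun n => (b (n + 1) : ℝ) with hBdef
  have hA : ∀ n, 0 < A n := fun n => hapos _ (by omega)
  have hdec : ∀ n, A (n + 1) < A n / 300 := fun n => hadec _ (by omega)
  have hB : ∀ n, 0 < B n := by
    intro n
    have : 0 < b (n + 1) := by
      rcases Nat.eq_zero_or_pos n with rfl | hn
      · simp [hb1]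
      · have := hbmod (n + 1) (by omega)
        omega
    exact Nat.cast_pos.2 this
  have hs := summable_of_decay hA hdec
  have hGeq : G = fun x => ∑' n, A n * g (B n * x) := funext hG
  have hGc : Continuous G := hGeq ▸ hg.continuous_series hA hs
  have hsums : ∀ k, 1 ≤ k → ∑ i ∈ Finset.range k, A i * B i < A k * B k / 100 := by
    intro k hk
    have h := hgrow k hk
    rwa [← Finset.Ico_add_one_right_eq_Icc, Finset.sum_Ico_eq_sum_range,
      Finset.sum_congr rfl (g := fun i => A i * B i)
        (fun i _ => by simp only [hAdef, hBdef, add_comm 1 i])] at h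
  have hZd : ∀ x, HasDerivAt Z (G x) x := by
    intro x
    rw [show Z = fun x => ∫ t in (0:ℝ)..x, G t from funext hZ]
    exact intervalIntegral.integral_hasDerivAt_right (hGc.intervalIntegrable _ _)
      (hGc.stronglyMeasurableAtFilter _ _) hGc.continuousAt
  refine ⟨hGc, hZd, fun x₀ _ => le_antisymm ?_ ?_⟩
  · refine sSup_le ?_
    rintro _ ⟨α, -, hα, rfl⟩
    refine EReal.coe_le_coe_iff.2 (not_lt.1 fun hα1 => ?_)
    obtain ⟨β, c₀, c₁, D, δ, hβ, hD, hδ, hZβ⟩ := hα.exists_affine hα1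
    have hBinf : Tendsto B atTop atTop := by
      have h300 : Tendsto (fun n : ℕ => (300 : ℝ) ^ n) atTop atTop :=
        tendsto_pow_atTop_atTop_of_one_lt (by norm_num)
      refine tendsto_atTop_mono' _ ?_ h300
      filter_upwards [eventually_ge_atTop 1] with k hk
      have hAk : A k ≤ (1 / 300) ^ k := by
        simpa [hAdef, ha1] using le_mul_pow_of_decay hdec 0 k
      have h0 : A 0 * B 0 ≤ ∑ i ∈ Finset.range k, A i * B i :=
        Finset.single_le_sum (f := fun i => A i * B i)
          (fun i _ => (mul_pos (hA i) (hB i)).le) (Finset.mem_range.2 hk)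
      have h00 : A 0 * B 0 = 4 := by simp [hAdef, hBdef, ha1, hb1]
      have h1 : 1 ≤ (1 / 300) ^ k * B k := by
        linarith [hsums k hk, mul_le_mul_of_nonneg_right hAk (hB k).le]
      rwa [one_div, inv_pow, ← div_eq_inv_mul, one_le_div (by positivity)] at h1
    refine false_of_power_decay (A := A) (D := D) hBinf hβ ?_ ?_
    · filter_upwards [eventually_ge_atTop 1] with k hk
      exact halow k hk
    · have hsmall : ∀ᶠ k in atTop, 4 / B k < δ :=
        (hBinf.const_div_atTop 4).eventually (gt_mem_nhds hδ)
      filter_upwards [hsmall, eventually_ge_atTop 1] with k hkδ hk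
      refine le_of_affine_approx hGc hZ (by linarith) hD (hB k) hkδ hZβ fun m x hx hx' => ?_
      rw [hG, hG]
      exact hg.half_le_series_sub hA hB hdec (hsums k hk) m hx hx'
  · refine le_sSup ⟨1, zero_le_one, ?_, rfl⟩
    have hpos : 0 < ∑' n, A n := hs.tsum_pos (fun n => (hA n).le) 0 (hA 0)
    refine ⟨Polynomial.C (Z x₀), ∑' n, A n, 1, hpos, one_pos, Or.inr (by simp), fun x _ => ?_⟩
    rw [Polynomial.eval_C, Real.rpow_one]
    exact Convex.norm_image_sub_le_of_norm_hasDerivWithin_le (s := univ)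
      (fun y _ => (hZd y).hasDerivWithinAt)
      (fun y _ => by rw [hG y]; exact hg.abs_series_le hA hs y) convex_univ (mem_univ _)
      (mem_univ _)
end
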